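/- Let T > 0 and let {u_ε}_{ε>0} be the family of smooth solutions to the viscous approximations of the short pulse equation, uniformly bounded in L^∞((0,T)×(0,∞)). Then there exists a subsequence {u_{ε_k}}_{k∈ℕ} and a limit function u ∈ L^∞((0,T)×(0,∞)) such that u_{ε_k} → u almost everywhere and in L^p_loc((0,T)×(0,∞)) for every 1 ≤ p < ∞. Moreover P_{ε_k} → P almost everywhere and in L^p_loc(0,T; W^{1,p}_loc(0,∞)) for every 1 ≤ p < ∞, where P(t,x) = ∫_0^x u(t,y) dy, and the limit u satisfies the entropy inequality of the initial-boundary value problem. -/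

import Mathlib

open MeasureTheory Set Filter

/-- `P(t,x) = ∫_0^x u(t,y) dy`, the nonlocal term of the short pulse equation. -/
noncomputable def spePrimitive (u : ℝ → ℝ → ℝ) (t x : ℝ) : ℝ := ∫ y in (0:ℝ)..x, u t y

section partials
variable {F : ℝ → ℝ → ℝ}

lemma hasDerivAt_left_of_differentiableAt {t x : ℝ}
    (hF : DifferentiableAt ℝ (Function.uncurry F) (t, x)) :
    HasDerivAt (fun s => F s x) (fderiv ℝ (Function.uncurry F) (t, x) (1, 0)) t := by
  have h1 : HasDerivAt (fun s : ℝ => (s, x)) ((1 : ℝ), (0 : ℝ)) t :=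
    (hasDerivAt_id t).prodMk (hasDerivAt_const t x)
  exact hF.hasFDerivAt.comp_hasDerivAt t h1

lemma hasDerivAt_right_of_differentiableAt {t x : ℝ}
    (hF : DifferentiableAt ℝ (Function.uncurry F) (t, x)) :
    HasDerivAt (F t) (fderiv ℝ (Function.uncurry F) (t, x) (0, 1)) x := by
  have h1 : HasDerivAt (fun y : ℝ => (t, y)) ((0 : ℝ), (1 : ℝ)) x :=
    (hasDerivAt_const x t).prodMk (hasDerivAt_id x)
  exact hF.hasFDerivAt.comp_hasDerivAt x h1

lemma ContDiff.hasDerivAt_left (hF : ContDiff ℝ 1 (Function.uncurry F)) (t x : ℝ) :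
    HasDerivAt (fun s => F s x) (deriv (fun s => F s x) t) t :=
  (hasDerivAt_left_of_differentiableAt
    (hF.differentiable (by norm_num) _)).differentiableAt.hasDerivAt

lemma ContDiff.hasDerivAt_right (hF : ContDiff ℝ 1 (Function.uncurry F)) (t x : ℝ) :
    HasDerivAt (F t) (deriv (F t) x) x :=
  (hasDerivAt_right_of_differentiableAt
    (hF.differentiable (by norm_num) _)).differentiableAt.hasDerivAt

lemma ContDiff.deriv_left {n m : WithTop ℕ∞} (hF : ContDiff ℝ n (Function.uncurry F)) (hmn : m + 1 ≤ n) :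
    ContDiff ℝ m (Function.uncurry fun t x => deriv (fun s => F s x) t) := by
  have hn : n ≠ 0 := by
    rintro h
    simp [h] at hmn
  have h : (Function.uncurry fun t x => deriv (fun s => F s x) t)
      = fun p => fderiv ℝ (Function.uncurry F) p (1, 0) := by
    ext ⟨t, x⟩
    exact (hasDerivAt_left_of_differentiableAt (hF.differentiable hn _)).deriv
  rw [h]
  exact (hF.fderiv_right hmn).clm_apply contDiff_const

lemma ContDiff.deriv_right {n m : WithTop ℕ∞} (hF : ContDiff ℝ n (Function.uncurry F)) (hmn : m + 1 ≤ n) :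
    ContDiff ℝ m (Function.uncurry fun t x => deriv (F t) x) := by
  have hn : n ≠ 0 := by
    rintro h
    simp [h] at hmn
  have h : (Function.uncurry fun t x => deriv (F t) x)
      = fun p => fderiv ℝ (Function.uncurry F) p (0, 1) := by
    ext ⟨t, x⟩
    exact (hasDerivAt_right_of_differentiableAt (hF.differentiable hn _)).deriv
  rw [h]
  exact (hF.fderiv_right hmn).clm_apply contDiff_const

/-- Divergence theorem on a rectangle, for partial derivatives of `C¹` functions. -/
lemma integral_rect_divergence {f g : ℝ → ℝ → ℝ} (hf : ContDiff ℝ 1 (Function.uncurry f))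
    (hg : ContDiff ℝ 1 (Function.uncurry g)) {τ R : ℝ} (hτ : 0 ≤ τ) (hR : 0 ≤ R) :
    ∫ p in Icc 0 τ ×ˢ Icc 0 R, (deriv (fun s => f s p.2) p.1 + deriv (g p.1) p.2)
      = (∫ t in (0:ℝ)..τ, g t R) - (∫ t in (0:ℝ)..τ, g t 0)
        + (∫ x in (0:ℝ)..R, f τ x) - ∫ x in (0:ℝ)..R, f 0 x := by
  have h1 : (1 : WithTop ℕ∞) ≠ 0 := by norm_num
  have hdf := hf.differentiable h1
  have hdg := hg.differentiable h1
  have h := integral_divergence_prod_Icc_of_hasFDerivAt_of_le (Function.uncurry f)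
    (Function.uncurry g) (fderiv ℝ (Function.uncurry f)) (fderiv ℝ (Function.uncurry g))
    (0, 0) (τ, R) ⟨hτ, hR⟩ hf.continuous.continuousOn hg.continuous.continuousOn
    (fun x _ => (hdf x).hasFDerivAt) (fun x _ => (hdg x).hasFDerivAt) (by
      apply Continuous.integrableOn_Icc
      exact ((hf.continuous_fderiv h1).clm_apply continuous_const).add
        ((hg.continuous_fderiv h1).clm_apply continuous_const))
  rw [Icc_prod_Icc]
  refine Eq.trans ?_ h
  congr 1
  ext ⟨t, x⟩
  rw [(hasDerivAt_left_of_differentiableAt (hdf (t, x))).deriv,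
    (hasDerivAt_right_of_differentiableAt (hdg (t, x))).deriv]

end partials

section kato

/-- Pointwise algebra behind the viscous entropy inequality for `η(D) = √(D² + δ²)`. -/
lemma regularized_abs_algebra {D Dt Dx Dxx a ax S ε δ N : ℝ} (hε : 0 ≤ ε) (hδ : 0 < δ)
    (hN : 0 < N) (hN2 : N ^ 2 = D ^ 2 + δ ^ 2) (hpde : Dt + (ax * D + a * Dx) = S + ε * Dxx) :
    D * Dt / N + (ax * N + a * (D * Dx / N))
      - ε * (((Dx * Dx + D * Dxx) * N - D * Dx * (D * Dx / N)) / N ^ 2)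
      ≤ D / N * S + |ax| * δ := by
  have hS : S = Dt + (ax * D + a * Dx) - ε * Dxx := by linarith
  have hδN : δ ≤ N := by
    by_contra h
    push Not at h
    nlinarith [sq_nonneg D]
  have e1 : D * Dt / N + (ax * N + a * (D * Dx / N))
      - ε * (((Dx * Dx + D * Dxx) * N - D * Dx * (D * Dx / N)) / N ^ 2)
      = D / N * S + ax * (δ ^ 2 / N) - ε * (Dx ^ 2 * δ ^ 2 / N ^ 3) := by
    have h3 : δ ^ 2 = N ^ 2 - D ^ 2 := by linarith
    rw [hS, h3]
    field_simp
    ring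
  have h4 : δ ^ 2 / N ≤ δ := by
    rw [div_le_iff₀ hN]; nlinarith
  have h5 : 0 ≤ δ ^ 2 / N := by positivity
  have h6 : 0 ≤ ε * (Dx ^ 2 * δ ^ 2 / N ^ 3) := by positivity
  have h7 : ax * (δ ^ 2 / N) ≤ |ax| * δ :=
    (mul_le_mul_of_nonneg_right (le_abs_self ax) h5).trans
      (mul_le_mul_of_nonneg_left h4 (abs_nonneg _))
  rw [e1]; linarith

variable {D a S Φ : ℝ → ℝ → ℝ} {ε τ R : ℝ}

lemma contDiff_regularized_abs {n : WithTop ℕ∞} (hD : ContDiff ℝ n (Function.uncurry D)) {δ : ℝ}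
    (hδ : 0 < δ) :
    ContDiff ℝ n (Function.uncurry fun t x => √(D t x ^ 2 + δ ^ 2)) := by
  have : (Function.uncurry fun t x => √(D t x ^ 2 + δ ^ 2))
      = fun p => √(Function.uncurry D p ^ 2 + δ ^ 2) := by
    ext ⟨t, x⟩; rfl
  rw [this]
  exact ((hD.pow 2).add contDiff_const).sqrt (fun p => by positivity)

/-- Weighted viscous entropy inequality for `D_t + (a D)_x = S + ε D_xx` with the regularized
entropy `√(D² + δ²)`. -/
lemma regularized_kato (hD : ContDiff ℝ 2 (Function.uncurry D))
    (ha : ContDiff ℝ 1 (Function.uncurry a)) (hS : Continuous (Function.uncurry S))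
    (hΦ : ContDiff ℝ 2 (Function.uncurry Φ)) (hε : 0 ≤ ε) (hτ : 0 ≤ τ) (hR : 0 ≤ R)
    (hΦ0 : ∀ t ∈ Icc 0 τ, ∀ x ∈ Icc 0 R, 0 ≤ Φ t x)
    (hΦl : ∀ t, Φ t 0 = 0) (hΦr : ∀ t, Φ t R = 0) (hΦr' : ∀ t, deriv (Φ t) R = 0)
    (hpde : ∀ t ∈ Icc 0 τ, ∀ x ∈ Icc 0 R, deriv (fun s => D s x) t
      + (deriv (a t) x * D t x + a t x * deriv (D t) x) = S t x + ε * deriv (deriv (D t)) x)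
    {δ : ℝ} (hδ : 0 < δ) :
    ∫ x in (0:ℝ)..R, √(D τ x ^ 2 + δ ^ 2) * Φ τ x
      ≤ (∫ x in (0:ℝ)..R, √(D 0 x ^ 2 + δ ^ 2) * Φ 0 x)
        + (∫ p in Icc 0 τ ×ˢ Icc 0 R,
            (√(D p.1 p.2 ^ 2 + δ ^ 2) * (deriv (fun s => Φ s p.2) p.1
                + a p.1 p.2 * deriv (Φ p.1) p.2 + ε * deriv (deriv (Φ p.1)) p.2)
              + (D p.1 p.2 / √(D p.1 p.2 ^ 2 + δ ^ 2) * S p.1 p.2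
                + |deriv (a p.1) p.2| * δ) * Φ p.1 p.2))
        + ε * ∫ t in (0:ℝ)..τ, √(D t 0 ^ 2 + δ ^ 2) * deriv (Φ t) 0 := by
  set N : ℝ → ℝ → ℝ := fun t x => √(D t x ^ 2 + δ ^ 2) with hNdef
  have hNpos : ∀ t x, 0 < N t x := fun t x => Real.sqrt_pos.2 (by positivity)
  have hN2 : ∀ t x, N t x ^ 2 = D t x ^ 2 + δ ^ 2 := fun t x => Real.sq_sqrt (by positivity)
  have hNc : ContDiff ℝ 2 (Function.uncurry N) := contDiff_regularized_abs hD hδ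
  have hD1 : ContDiff ℝ 1 (Function.uncurry D) := hD.of_le (by norm_num)
  have hΦ1 : ContDiff ℝ 1 (Function.uncurry Φ) := hΦ.of_le (by norm_num)
  have h2 : (1 : WithTop ℕ∞) + 1 ≤ 2 := by norm_num
  have hDx : ContDiff ℝ 1 (Function.uncurry fun t x => deriv (D t) x) := hD.deriv_right h2
  have hΦx : ContDiff ℝ 1 (Function.uncurry fun t x => deriv (Φ t) x) := hΦ.deriv_right h2
  set Nx : ℝ → ℝ → ℝ := fun t x => D t x * deriv (D t) x / N t x with hNxdef
  have hN1 : ContDiff ℝ 1 (Function.uncurry N) := hNc.of_le (by norm_num)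
  have hNxc : ContDiff ℝ 1 (Function.uncurry Nx) :=
    (hD1.mul hDx).div hN1 (fun p => (hNpos p.1 p.2).ne')
  have hNt_d : ∀ t x, HasDerivAt (fun s => N s x)
      (D t x * deriv (fun s => D s x) t / N t x) t := by
    intro t x
    have h := (((hD1.hasDerivAt_left t x).pow 2).add_const (δ ^ 2)).sqrt
      (by simp only [Pi.pow_apply]; positivity)
    refine h.congr_deriv ?_
    have := (hNpos t x).ne'
    simp only [hNdef] at this ⊢
    simp only [Pi.pow_apply]
    field_simp
    norm_num
    ring
  have hNx_d : ∀ t x, HasDerivAt (N t) (Nx t x) x := by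
    intro t x
    have h := (((hD1.hasDerivAt_right t x).pow 2).add_const (δ ^ 2)).sqrt
      (by simp only [Pi.pow_apply]; positivity)
    refine h.congr_deriv ?_
    have := (hNpos t x).ne'
    simp only [hNdef, hNxdef] at this ⊢
    simp only [Pi.pow_apply]
    field_simp
    norm_num
    ring
  have hNxx_d : ∀ t x, HasDerivAt (Nx t)
      (((deriv (D t) x * deriv (D t) x + D t x * deriv (deriv (D t)) x) * N t x
        - D t x * deriv (D t) x * (D t x * deriv (D t) x / N t x)) / N t x ^ 2) x := by
    intro t x
    exact ((hD1.hasDerivAt_right t x).mul (hDx.hasDerivAt_right t x)).div (hNx_d t x)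
      (hNpos t x).ne'
  set f : ℝ → ℝ → ℝ := fun t x => N t x * Φ t x
  set g : ℝ → ℝ → ℝ := fun t x => a t x * N t x * Φ t x - ε * (Nx t x * Φ t x)
    + ε * (N t x * deriv (Φ t) x)
  have hf : ContDiff ℝ 1 (Function.uncurry f) := hN1.mul hΦ1
  have hg : ContDiff ℝ 1 (Function.uncurry g) :=
    (((ha.mul hN1).mul hΦ1).sub (contDiff_const.mul (hNxc.mul hΦ1))).add
      (contDiff_const.mul (hN1.mul hΦx))
  have hdiv := integral_rect_divergence hf hg hτ hR
  have hft : ∀ t x, deriv (fun s => f s x) t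
      = D t x * deriv (fun s => D s x) t / N t x * Φ t x + N t x * deriv (fun s => Φ s x) t :=
    fun t x => ((hNt_d t x).mul (hΦ1.hasDerivAt_left t x)).deriv
  have hgx : ∀ t x, deriv (g t) x
      = ((deriv (a t) x * N t x + a t x * Nx t x) * Φ t x + a t x * N t x * deriv (Φ t) x)
        - ε * ((((deriv (D t) x * deriv (D t) x + D t x * deriv (deriv (D t)) x) * N t x
        - D t x * deriv (D t) x * (D t x * deriv (D t) x / N t x)) / N t x ^ 2) * Φ t x
          + Nx t x * deriv (Φ t) x)
        + ε * (Nx t x * deriv (Φ t) x + N t x * deriv (deriv (Φ t)) x) := by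
    intro t x
    exact (((((ha.hasDerivAt_right t x).mul (hNx_d t x)).mul (hΦ1.hasDerivAt_right t x)).sub
      (((hNxx_d t x).mul (hΦ1.hasDerivAt_right t x)).const_mul ε)).add
      (((hNx_d t x).mul (hΦx.hasDerivAt_right t x)).const_mul ε)).deriv
  have hgR : ∀ t, g t R = 0 := by intro t; simp [g, hΦr, hΦr']
  have hg0 : ∀ t, g t 0 = ε * (N t 0 * deriv (Φ t) 0) := by intro t; simp [g, hΦl]
  simp only [hgR, hg0, intervalIntegral.integral_zero, intervalIntegral.integral_const_mul] at hdiv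
  have hmono : ∫ p in Icc 0 τ ×ˢ Icc 0 R, (deriv (fun s => f s p.2) p.1 + deriv (g p.1) p.2)
      ≤ ∫ p in Icc 0 τ ×ˢ Icc 0 R,
            (N p.1 p.2 * (deriv (fun s => Φ s p.2) p.1
                + a p.1 p.2 * deriv (Φ p.1) p.2 + ε * deriv (deriv (Φ p.1)) p.2)
              + (D p.1 p.2 / N p.1 p.2 * S p.1 p.2
                + |deriv (a p.1) p.2| * δ) * Φ p.1 p.2) := by
    have hK : IsCompact (Icc 0 τ ×ˢ Icc 0 R) := isCompact_Icc.prod isCompact_Icc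
    have c1 := (hf.deriv_left (m := 0) (by norm_num)).continuous
    have c2 := (hg.deriv_right (m := 0) (by norm_num)).continuous
    have c3 := (hΦ1.deriv_left (m := 0) (by norm_num)).continuous
    have c5 := (hΦx.deriv_right (m := 0) (by norm_num)).continuous
    have c6 := (ha.deriv_right (m := 0) (by norm_num)).continuous
    refine setIntegral_mono_on ((c1.add c2).continuousOn.integrableOn_compact hK) ?_
      (measurableSet_Icc.prod measurableSet_Icc) ?_
    · refine Continuous.continuousOn ?_ |>.integrableOn_compact hK
      exact (hN1.continuous.mul ((c3.add (ha.continuous.mul hΦx.continuous)).add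
        (continuous_const.mul c5))).add ((((hD1.continuous.div hN1.continuous
          (fun p => (hNpos p.1 p.2).ne')).mul hS).add (c6.abs.mul continuous_const)).mul
          hΦ1.continuous)
    · rintro ⟨t, x⟩ ⟨ht, hx⟩
      simp only at ht hx
      have key := regularized_abs_algebra hε hδ (hNpos t x) (hN2 t x) (hpde t ht x hx)
      have key' := mul_le_mul_of_nonneg_right key (hΦ0 t ht x hx)
      simp only [hft, hgx]
      simp only [hNxdef] at key' ⊢
      nlinarith [key']
  linarith

end kato

section katolimit

lemma tendsto_regularized_abs (d : ℝ) :
    Tendsto (fun n : ℕ => √(d ^ 2 + (1 / ((n : ℝ) + 1)) ^ 2)) atTop (nhds |d|) := by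
  have h : Tendsto (fun n : ℕ => √(d ^ 2 + (1 / ((n : ℝ) + 1)) ^ 2)) atTop
      (nhds √(d ^ 2 + 0 ^ 2)) :=
    (tendsto_const_nhds.add ((tendsto_one_div_add_atTop_nhds_zero_nat).pow 2)).sqrt
  simpa [Real.sqrt_sq_eq_abs] using h

lemma tendsto_regularized_sign (d : ℝ) :
    Tendsto (fun n : ℕ => d / √(d ^ 2 + (1 / ((n : ℝ) + 1)) ^ 2)) atTop (nhds (Real.sign d)) := by
  rcases eq_or_ne d 0 with rfl | hd
  · simp
  · have h := (tendsto_const_nhds (x := d)).div (tendsto_regularized_abs d) (abs_ne_zero.2 hd)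
    have e : Real.sign d = d / |d| := by
      rcases lt_or_gt_of_ne hd with h' | h'
      · rw [Real.sign_of_neg h', abs_of_neg h']; field_simp
      · rw [Real.sign_of_pos h', abs_of_pos h']; field_simp
    rw [e]
    exact h

lemma regularized_abs_le (d : ℝ) (n : ℕ) :
    √(d ^ 2 + (1 / ((n : ℝ) + 1)) ^ 2) ≤ √(d ^ 2 + 1) := by
  apply Real.sqrt_le_sqrt
  have h : 1 / ((n : ℝ) + 1) ≤ 1 := by
    rw [div_le_one (by positivity)]; linarith [n.cast_nonneg (α := ℝ)]
  have h0 : 0 ≤ 1 / ((n : ℝ) + 1) := by positivity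
  nlinarith

lemma abs_regularized_sign_le (d δ : ℝ) : |d / √(d ^ 2 + δ ^ 2)| ≤ 1 := by
  rw [abs_div, abs_of_nonneg (Real.sqrt_nonneg _)]
  apply div_le_one_of_le₀ _ (Real.sqrt_nonneg _)
  rw [← Real.sqrt_sq_eq_abs]
  exact Real.sqrt_le_sqrt (by nlinarith [sq_nonneg δ])

variable {D a S Φ : ℝ → ℝ → ℝ} {ε τ R : ℝ}

lemma tendsto_integral_regularized_abs {d φ : ℝ → ℝ} (hd : Continuous d) (hφ : Continuous φ)
    (b : ℝ) :
    Tendsto (fun n : ℕ => ∫ x in (0:ℝ)..b, √(d x ^ 2 + (1 / ((n : ℝ) + 1)) ^ 2) * φ x) atTop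
      (nhds (∫ x in (0:ℝ)..b, |d x| * φ x)) := by
  apply intervalIntegral.tendsto_integral_filter_of_dominated_convergence
    (fun x => √(d x ^ 2 + 1) * |φ x|)
  · refine Eventually.of_forall fun n => Continuous.aestronglyMeasurable ?_
    fun_prop
  · refine Eventually.of_forall fun n => Eventually.of_forall fun x _ => ?_
    rw [Real.norm_eq_abs, abs_mul, abs_of_nonneg (Real.sqrt_nonneg _)]
    exact mul_le_mul_of_nonneg_right (regularized_abs_le _ _) (abs_nonneg _)
  · exact Continuous.intervalIntegrable (by fun_prop) _ _
  · exact Eventually.of_forall fun x _ => (tendsto_regularized_abs _).mul tendsto_const_nhds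

lemma measurable_real_sign : Measurable Real.sign :=
  Measurable.ite measurableSet_Iio measurable_const
    (Measurable.ite measurableSet_Ioi measurable_const measurable_const)

lemma abs_real_sign_le (d : ℝ) : |Real.sign d| ≤ 1 := by
  rcases Real.sign_apply_eq d with h | h | h <;> simp [h]

/-- Kato's inequality in weighted integrated form for `D_t + (a D)_x = S + ε D_xx`. -/
lemma kato_inequality (hD : ContDiff ℝ 2 (Function.uncurry D))
    (ha : ContDiff ℝ 1 (Function.uncurry a)) (hS : Continuous (Function.uncurry S))
    (hΦ : ContDiff ℝ 2 (Function.uncurry Φ)) (hε : 0 ≤ ε) (hτ : 0 ≤ τ) (hR : 0 ≤ R)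
    (hΦ0 : ∀ t ∈ Icc 0 τ, ∀ x ∈ Icc 0 R, 0 ≤ Φ t x)
    (hΦl : ∀ t, Φ t 0 = 0) (hΦr : ∀ t, Φ t R = 0) (hΦr' : ∀ t, deriv (Φ t) R = 0)
    (hpde : ∀ t ∈ Icc 0 τ, ∀ x ∈ Icc 0 R, deriv (fun s => D s x) t
      + (deriv (a t) x * D t x + a t x * deriv (D t) x) = S t x + ε * deriv (deriv (D t)) x) :
    ∫ x in (0:ℝ)..R, |D τ x| * Φ τ x
      ≤ (∫ x in (0:ℝ)..R, |D 0 x| * Φ 0 x)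
        + (∫ p in Icc 0 τ ×ˢ Icc 0 R,
            (|D p.1 p.2| * (deriv (fun s => Φ s p.2) p.1
                + a p.1 p.2 * deriv (Φ p.1) p.2 + ε * deriv (deriv (Φ p.1)) p.2)
              + Real.sign (D p.1 p.2) * S p.1 p.2 * Φ p.1 p.2))
        + ε * ∫ t in (0:ℝ)..τ, |D t 0| * deriv (Φ t) 0 := by
  have hK : IsCompact (Icc 0 τ ×ˢ Icc 0 R) := isCompact_Icc.prod isCompact_Icc
  have hΦx : ContDiff ℝ 1 (Function.uncurry fun t x => deriv (Φ t) x) :=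
    hΦ.deriv_right (by norm_num)
  have cD : Continuous fun p : ℝ × ℝ => D p.1 p.2 := hD.continuous
  have ca : Continuous fun p : ℝ × ℝ => a p.1 p.2 := ha.continuous
  have cS : Continuous fun p : ℝ × ℝ => S p.1 p.2 := hS
  have cΦ : Continuous fun p : ℝ × ℝ => Φ p.1 p.2 := hΦ.continuous
  have cΦx : Continuous fun p : ℝ × ℝ => deriv (Φ p.1) p.2 := hΦx.continuous
  have cΦt : Continuous fun p : ℝ × ℝ => deriv (fun s => Φ s p.2) p.1 :=
    (hΦ.deriv_left (m := 1) (by norm_num)).continuous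
  have cΦxx : Continuous fun p : ℝ × ℝ => deriv (deriv (Φ p.1)) p.2 :=
    (hΦx.deriv_right (m := 0) (by norm_num)).continuous
  have cax : Continuous fun p : ℝ × ℝ => deriv (a p.1) p.2 :=
    (ha.deriv_right (m := 0) (by norm_num)).continuous
  have cDτ : ∀ t, Continuous fun x => D t x := fun t => cD.comp (by fun_prop : Continuous (t, ·))
  have cΦτ : ∀ t, Continuous fun x => Φ t x := fun t => cΦ.comp (by fun_prop : Continuous (t, ·))
  have cD0 : Continuous fun t => D t 0 := cD.comp (by fun_prop : Continuous fun t : ℝ => (t, (0:ℝ)))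
  have cΦ0 : Continuous fun t => deriv (Φ t) 0 :=
    cΦx.comp (by fun_prop : Continuous fun t : ℝ => (t, (0:ℝ)))
  have hn : ∀ n : ℕ, 0 < 1 / ((n : ℝ) + 1) := fun n => by positivity
  refine le_of_tendsto_of_tendsto' (tendsto_integral_regularized_abs (cDτ τ) (cΦτ τ) R) ?_
    (fun n => regularized_kato hD ha hS hΦ hε hτ hR hΦ0 hΦl hΦr hΦr' hpde (hn n))
  refine ((tendsto_integral_regularized_abs (cDτ 0) (cΦτ 0) R).add ?_).add
    ((tendsto_integral_regularized_abs cD0 cΦ0 τ).const_mul ε)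
  apply tendsto_integral_of_dominated_convergence (fun p =>
    √(D p.1 p.2 ^ 2 + 1) * |deriv (fun s => Φ s p.2) p.1
                + a p.1 p.2 * deriv (Φ p.1) p.2 + ε * deriv (deriv (Φ p.1)) p.2|
      + (|S p.1 p.2| + |deriv (a p.1) p.2|) * |Φ p.1 p.2|)
  · intro n
    have hne : ∀ p : ℝ × ℝ, √(D p.1 p.2 ^ 2 + (1 / ((n : ℝ) + 1)) ^ 2) ≠ 0 := fun p => by
      have := hn n; positivity
    apply Continuous.aestronglyMeasurable
    have : Continuous fun p : ℝ × ℝ =>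
        D p.1 p.2 / √(D p.1 p.2 ^ 2 + (1 / ((n : ℝ) + 1)) ^ 2) :=
      cD.div (by fun_prop) hne
    fun_prop
  · refine Continuous.continuousOn ?_ |>.integrableOn_compact hK
    fun_prop
  · intro n
    refine Eventually.of_forall fun p => ?_
    have h1 : 1 / ((n : ℝ) + 1) ≤ 1 := by
      rw [div_le_one (by positivity)]; linarith [n.cast_nonneg (α := ℝ)]
    rw [Real.norm_eq_abs]
    refine (abs_add_le _ _).trans (add_le_add ?_ ?_)
    · rw [abs_mul, abs_of_nonneg (Real.sqrt_nonneg _)]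
      exact mul_le_mul_of_nonneg_right (regularized_abs_le _ _) (abs_nonneg _)
    · rw [abs_mul]
      refine mul_le_mul_of_nonneg_right ((abs_add_le _ _).trans (add_le_add ?_ ?_)) (abs_nonneg _)
      · rw [abs_mul]
        exact mul_le_of_le_one_left (abs_nonneg _) (abs_regularized_sign_le _ _)
      · rw [abs_mul, abs_abs, abs_of_pos (hn n)]
        exact mul_le_of_le_one_right (abs_nonneg _) h1
  · refine Eventually.of_forall fun p => ?_
    have h0 := tendsto_one_div_add_atTop_nhds_zero_nat (𝕜 := ℝ)
    have := ((tendsto_regularized_abs (D p.1 p.2)).mul_const (deriv (fun s => Φ s p.2) p.1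
                + a p.1 p.2 * deriv (Φ p.1) p.2 + ε * deriv (deriv (Φ p.1)) p.2)).add
      ((((tendsto_regularized_sign (D p.1 p.2)).mul_const (S p.1 p.2)).add
        (h0.const_mul |deriv (a p.1) p.2|)).mul_const (Φ p.1 p.2))
    simpa using this

end katolimit

section contraction

lemma Continuous.integrableOn_of_isCompact {X : Type*} [MeasurableSpace X] [TopologicalSpace X]
    [OpensMeasurableSpace X] [T2Space X] {μ : Measure X} [IsFiniteMeasureOnCompacts μ]
    {f : X → ℝ} (hf : Continuous f) {K : Set X} (hK : IsCompact K) : IntegrableOn f K μ :=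
  hf.continuousOn.integrableOn_compact hK

lemma integral_exp_layer_le {k R : ℝ} (hk : 0 < k) :
    ∫ x in (0:ℝ)..R, Real.exp (-(k * x)) ≤ 1 / k := by
  have h : ∀ x ∈ uIcc 0 R, HasDerivAt (fun x => -(1 / k) * Real.exp (-(k * x)))
      (Real.exp (-(k * x))) x := by
    intro x _
    have := (((hasDerivAt_id x).const_mul k).neg.exp).const_mul (-(1 / k))
    refine this.congr_deriv ?_
    simp; field_simp
  rw [intervalIntegral.integral_eq_sub_of_hasDerivAt h
    (Continuous.intervalIntegrable (by fun_prop) _ _)]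
  have := Real.exp_pos (-(k * R))
  have : 0 ≤ 1 / k * Real.exp (-(k * R)) := by positivity
  simp; simp at this; linarith

lemma integral_rect_exp_layer_le {k R τ : ℝ} (hk : 0 < k) (hτ : 0 ≤ τ) (hR : 0 ≤ R) :
    ∫ p in Icc 0 τ ×ˢ Icc 0 R, Real.exp (-(k * (p : ℝ × ℝ).2)) ≤ τ / k := by
  have h := setIntegral_prod_mul (μ := volume) (ν := volume) (fun _ : ℝ => (1:ℝ))
    (fun x : ℝ => Real.exp (-(k * x))) (Icc 0 τ) (Icc 0 R)
  rw [← Measure.volume_eq_prod] at h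
  simp only [one_mul] at h
  rw [h, integral_Icc_eq_integral_Ioc, ← intervalIntegral.integral_of_le hτ,
    integral_Icc_eq_integral_Ioc, ← intervalIntegral.integral_of_le hR]
  have := integral_exp_layer_le (R := R) hk
  simp only [intervalIntegral.integral_const, smul_eq_mul, sub_zero, mul_one]
  calc τ * _ ≤ τ * (1 / k) := by gcongr
    _ = τ / k := by ring

lemma layer_algebra {θ φ φ' φ'' E a d s g S ε A B L l : ℝ} (hθ : 0 ≤ θ) (hθ1 : θ ≤ 1)
    (hφ : 0 ≤ φ) (hφL : φ ≤ L) (hφ' : φ' ≤ 0) (hφ'L : -φ' ≤ L) (hφ'' : |φ''| ≤ L)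
    (hE : 0 ≤ E) (hE1 : E ≤ 1) (ha : 0 ≤ a) (haA : a ≤ A) (hd : 0 ≤ d) (hdB : d ≤ B)
    (hs : |s| ≤ 1) (hg : 0 ≤ g) (hgA : ε * g = A) (hε : 0 ≤ ε) (hl : 0 ≤ l) :
    d * (-l * (θ * (φ * (1 - E))) + a * (θ * (φ' * (1 - E) + φ * (g * E)))
        + ε * (θ * (φ'' * (1 - E) + φ' * (g * E) + (φ' * (g * E) + φ * (-(g * (g * E)))))))
      + s * S * (θ * (φ * (1 - E)))
      ≤ -(θ * (l * (d * φ) + a * d * (-φ') - |S| * φ)) + ((l + A) * (B * L)) * E + ε * (B * L) := by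
  have hL : 0 ≤ L := hφ.trans hφL
  have hB : 0 ≤ B := hd.trans hdB
  have hA : 0 ≤ A := ha.trans haA
  have hdφ : d * φ ≤ B * L := mul_le_mul hdB hφL hφ hB
  have h1 : θ * (l * (d * φ)) * E ≤ l * (B * L) * E := by
    apply mul_le_mul_of_nonneg_right _ hE
    calc θ * (l * (d * φ)) ≤ 1 * (l * (d * φ)) := by gcongr
      _ ≤ l * (B * L) := by rw [one_mul]; gcongr
  have h2 : θ * (a * d * (-φ')) * E ≤ A * (B * L) * E := by
    apply mul_le_mul_of_nonneg_right _ hE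
    have : 0 ≤ -φ' := by linarith
    calc θ * (a * d * (-φ')) ≤ 1 * (a * d * (-φ')) := by gcongr
      _ ≤ A * (B * L) := by rw [one_mul, mul_assoc]; gcongr
  have h3 : d * (θ * (φ * (g * E) * (a - A))) ≤ 0 :=
    mul_nonpos_of_nonneg_of_nonpos hd (mul_nonpos_of_nonneg_of_nonpos hθ
      (mul_nonpos_of_nonneg_of_nonpos (by positivity) (by linarith)))
  have h4 : d * (ε * (θ * (2 * (φ' * (g * E))))) ≤ 0 := by
    have : φ' * (g * E) ≤ 0 := mul_nonpos_of_nonpos_of_nonneg hφ' (by positivity)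
    exact mul_nonpos_of_nonneg_of_nonpos hd (mul_nonpos_of_nonneg_of_nonpos hε
      (mul_nonpos_of_nonneg_of_nonpos hθ (by linarith)))
  have h5 : d * (ε * (θ * (φ'' * (1 - E)))) ≤ ε * (B * L) := by
    have e1 : φ'' * (1 - E) ≤ L := by
      calc φ'' * (1 - E) ≤ L * (1 - E) :=
            mul_le_mul_of_nonneg_right ((le_abs_self _).trans hφ'') (by linarith)
        _ ≤ L := by nlinarith
    calc d * (ε * (θ * (φ'' * (1 - E)))) ≤ d * (ε * (θ * L)) := by gcongr
      _ ≤ B * (ε * (1 * L)) := by gcongr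
      _ = ε * (B * L) := by ring
  have h6 : s * S * (θ * (φ * (1 - E))) ≤ θ * (|S| * φ) := by
    have e1 : s * S ≤ |S| := by
      calc s * S ≤ |s * S| := le_abs_self _
        _ = |s| * |S| := abs_mul _ _
        _ ≤ |S| := mul_le_of_le_one_left (abs_nonneg _) hs
    have e2 : 0 ≤ θ * (φ * (1 - E)) := mul_nonneg hθ (mul_nonneg hφ (by linarith))
    calc s * S * (θ * (φ * (1 - E))) ≤ |S| * (θ * (φ * (1 - E))) :=
          mul_le_mul_of_nonneg_right e1 e2
      _ = θ * (|S| * φ) * (1 - E) := by ring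
      _ ≤ θ * (|S| * φ) := mul_le_of_le_one_right (by positivity) (by linarith)
  have h7 : ε * (φ * (-(g * (g * E)))) = -(A * (φ * (g * E))) := by rw [← hgA]; ring
  have : d * (-l * (θ * (φ * (1 - E))) + a * (θ * (φ' * (1 - E) + φ * (g * E)))
        + ε * (θ * (φ'' * (1 - E) + φ' * (g * E) + (φ' * (g * E) + φ * (-(g * (g * E)))))))
      = -(θ * (l * (d * φ) + a * d * (-φ'))) + θ * (l * (d * φ)) * E + θ * (a * d * (-φ')) * E
        + d * (θ * (φ * (g * E) * (a - A))) + d * (ε * (θ * (2 * (φ' * (g * E)))))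
        + d * (ε * (θ * (φ'' * (1 - E)))) := by
    have h7' : d * θ * (ε * (φ * (-(g * (g * E))))) = d * θ * (-(A * (φ * (g * E)))) := by rw [h7]
    linear_combination h7'
  rw [this]
  linarith

/-- Weighted `L¹` estimate for `D_t + (a D)_x = S + ε D_xx` with `0 ≤ a ≤ A`.  The boundary layer
weight `1 - exp (-A x / ε)` removes the unknown boundary flux, at the cost of `O(ε)` terms. -/
lemma weighted_contraction {D a S : ℝ → ℝ → ℝ} {φ : ℝ → ℝ} {ε τ R A B L l : ℝ}
    (hD : ContDiff ℝ 2 (Function.uncurry D))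
    (ha : ContDiff ℝ 1 (Function.uncurry a)) (hS : Continuous (Function.uncurry S))
    (hφ : ContDiff ℝ 2 φ) (hε : 0 < ε) (hτ : 0 ≤ τ) (hR : 0 ≤ R) (hA : 0 < A) (hl : 0 ≤ l)
    (hφ0 : ∀ x ∈ Icc 0 R, 0 ≤ φ x) (hφ' : ∀ x ∈ Icc 0 R, deriv φ x ≤ 0)
    (hφR : φ R = 0) (hφR' : deriv φ R = 0)
    (hφL : ∀ x ∈ Icc 0 R, φ x ≤ L) (hφ'L : ∀ x ∈ Icc 0 R, -deriv φ x ≤ L)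
    (hφ''L : ∀ x ∈ Icc 0 R, |deriv (deriv φ) x| ≤ L)
    (ha0 : ∀ t ∈ Icc 0 τ, ∀ x ∈ Icc 0 R, 0 ≤ a t x)
    (haA : ∀ t ∈ Icc 0 τ, ∀ x ∈ Icc 0 R, a t x ≤ A)
    (hDB : ∀ t ∈ Icc 0 τ, ∀ x ∈ Icc 0 R, |D t x| ≤ B)
    (hpde : ∀ t ∈ Icc 0 τ, ∀ x ∈ Icc 0 R, deriv (fun s => D s x) t
      + (deriv (a t) x * D t x + a t x * deriv (D t) x) = S t x + ε * deriv (deriv (D t)) x) :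
    Real.exp (-(l * τ)) * (∫ x in (0:ℝ)..R, |D τ x| * φ x)
      + (∫ p in Icc 0 τ ×ˢ Icc 0 R, Real.exp (-(l * p.1)) * (l * (|D p.1 p.2| * φ p.2)
          + a p.1 p.2 * |D p.1 p.2| * (-deriv φ p.2) - |S p.1 p.2| * φ p.2))
      ≤ (∫ x in (0:ℝ)..R, |D 0 x| * φ x) + A * φ 0 * (∫ t in (0:ℝ)..τ, |D t 0|)
        + ε * (B * L * (1 / A + (l + A) * τ / A + τ * R)) := by
  have hK : IsCompact (Icc 0 τ ×ˢ Icc 0 R) := isCompact_Icc.prod isCompact_Icc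
  have hB : 0 ≤ B := (abs_nonneg _).trans (hDB 0 ⟨le_rfl, hτ⟩ 0 ⟨le_rfl, hR⟩)
  have hL : 0 ≤ L := (hφ0 0 ⟨le_rfl, hR⟩).trans (hφL 0 ⟨le_rfl, hR⟩)
  set g := A / ε with hg
  have hgpos : 0 < g := by positivity
  have hgA : ε * g = A := by rw [hg]; field_simp
  set E : ℝ → ℝ := fun x => Real.exp (-(g * x)) with hE
  have hEc : ContDiff ℝ 2 E := by fun_prop
  have hE0 : ∀ x, 0 ≤ E x := fun x => (Real.exp_pos _).le
  have hE1 : ∀ x ∈ Icc 0 R, E x ≤ 1 := fun x hx => by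
    have : 0 ≤ g * x := mul_nonneg hgpos.le hx.1
    exact Real.exp_le_one_iff.2 (by linarith)
  have hEd : ∀ x, HasDerivAt E (-(g * E x)) x := by
    intro x
    have := ((hasDerivAt_id x).const_mul g).neg.exp
    refine this.congr_deriv ?_
    simp [hE]; ring
  have hφd : ∀ x, HasDerivAt φ (deriv φ x) x := fun x =>
    (hφ.differentiable (by norm_num) x).hasDerivAt
  have hφ1 : ContDiff ℝ 1 (deriv φ) := by
    have := (contDiff_succ_iff_deriv (n := 1) (f := φ)).1 (by simpa [one_add_one_eq_two] using hφ)
    exact this.2.2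
  have hφdd : ∀ x, HasDerivAt (deriv φ) (deriv (deriv φ) x) x := fun x =>
    (hφ1.differentiable (by norm_num) x).hasDerivAt
  set θ : ℝ → ℝ := fun t => Real.exp (-(l * t)) with hθ
  have hθd : ∀ t, HasDerivAt θ (-l * θ t) t := by
    intro x
    have := ((hasDerivAt_id x).const_mul l).neg.exp
    refine this.congr_deriv ?_
    simp [hθ]; ring
  have hθ0 : ∀ t, 0 ≤ θ t := fun x => (Real.exp_pos _).le
  have hθ1 : ∀ t ∈ Icc 0 τ, θ t ≤ 1 := fun x hx => by
    have : 0 ≤ l * x := mul_nonneg hl hx.1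
    exact Real.exp_le_one_iff.2 (by linarith)
  set Φ : ℝ → ℝ → ℝ := fun t x => θ t * (φ x * (1 - E x)) with hΦ
  have hΦc : ContDiff ℝ 2 (Function.uncurry Φ) := by
    have : Function.uncurry Φ = fun p => θ p.1 * (φ p.2 * (1 - E p.2)) := by
      ext ⟨t, x⟩; rfl
    rw [this]
    fun_prop
  have hΦt : ∀ t x, deriv (fun s => Φ s x) t = -l * (θ t * (φ x * (1 - E x))) := fun t x => by
    rw [((hθd t).mul_const (φ x * (1 - E x))).deriv]; ring
  have hΦx : ∀ t x, deriv (Φ t) x = θ t * (deriv φ x * (1 - E x) + φ x * (g * E x)) := fun t x => by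
    have := (((hφd x).mul ((hEd x).const_sub 1)).const_mul (θ t)).deriv
    rw [hΦ]; rw [neg_neg] at this; exact this
  have hΦxx : ∀ t x, deriv (deriv (Φ t)) x = θ t * (deriv (deriv φ) x * (1 - E x)
      + deriv φ x * (g * E x) + (deriv φ x * (g * E x) + φ x * (-(g * (g * E x))))) := fun t x => by
    have e : deriv (Φ t) = fun x => θ t * (deriv φ x * (1 - E x) + φ x * (g * E x)) :=
      funext (hΦx t)
    rw [e]
    have := ((((hφdd x).mul ((hEd x).const_sub 1)).add
      ((hφd x).mul ((hEd x).const_mul g))).const_mul (θ t)).deriv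
    rw [neg_neg, mul_neg] at this
    exact this
  have hk := kato_inequality hD ha hS hΦc hε.le hτ hR
    (fun t ht x hx => mul_nonneg (hθ0 t) (mul_nonneg (hφ0 x hx) (by linarith [hE1 x hx])))
    (fun t => by simp [hΦ, hE]) (fun t => by simp [hΦ, hφR])
    (fun t => by rw [hΦx]; simp [hφR, hφR']) hpde
  have cD : Continuous fun p : ℝ × ℝ => D p.1 p.2 := hD.continuous
  have ca : Continuous fun p : ℝ × ℝ => a p.1 p.2 := ha.continuous
  have cS : Continuous fun p : ℝ × ℝ => S p.1 p.2 := hS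
  have cDτ : ∀ t, Continuous fun x => D t x := fun t => cD.comp (by fun_prop : Continuous (t, ·))
  have cD0 : Continuous fun t => D t 0 := cD.comp (by fun_prop : Continuous fun t : ℝ => (t, (0:ℝ)))
  have cφ : Continuous φ := hφ.continuous
  have cE : Continuous E := hEc.continuous
  have cθ : Continuous θ := by fun_prop
  have cφ' : Continuous (deriv φ) := hφ1.continuous
  have cφ'' : Continuous (deriv (deriv φ)) :=
    hφ1.continuous_deriv (by norm_num)
  -- the terminal slice
  have t1 : θ τ * (∫ x in (0:ℝ)..R, |D τ x| * φ x) - B * L * (1 / g)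
      ≤ ∫ x in (0:ℝ)..R, |D τ x| * Φ τ x := by
    have e : B * L * (∫ x in (0:ℝ)..R, E x) ≤ B * L * (1 / g) := by
      gcongr; exact integral_exp_layer_le hgpos
    have i1 : IntervalIntegrable (fun x => |D τ x| * φ x) volume 0 R :=
      Continuous.intervalIntegrable (((cDτ τ).abs).mul cφ) _ _
    have i2 : IntervalIntegrable E volume 0 R := cE.intervalIntegrable _ _
    refine le_trans (sub_le_sub_left e _) ?_
    rw [← intervalIntegral.integral_const_mul, ← intervalIntegral.integral_const_mul,
      ← intervalIntegral.integral_sub (i1.const_mul _) (i2.const_mul _)]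
    apply intervalIntegral.integral_mono_on hR ((i1.const_mul _).sub (i2.const_mul _))
    · apply Continuous.intervalIntegrable
      have := cDτ τ
      simp only [hΦ]; fun_prop
    · intro x hx
      have hτm : τ ∈ Icc 0 τ := ⟨hτ, le_rfl⟩
      have b1 : |D τ x| * φ x ≤ B * L := mul_le_mul (hDB τ hτm x hx) (hφL x hx) (hφ0 x hx) hB
      have b2 : θ τ * (|D τ x| * φ x) ≤ 1 * (B * L) :=
        mul_le_mul (hθ1 τ hτm) b1 (mul_nonneg (abs_nonneg _) (hφ0 x hx)) zero_le_one
      have b3 := mul_le_mul_of_nonneg_right b2 (hE0 x)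
      simp only [hΦ]
      nlinarith
  -- the initial slice
  have t2 : ∫ x in (0:ℝ)..R, |D 0 x| * Φ 0 x ≤ ∫ x in (0:ℝ)..R, |D 0 x| * φ x := by
    have := cDτ 0
    apply intervalIntegral.integral_mono_on hR
    · apply Continuous.intervalIntegrable; simp only [hΦ]; fun_prop
    · apply Continuous.intervalIntegrable; fun_prop
    · intro x hx
      have : Φ 0 x ≤ φ x := by
        simp only [hΦ, hθ, mul_zero, neg_zero, Real.exp_zero, one_mul]
        exact mul_le_of_le_one_right (hφ0 x hx) (by linarith [hE0 x])
      exact mul_le_mul_of_nonneg_left this (abs_nonneg _)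
  -- the boundary term
  have t3 : ε * (∫ t in (0:ℝ)..τ, |D t 0| * deriv (Φ t) 0)
      ≤ A * φ 0 * (∫ t in (0:ℝ)..τ, |D t 0|) := by
    rw [← intervalIntegral.integral_const_mul, ← intervalIntegral.integral_const_mul]
    apply intervalIntegral.integral_mono_on hτ
    · apply Continuous.intervalIntegrable; simp only [hΦx]; fun_prop
    · apply Continuous.intervalIntegrable; fun_prop
    · intro t ht
      rw [hΦx]
      have e0 : E 0 = 1 := by simp [hE]
      rw [e0, ← hgA]
      have : 0 ≤ φ 0 := hφ0 0 ⟨le_rfl, hR⟩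
      have h9 : (ε * g * φ 0 * |D t 0|) * θ t ≤ (ε * g * φ 0 * |D t 0|) * 1 :=
        mul_le_mul_of_nonneg_left (hθ1 t ht) (by positivity)
      nlinarith
  -- the interior
  have t4 : (∫ p in Icc 0 τ ×ˢ Icc 0 R,
            (|D p.1 p.2| * (deriv (fun s => Φ s p.2) p.1
                + a p.1 p.2 * deriv (Φ p.1) p.2 + ε * deriv (deriv (Φ p.1)) p.2)
              + Real.sign (D p.1 p.2) * S p.1 p.2 * Φ p.1 p.2))
      ≤ ∫ p in Icc 0 τ ×ˢ Icc 0 R, (-(θ p.1 * (l * (|D p.1 p.2| * φ p.2)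
          + a p.1 p.2 * |D p.1 p.2| * (-deriv φ p.2) - |S p.1 p.2| * φ p.2))
          + ((l + A) * (B * L)) * E p.2 + ε * (B * L)) := by
    apply setIntegral_mono_on _ _ (measurableSet_Icc.prod measurableSet_Icc)
    · rintro ⟨t, x⟩ ⟨ht, hx⟩
      simp only at ht hx
      simp only [hΦx, hΦt, hΦxx]
      exact layer_algebra (hθ0 t) (hθ1 t ht) (hφ0 x hx) (hφL x hx) (hφ' x hx) (hφ'L x hx)
        (hφ''L x hx) (hE0 x) (hE1 x hx) (ha0 t ht x hx) (haA t ht x hx) (abs_nonneg _)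
        (hDB t ht x hx) (abs_real_sign_le _) hgpos.le hgA hε.le hl
    · simp only [hΦx, hΦt, hΦxx]
      apply Integrable.add
      · apply Continuous.integrableOn_of_isCompact (hK := hK)
        fun_prop
      · have hc : IntegrableOn (fun p : ℝ × ℝ => S p.1 p.2 * Φ p.1 p.2)
            (Icc 0 τ ×ˢ Icc 0 R) := by
          apply Continuous.integrableOn_of_isCompact (hK := hK)
          simp only [hΦ]; fun_prop
        have := hc.bdd_mul (c := 1) (f := fun p : ℝ × ℝ => Real.sign (D p.1 p.2))
          (measurable_real_sign.comp cD.measurable).aestronglyMeasurable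
          (Eventually.of_forall fun p => abs_real_sign_le _)
        simpa only [mul_assoc] using this
    · apply Continuous.integrableOn_of_isCompact (hK := hK)
      fun_prop
  have i5 : IntegrableOn (fun p : ℝ × ℝ => θ p.1 * (l * (|D p.1 p.2| * φ p.2)
          + a p.1 p.2 * |D p.1 p.2| * (-deriv φ p.2) - |S p.1 p.2| * φ p.2))
          (Icc 0 τ ×ˢ Icc 0 R) := Continuous.integrableOn_of_isCompact (by fun_prop) hK
  have i6 : IntegrableOn (fun p : ℝ × ℝ => ((l + A) * (B * L)) * E p.2)
          (Icc 0 τ ×ˢ Icc 0 R) := Continuous.integrableOn_of_isCompact (by fun_prop) hK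
  have i7 : IntegrableOn (fun p : ℝ × ℝ => ε * (B * L))
          (Icc 0 τ ×ˢ Icc 0 R) := Continuous.integrableOn_of_isCompact (by fun_prop) hK
  have e5 := integral_add (i5.neg.add i6) i7
  have e6 := integral_add i5.neg i6
  simp only [Pi.add_apply, Pi.neg_apply] at e5 e6
  rw [e5, e6, integral_neg, integral_const_mul] at t4
  have t5 := integral_rect_exp_layer_le hgpos hτ hR
  have t6 : ∫ p in Icc 0 τ ×ˢ Icc 0 R, ε * (B * L) ∂(volume : Measure (ℝ × ℝ))
      = τ * R * (ε * (B * L)) := by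
    rw [setIntegral_const, Measure.volume_eq_prod, measureReal_prod_prod]
    simp [hτ, hR]
  have t7 : (l + A) * (B * L) * (∫ p in Icc 0 τ ×ˢ Icc 0 R, E (p : ℝ × ℝ).2)
      ≤ (l + A) * (B * L) * (τ / g) := by gcongr
  have hg' : 1 / g = ε / A := by rw [hg]; field_simp
  have hg'' : τ / g = τ * (ε / A) := by rw [hg]; field_simp
  rw [hg''] at t7
  rw [hg'] at t1
  have e9 : ε * (B * L * (1 / A + (l + A) * τ / A + τ * R))
      = B * L * (ε / A) + (l + A) * (B * L) * (τ * (ε / A)) + τ * R * (ε * (B * L)) := by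
    ring
  rw [e9]
  linarith

end contraction

section viscous

/-- A bounded classical solution of the viscous short pulse equation on `[0,T] × [0,∞)`. -/
structure IsViscousSolution (ε T M : ℝ) (U : ℝ → ℝ → ℝ) : Prop where
  contDiff : ContDiff ℝ 2 (Function.uncurry U)
  pde : ∀ t ∈ Icc 0 T, ∀ x ∈ Ici (0:ℝ), deriv (fun s => U s x) t + 3 * U t x ^ 2 * deriv (U t) x
    = spePrimitive U t x + ε * deriv (deriv (U t)) x
  bound : ∀ t ∈ Icc 0 T, ∀ x ∈ Ici (0:ℝ), |U t x| ≤ M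

lemma continuous_spePrimitive {U : ℝ → ℝ → ℝ} (hU : Continuous (Function.uncurry U)) :
    Continuous (Function.uncurry (spePrimitive U)) := by
  have := intervalIntegral.continuous_parametric_intervalIntegral_of_continuous
    (μ := volume) (f := fun (p : ℝ × ℝ) y => U p.1 y) (a₀ := 0) (s := fun p : ℝ × ℝ => p.2)
    (by
      have : (Function.uncurry fun (p : ℝ × ℝ) y => U p.1 y)
          = Function.uncurry U ∘ fun q : (ℝ × ℝ) × ℝ => (q.1.1, q.2) := rfl
      rw [this]; exact hU.comp (by fun_prop)) continuous_snd
  exact this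

lemma IsViscousSolution.of_interior {ε T M : ℝ} (hT : 0 < T) {U : ℝ → ℝ → ℝ}
    (hU : ContDiff ℝ 2 (Function.uncurry U))
    (hpde : ∀ t > (0:ℝ), ∀ x > (0:ℝ), deriv (fun s => U s x) t + 3 * U t x ^ 2 * deriv (U t) x
      = spePrimitive U t x + ε * deriv (deriv (U t)) x)
    (hb : ∀ t ∈ Ioo 0 T, ∀ x > (0:ℝ), |U t x| ≤ M) : IsViscousSolution ε T M U := by
  have hcl : closure (Ioo 0 T ×ˢ Ioi (0:ℝ)) = Icc 0 T ×ˢ Ici 0 := by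
    rw [closure_prod_eq, closure_Ioo hT.ne, closure_Ioi]
  have c0 : Continuous fun p : ℝ × ℝ => U p.1 p.2 := hU.continuous
  have hx : ContDiff ℝ 1 (Function.uncurry fun t x => deriv (U t) x) :=
    hU.deriv_right (by norm_num [one_add_one_eq_two])
  have c1 : Continuous fun p : ℝ × ℝ => deriv (U p.1) p.2 := hx.continuous
  have c2 : Continuous fun p : ℝ × ℝ => deriv (fun s => U s p.2) p.1 :=
    (hU.deriv_left (m := 1) (by norm_num [one_add_one_eq_two])).continuous
  have c3 : Continuous fun p : ℝ × ℝ => deriv (deriv (U p.1)) p.2 :=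
    (hx.deriv_right (m := 0) (by norm_num)).continuous
  have c4 : Continuous fun p : ℝ × ℝ => spePrimitive U p.1 p.2 :=
    continuous_spePrimitive hU.continuous
  refine ⟨hU, ?_, ?_⟩
  · have h : EqOn (fun p : ℝ × ℝ => deriv (fun s => U s p.2) p.1
        + 3 * U p.1 p.2 ^ 2 * deriv (U p.1) p.2)
        (fun p => spePrimitive U p.1 p.2 + ε * deriv (deriv (U p.1)) p.2)
        (Ioo 0 T ×ˢ Ioi 0) := by
      rintro ⟨t, x⟩ ⟨ht, hx⟩
      exact hpde t ht.1 x hx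
    have h2 := h.closure (by fun_prop) (by fun_prop)
    rw [hcl] at h2
    exact fun t ht x hx => h2 (show (t, x) ∈ _ from ⟨ht, hx⟩)
  · have h : Ioo 0 T ×ˢ Ioi 0 ⊆ {p : ℝ × ℝ | |U p.1 p.2| ≤ M} := by
      rintro ⟨t, x⟩ ⟨ht, hx⟩
      exact hb t ht x hx
    have h2 := closure_minimal h (isClosed_le (by fun_prop) continuous_const)
    rw [hcl] at h2
    exact fun t ht x hx => h2 (show (t, x) ∈ _ from ⟨ht, hx⟩)

lemma abs_spePrimitive_le {U : ℝ → ℝ → ℝ} {M t x : ℝ} (hx : 0 ≤ x)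
    (h : ∀ y ∈ Ioc 0 x, |U t y| ≤ M) : |spePrimitive U t x| ≤ M * x := by
  have := intervalIntegral.norm_integral_le_of_norm_le_const (a := 0) (b := x) (f := U t) (C := M)
    (fun y hy => h y (by rwa [uIoc_of_le hx] at hy))
  simpa [abs_of_nonneg hx, spePrimitive] using this

lemma quadratic_nonneg (p q : ℝ) : 0 ≤ p ^ 2 + p * q + q ^ 2 := by
  nlinarith [sq_nonneg (p + q), sq_nonneg p, sq_nonneg q]

lemma quadratic_le {p q M : ℝ} (hp : |p| ≤ M) (hq : |q| ≤ M) :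
    p ^ 2 + p * q + q ^ 2 ≤ 3 * M ^ 2 := by
  have hp2 : p ^ 2 ≤ M ^ 2 := sq_le_sq' (abs_le.1 hp).1 (abs_le.1 hp).2
  have hq2 : q ^ 2 ≤ M ^ 2 := sq_le_sq' (abs_le.1 hq).1 (abs_le.1 hq).2
  nlinarith [sq_nonneg (p - q)]

lemma quadratic_mul_abs_sub (p q : ℝ) :
    (p ^ 2 + p * q + q ^ 2) * |p - q| = |p ^ 3 - q ^ 3| := by
  rw [← abs_of_nonneg (quadratic_nonneg p q), ← abs_mul]
  congr 1; ring

/-- Comparison of a viscous solution with a smooth function. -/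
lemma IsViscousSolution.comparison {ε T M M' C τ R L : ℝ} {U w : ℝ → ℝ → ℝ} {φ : ℝ → ℝ}
    (hU : IsViscousSolution ε T M U) (hw : ContDiff ℝ 2 (Function.uncurry w))
    (hφ : ContDiff ℝ 2 φ) (hε : 0 < ε) (hτ : 0 ≤ τ) (hτT : τ ≤ T) (hR : 0 ≤ R)
    (hM' : 0 < M') (hMM' : M ≤ M')
    (hφ0 : ∀ x ∈ Icc 0 R, 0 ≤ φ x) (hφ' : ∀ x ∈ Icc 0 R, deriv φ x ≤ 0)
    (hφR : φ R = 0) (hφR' : deriv φ R = 0)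
    (hφL : ∀ x ∈ Icc 0 R, φ x ≤ L) (hφ'L : ∀ x ∈ Icc 0 R, -deriv φ x ≤ L)
    (hφ''L : ∀ x ∈ Icc 0 R, |deriv (deriv φ) x| ≤ L)
    (hwM : ∀ t ∈ Icc 0 τ, ∀ x ∈ Icc 0 R, |w t x| ≤ M')
    (hwC : ∀ t ∈ Icc 0 τ, ∀ x ∈ Icc 0 R, |deriv (fun s => w s x) t
      + 3 * w t x ^ 2 * deriv (w t) x - ε * deriv (deriv (w t)) x| ≤ C) :
    (∫ x in (0:ℝ)..R, |U τ x - w τ x| * φ x)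
      + (∫ p in Icc 0 τ ×ˢ Icc 0 R, |U p.1 p.2 ^ 3 - w p.1 p.2 ^ 3| * (-deriv φ p.2))
      ≤ (∫ x in (0:ℝ)..R, |U 0 x - w 0 x| * φ x)
        + 3 * M' ^ 2 * φ 0 * (∫ t in (0:ℝ)..τ, |U t 0 - w t 0|)
        + (M' * R + C) * (τ * ∫ x in (0:ℝ)..R, φ x)
        + ε * (2 * M' * L * (1 / (3 * M' ^ 2) + τ + τ * R)) := by
  have h12 : (1 : WithTop ℕ∞) ≤ 2 := by norm_num
  have hK : IsCompact (Icc 0 τ ×ˢ Icc 0 R) := isCompact_Icc.prod isCompact_Icc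
  have hU1 := hU.contDiff.of_le h12
  have hw1 := hw.of_le h12
  have hUx : ContDiff ℝ 1 (Function.uncurry fun t x => deriv (U t) x) :=
    hU.contDiff.deriv_right (by norm_num [one_add_one_eq_two])
  have hwx : ContDiff ℝ 1 (Function.uncurry fun t x => deriv (w t) x) :=
    hw.deriv_right (by norm_num [one_add_one_eq_two])
  have cU : Continuous fun p : ℝ × ℝ => U p.1 p.2 := hU.contDiff.continuous
  have cw : Continuous fun p : ℝ × ℝ => w p.1 p.2 := hw.continuous
  have c1 : Continuous fun p : ℝ × ℝ => deriv (w p.1) p.2 := hwx.continuous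
  have c2 : Continuous fun p : ℝ × ℝ => deriv (fun s => w s p.2) p.1 :=
    (hw.deriv_left (m := 1) (by norm_num [one_add_one_eq_two])).continuous
  have c3 : Continuous fun p : ℝ × ℝ => deriv (deriv (w p.1)) p.2 :=
    (hwx.deriv_right (m := 0) (by norm_num)).continuous
  have c4 : Continuous fun p : ℝ × ℝ => spePrimitive U p.1 p.2 :=
    continuous_spePrimitive hU.contDiff.continuous
  have cφ : Continuous φ := hφ.continuous
  have cφ' : Continuous (deriv φ) := hφ.continuous_deriv (by norm_num)
  set D : ℝ → ℝ → ℝ := fun t x => U t x - w t x with hDdef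
  set a : ℝ → ℝ → ℝ := fun t x => U t x ^ 2 + U t x * w t x + w t x ^ 2 with hadef
  set S : ℝ → ℝ → ℝ := fun t x => spePrimitive U t x - (deriv (fun s => w s x) t
      + 3 * w t x ^ 2 * deriv (w t) x - ε * deriv (deriv (w t)) x) with hSdef
  have hUM : ∀ t ∈ Icc 0 τ, ∀ x ∈ Icc 0 R, |U t x| ≤ M' := fun t ht x hx =>
    (hU.bound t ⟨ht.1, ht.2.trans hτT⟩ x hx.1).trans hMM'
  have key := weighted_contraction (D := D) (a := a) (S := S) (φ := φ) (ε := ε) (τ := τ) (R := R)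
    (A := 3 * M' ^ 2) (B := 2 * M') (L := L) (l := 0)
    (hU.contDiff.sub hw) ((hU1.pow 2).add (hU1.mul hw1) |>.add (hw1.pow 2))
    (by
      have : Function.uncurry S = fun p => S p.1 p.2 := rfl
      rw [this]; simp only [hSdef]; fun_prop)
    hφ hε hτ hR (by positivity) le_rfl hφ0 hφ' hφR hφR' hφL hφ'L hφ''L
    (fun t _ x _ => quadratic_nonneg _ _)
    (fun t ht x hx => quadratic_le (hUM t ht x hx) (hwM t ht x hx))
    (fun t ht x hx => by
      have := hUM t ht x hx; have := hwM t ht x hx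
      simp only [hDdef]
      exact (abs_sub _ _).trans (by linarith))
    (fun t ht x hx => by
      have d1 : deriv (fun s => D s x) t = deriv (fun s => U s x) t - deriv (fun s => w s x) t :=
        ((hU1.hasDerivAt_left t x).sub (hw1.hasDerivAt_left t x)).deriv
      have d2 : ∀ x, deriv (D t) x = deriv (U t) x - deriv (w t) x := fun x =>
        ((hU1.hasDerivAt_right t x).sub (hw1.hasDerivAt_right t x)).deriv
      have d3 : deriv (deriv (D t)) x = deriv (deriv (U t)) x - deriv (deriv (w t)) x := by
        rw [funext d2]
        exact ((hUx.hasDerivAt_right t x).sub (hwx.hasDerivAt_right t x)).deriv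
      have d4 : deriv (a t) x = (2 * U t x * deriv (U t) x
          + (deriv (U t) x * w t x + U t x * deriv (w t) x)) + 2 * w t x * deriv (w t) x := by
        have := ((((hU1.hasDerivAt_right t x).pow 2).add
          ((hU1.hasDerivAt_right t x).mul (hw1.hasDerivAt_right t x))).add
          ((hw1.hasDerivAt_right t x).pow 2)).deriv
        refine Eq.trans this ?_
        norm_num
      rw [d1, d2, d3, d4]
      simp only [hDdef, hadef, hSdef]
      linear_combination hU.pde t ⟨ht.1, ht.2.trans hτT⟩ x hx.1)
  simp only [zero_mul, neg_zero, Real.exp_zero, one_mul, zero_add] at key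
  rw [mul_div_cancel_left₀ _ (by positivity : 3 * M' ^ 2 ≠ 0)] at key
  have e1 : ∫ p in Icc 0 τ ×ˢ Icc 0 R, (|U p.1 p.2 ^ 3 - w p.1 p.2 ^ 3| * (-deriv φ p.2)
      - (M' * R + C) * φ p.2) ≤ ∫ p in Icc 0 τ ×ˢ Icc 0 R,
        (a p.1 p.2 * |D p.1 p.2| * (-deriv φ p.2) - |S p.1 p.2| * φ p.2) := by
    apply setIntegral_mono_on _ _ (measurableSet_Icc.prod measurableSet_Icc)
    · rintro ⟨t, x⟩ ⟨ht, hx⟩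
      simp only at ht hx
      simp only [hadef, hDdef]
      rw [quadratic_mul_abs_sub]
      have : |S t x| ≤ M' * R + C := by
        have h1 : |spePrimitive U t x| ≤ M' * R :=
          (abs_spePrimitive_le hx.1 fun y hy => hUM t ht y ⟨hy.1.le, hy.2.trans hx.2⟩).trans
            (by gcongr; exact hx.2)
        exact (abs_sub _ _).trans (add_le_add h1 (hwC t ht x hx))
      have := mul_le_mul_of_nonneg_right this (hφ0 x hx)
      linarith
    · exact Continuous.integrableOn_of_isCompact (by fun_prop) hK
    · exact Continuous.integrableOn_of_isCompact (by simp only [hadef, hDdef, hSdef]; fun_prop) hK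
  have e2 := integral_sub (μ := volume.restrict (Icc 0 τ ×ˢ Icc 0 R))
    (f := fun p : ℝ × ℝ => |U p.1 p.2 ^ 3 - w p.1 p.2 ^ 3| * (-deriv φ p.2))
    (g := fun p : ℝ × ℝ => (M' * R + C) * φ p.2)
    (Continuous.integrableOn_of_isCompact (by fun_prop) hK)
    (Continuous.integrableOn_of_isCompact (by fun_prop) hK)
  have e3 : ∫ p in Icc 0 τ ×ˢ Icc 0 R, (M' * R + C) * φ (p : ℝ × ℝ).2
      = (M' * R + C) * (τ * ∫ x in (0:ℝ)..R, φ x) := by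
    rw [integral_const_mul]
    have h := setIntegral_prod_mul (μ := volume) (ν := volume) (fun _ : ℝ => (1:ℝ))
      φ (Icc 0 τ) (Icc 0 R)
    rw [← Measure.volume_eq_prod] at h
    simp only [one_mul] at h
    rw [h, intervalIntegral.integral_of_le hR, ← integral_Icc_eq_integral_Ioc]
    simp [hτ]
  simp only [hDdef] at key e1
  linarith

end viscous

section translation

lemma hasDerivAt_cube_layer (R x : ℝ) :
    HasDerivAt (fun x : ℝ => (R - x) ^ 3) (-(3 * (R - x) ^ 2)) x := by
  have := ((hasDerivAt_id x).const_sub R).pow 3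
  refine this.congr_deriv ?_
  simp

lemma deriv_cube_layer (R : ℝ) :
    deriv (fun x : ℝ => (R - x) ^ 3) = fun x => -(3 * (R - x) ^ 2) :=
  funext fun x => (hasDerivAt_cube_layer R x).deriv

lemma deriv_deriv_cube_layer (R : ℝ) :
    deriv (deriv (fun x : ℝ => (R - x) ^ 3)) = fun x => 6 * (R - x) := by
  rw [deriv_cube_layer]
  ext x
  have := (((hasDerivAt_id x).const_sub R).pow 2).const_mul 3 |>.neg
  refine (this.congr_deriv ?_).deriv
  simp; ring

lemma integral_rect_eq {f : ℝ → ℝ → ℝ} (hf : Continuous (Function.uncurry f)) {τ R : ℝ}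
    (hτ : 0 ≤ τ) (hR : 0 ≤ R) :
    ∫ p in Icc 0 τ ×ˢ Icc 0 R, f p.1 p.2 = ∫ t in (0:ℝ)..τ, ∫ x in (0:ℝ)..R, f t x := by
  have hK : IsCompact (Icc 0 τ ×ˢ Icc 0 R) := isCompact_Icc.prod isCompact_Icc
  have hi : IntegrableOn (fun p : ℝ × ℝ => f p.1 p.2) (Icc 0 τ ×ˢ Icc 0 R) :=
    Continuous.integrableOn_of_isCompact hf hK
  rw [Measure.volume_eq_prod] at hi ⊢
  rw [setIntegral_prod _ hi]
  simp only [integral_Icc_eq_integral_Ioc, intervalIntegral.integral_of_le hτ,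
    intervalIntegral.integral_of_le hR]

lemma IsViscousSolution.translation {ε T M τ R s y : ℝ} {U : ℝ → ℝ → ℝ}
    (hU : IsViscousSolution ε T M U) (hε : 0 < ε) (hM : 0 < M) (hτ : 0 ≤ τ) (hs : 0 ≤ s)
    (hτT : τ + s ≤ T) (hy : 0 ≤ y) (hR : 0 ≤ R) :
    Real.exp (-(R * τ)) * (∫ x in (0:ℝ)..R, |U (τ + s) (x + y) - U τ x| * (R - x) ^ 3)
      ≤ (∫ x in (0:ℝ)..R, |U s (x + y) - U 0 x| * (R - x) ^ 3)
        + 3 * M ^ 2 * R ^ 3 * (∫ t in (0:ℝ)..τ, |U (t + s) y - U t 0|)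
        + M * y * R ^ 3 * (τ * R)
        + ε * (2 * M * (R ^ 3 + 3 * R ^ 2 + 6 * R)
          * (1 / (3 * M ^ 2) + (R + 3 * M ^ 2) * τ / (3 * M ^ 2) + τ * R)) := by
  have h12 : (1 : WithTop ℕ∞) ≤ 2 := by norm_num
  have hK : IsCompact (Icc 0 τ ×ˢ Icc 0 R) := isCompact_Icc.prod isCompact_Icc
  set w : ℝ → ℝ → ℝ := fun t x => U (t + s) (x + y) with hwdef
  have hw : ContDiff ℝ 2 (Function.uncurry w) := by
    have : Function.uncurry w = Function.uncurry U ∘ fun p => (p.1 + s, p.2 + y) := rfl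
    rw [this]
    exact hU.contDiff.comp (by fun_prop)
  have hU1 := hU.contDiff.of_le h12
  have hw1 := hw.of_le h12
  have hUx : ContDiff ℝ 1 (Function.uncurry fun t x => deriv (U t) x) :=
    hU.contDiff.deriv_right (by norm_num [one_add_one_eq_two])
  have hwx : ContDiff ℝ 1 (Function.uncurry fun t x => deriv (w t) x) :=
    hw.deriv_right (by norm_num [one_add_one_eq_two])
  have cU : Continuous fun p : ℝ × ℝ => U p.1 p.2 := hU.contDiff.continuous
  have cw : Continuous fun p : ℝ × ℝ => w p.1 p.2 := hw.continuous
  have cP : Continuous fun p : ℝ × ℝ => spePrimitive U p.1 p.2 :=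
    continuous_spePrimitive hU.contDiff.continuous
  have cPw : Continuous fun p : ℝ × ℝ => spePrimitive U (p.1 + s) (p.2 + y) :=
    cP.comp (by fun_prop : Continuous fun p : ℝ × ℝ => (p.1 + s, p.2 + y))
  have hUM : ∀ t ∈ Icc 0 τ, ∀ x ∈ Ici (0:ℝ), |U t x| ≤ M := fun t ht x hx =>
    hU.bound t ⟨ht.1, by linarith [ht.2]⟩ x hx
  have hUM' : ∀ t ∈ Icc 0 τ, ∀ x ∈ Ici (0:ℝ), |U (t + s) x| ≤ M := fun t ht x hx =>
    hU.bound (t + s) ⟨by linarith [ht.1], by linarith [ht.2]⟩ x hx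
  have hwM : ∀ t ∈ Icc 0 τ, ∀ x ∈ Ici (0:ℝ), |w t x| ≤ M := fun t ht x hx =>
    hUM' t ht _ (add_nonneg hx hy)
  have dwt : ∀ t x, deriv (fun r => w r x) t = deriv (fun r => U r (x + y)) (t + s) := fun t x =>
    deriv_comp_add_const (fun r => U r (x + y)) s t
  have dwx : ∀ t x, deriv (w t) x = deriv (U (t + s)) (x + y) := fun t x =>
    deriv_comp_add_const (U (t + s)) y x
  have dwxx : ∀ t x, deriv (deriv (w t)) x = deriv (deriv (U (t + s))) (x + y) := fun t x => by
    rw [funext (dwx t)]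
    exact deriv_comp_add_const (deriv (U (t + s))) y x
  set D : ℝ → ℝ → ℝ := fun t x => w t x - U t x with hDdef
  set a : ℝ → ℝ → ℝ := fun t x => w t x ^ 2 + w t x * U t x + U t x ^ 2 with hadef
  set S : ℝ → ℝ → ℝ := fun t x => spePrimitive U (t + s) (x + y) - spePrimitive U t x with hSdef
  set φ : ℝ → ℝ := fun x => (R - x) ^ 3 with hφdef
  have cD : Continuous (Function.uncurry D) := cw.sub cU
  have hφ0 : ∀ x ∈ Icc 0 R, 0 ≤ φ x := fun x hx => pow_nonneg (by linarith [hx.2]) 3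
  have hφanti : ∀ x ∈ Icc 0 R, ∀ z ∈ Icc 0 x, φ x ≤ φ z := fun x hx z hz =>
    pow_le_pow_left₀ (by linarith [hx.2]) (by linarith [hz.2]) 3
  have hφR3 : ∀ x ∈ Icc 0 R, φ x ≤ R ^ 3 := fun x hx =>
    pow_le_pow_left₀ (by linarith [hx.2]) (by linarith [hx.1]) 3
  have hφ2 : ∀ x ∈ Icc 0 R, (R - x) ^ 2 ≤ R ^ 2 := fun x hx =>
    pow_le_pow_left₀ (by linarith [hx.2]) (by linarith [hx.1]) 2
  have hR3 : 0 ≤ R ^ 3 := by positivity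
  have hR2 : 0 ≤ R ^ 2 := by positivity
  have key := weighted_contraction (D := D) (a := a) (S := S) (φ := φ) (ε := ε) (τ := τ) (R := R)
    (A := 3 * M ^ 2) (B := 2 * M) (L := R ^ 3 + 3 * R ^ 2 + 6 * R) (l := R)
    (hw.sub hU.contDiff) ((hw1.pow 2).add (hw1.mul hU1) |>.add (hU1.pow 2))
    (by
      have : Function.uncurry S = fun p => S p.1 p.2 := rfl
      rw [this]; simp only [hSdef]; fun_prop)
    (by fun_prop) hε hτ hR (by positivity) hR hφ0
    (fun x hx => by rw [hφdef, deriv_cube_layer]; simp only; nlinarith [sq_nonneg (R - x)])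
    (by simp [hφdef]) (by rw [hφdef, deriv_cube_layer]; simp)
    (fun x hx => by linarith [hφR3 x hx])
    (fun x hx => by rw [hφdef, deriv_cube_layer]; simp only; linarith [hφ2 x hx])
    (fun x hx => by
      rw [hφdef, deriv_deriv_cube_layer]; simp only
      rw [abs_of_nonneg (by linarith [hx.2])]; linarith [hx.1])
    (fun t _ x _ => quadratic_nonneg _ _)
    (fun t ht x hx => quadratic_le (hwM t ht x hx.1) (hUM t ht x hx.1))
    (fun t ht x hx => by
      have := hUM t ht x hx.1; have := hwM t ht x hx.1
      simp only [hDdef]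
      exact (abs_sub _ _).trans (by linarith))
    (fun t ht x hx => by
      have d1 : deriv (fun s => D s x) t = deriv (fun s => w s x) t - deriv (fun s => U s x) t :=
        ((hw1.hasDerivAt_left t x).sub (hU1.hasDerivAt_left t x)).deriv
      have d2 : ∀ x, deriv (D t) x = deriv (w t) x - deriv (U t) x := fun x =>
        ((hw1.hasDerivAt_right t x).sub (hU1.hasDerivAt_right t x)).deriv
      have d3 : deriv (deriv (D t)) x = deriv (deriv (w t)) x - deriv (deriv (U t)) x := by
        rw [funext d2]
        exact ((hwx.hasDerivAt_right t x).sub (hUx.hasDerivAt_right t x)).deriv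
      have d4 : deriv (a t) x = (2 * w t x * deriv (w t) x
          + (deriv (w t) x * U t x + w t x * deriv (U t) x)) + 2 * U t x * deriv (U t) x := by
        have := ((((hw1.hasDerivAt_right t x).pow 2).add
          ((hw1.hasDerivAt_right t x).mul (hU1.hasDerivAt_right t x))).add
          ((hU1.hasDerivAt_right t x).pow 2)).deriv
        refine Eq.trans this ?_
        norm_num
      have e1 := hU.pde t ⟨ht.1, by linarith [ht.2]⟩ x hx.1
      have e2 := hU.pde (t + s) ⟨by linarith [ht.1], by linarith [ht.2]⟩ (x + y)
        (add_nonneg hx.1 hy)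
      rw [← dwt, ← dwx, ← dwxx] at e2
      rw [d1, d2, d3, d4]
      simp only [hDdef, hadef, hSdef]
      simp only [hwdef] at e2 ⊢
      linear_combination e2 - e1)
  set I : ℝ → ℝ := fun t => ∫ x in (0:ℝ)..R, |D t x| * φ x with hIdef
  have cφ : Continuous φ := by fun_prop
  have cDp : Continuous fun p : ℝ × ℝ => D p.1 p.2 := cD
  have cI : Continuous I :=
    intervalIntegral.continuous_parametric_intervalIntegral_of_continuous' (by
      have : (Function.uncurry fun t x => |D t x| * φ x) = fun p => |D p.1 p.2| * φ p.2 := rfl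
      rw [this]; fun_prop) _ _
  have hS : ∀ t ∈ Icc 0 τ, ∀ x ∈ Icc 0 R, |S t x| * φ x ≤ M * y * R ^ 3 + I t := by
    intro t ht x hx
    have hi : ∀ a b, IntervalIntegrable (U (t + s)) volume a b := fun a b =>
      (hU.contDiff.continuous.uncurry_left _).intervalIntegrable _ _
    have cw' : Continuous (w t) := hw.continuous.uncurry_left t
    have cU' : Continuous (U t) := hU.contDiff.continuous.uncurry_left t
    have cD' : Continuous (D t) := cw'.sub cU'
    have e1 : S t x = spePrimitive U (t + s) y + ∫ z in (0:ℝ)..x, D t z := by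
      simp only [hSdef, hDdef, spePrimitive]
      rw [intervalIntegral.integral_sub (cw'.intervalIntegrable _ _) (cU'.intervalIntegrable _ _),
        ← intervalIntegral.integral_add_adjacent_intervals (hi 0 y) (hi y (x + y))]
      have : ∫ z in (0:ℝ)..x, w t z = ∫ z in y..(x + y), U (t + s) z := by
        simp only [hwdef]
        rw [intervalIntegral.integral_comp_add_right (fun z => U (t + s) z) y, zero_add]
      rw [this]; ring
    have e2 : |S t x| ≤ M * y + ∫ z in (0:ℝ)..x, |D t z| := by
      rw [e1]
      refine (abs_add_le _ _).trans (add_le_add ?_ ?_)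
      · exact abs_spePrimitive_le hy fun z hz => hUM' t ht z hz.1.le
      · exact intervalIntegral.abs_integral_le_integral_abs hx.1
    have e3 : (∫ z in (0:ℝ)..x, |D t z|) * φ x ≤ ∫ z in (0:ℝ)..x, |D t z| * φ z := by
      rw [← intervalIntegral.integral_mul_const]
      apply intervalIntegral.integral_mono_on hx.1
      · apply Continuous.intervalIntegrable; fun_prop
      · apply Continuous.intervalIntegrable; fun_prop
      · intro z hz
        exact mul_le_mul_of_nonneg_left (hφanti x hx z hz) (abs_nonneg _)
    have e4 : ∫ z in (0:ℝ)..x, |D t z| * φ z ≤ I t := by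
      apply intervalIntegral.integral_mono_interval le_rfl hx.1 hx.2
      · filter_upwards [ae_restrict_mem measurableSet_Ioc] with z hz
        exact mul_nonneg (abs_nonneg _) (hφ0 z ⟨hz.1.le, hz.2⟩)
      · apply Continuous.intervalIntegrable; fun_prop
    have e5 : M * y * φ x ≤ M * y * R ^ 3 :=
      mul_le_mul_of_nonneg_left (hφR3 x hx) (by positivity)
    calc |S t x| * φ x ≤ (M * y + ∫ z in (0:ℝ)..x, |D t z|) * φ x :=
          mul_le_mul_of_nonneg_right e2 (hφ0 x hx)
      _ ≤ _ := by rw [add_mul]; linarith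
  have cS : Continuous fun p : ℝ × ℝ => S p.1 p.2 := by simp only [hSdef]; fun_prop
  have ca : Continuous fun p : ℝ × ℝ => a p.1 p.2 := by simp only [hadef]; fun_prop
  have low : ∫ p in Icc 0 τ ×ˢ Icc 0 R, (Real.exp (-(R * p.1)) * (R * (|D p.1 p.2| * φ p.2) - I p.1)
      - M * y * R ^ 3) ≤ ∫ p in Icc 0 τ ×ˢ Icc 0 R, Real.exp (-(R * p.1)) *
        (R * (|D p.1 p.2| * φ p.2) + a p.1 p.2 * |D p.1 p.2| * (-deriv φ p.2)
          - |S p.1 p.2| * φ p.2) := by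
    rw [hφdef, deriv_cube_layer, ← hφdef]
    apply setIntegral_mono_on _ _ (measurableSet_Icc.prod measurableSet_Icc)
    · rintro ⟨t, x⟩ ⟨ht, hx⟩
      simp only at ht hx
      simp only
      have h1 := hS t ht x hx
      have h2 : Real.exp (-(R * t)) ≤ 1 :=
        Real.exp_le_one_iff.2 (by have := mul_nonneg hR ht.1; linarith)
      have h3 : 0 ≤ a t x * |D t x| * (- -(3 * (R - x) ^ 2)) := by
        have := quadratic_nonneg (w t x) (U t x)
        rw [neg_neg]
        exact mul_nonneg (mul_nonneg this (abs_nonneg _)) (by positivity)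
      have h4 : 0 ≤ M * y * R ^ 3 := by positivity
      have h5 : Real.exp (-(R * t)) * (R * (|D t x| * φ x) - I t - M * y * R ^ 3) ≤
          Real.exp (-(R * t)) * (R * (|D t x| * φ x)
            + a t x * |D t x| * (- -(3 * (R - x) ^ 2)) - |S t x| * φ x) :=
        mul_le_mul_of_nonneg_left (by linarith) (Real.exp_pos _).le
      have h6 := mul_le_mul_of_nonneg_right h2 h4
      refine le_trans ?_ h5
      linarith
    · exact Continuous.integrableOn_of_isCompact (by fun_prop) hK
    · exact Continuous.integrableOn_of_isCompact (by fun_prop) hK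
  have zero : ∫ p in Icc 0 τ ×ˢ Icc 0 R, (Real.exp (-(R * p.1)) * (R * (|D p.1 p.2| * φ p.2) - I p.1)
      - M * y * R ^ 3) = -(M * y * R ^ 3 * (τ * R)) := by
    rw [integral_rect_eq (f := fun t x => Real.exp (-(R * t)) * (R * (|D t x| * φ x) - I t)
      - M * y * R ^ 3) (by
        have : (Function.uncurry fun t x => Real.exp (-(R * t)) * (R * (|D t x| * φ x) - I t)
          - M * y * R ^ 3) = fun p => Real.exp (-(R * p.1)) * (R * (|D p.1 p.2| * φ p.2) - I p.1)
          - M * y * R ^ 3 := rfl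
        rw [this]; fun_prop) hτ hR]
    have h : ∀ t, ∫ x in (0:ℝ)..R, (Real.exp (-(R * t)) * (R * (|D t x| * φ x) - I t)
        - M * y * R ^ 3) = -(M * y * R ^ 3 * R) := by
      intro t
      have c : Continuous (D t) := cD.uncurry_left t
      have c1 : IntervalIntegrable (fun x => R * (|D t x| * φ x)) volume 0 R :=
        Continuous.intervalIntegrable (by fun_prop) _ _
      have c2 : IntervalIntegrable (fun x : ℝ => I t) volume 0 R :=
        Continuous.intervalIntegrable (by fun_prop) _ _
      have c3 : IntervalIntegrable (fun x : ℝ => M * y * R ^ 3) volume 0 R :=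
        Continuous.intervalIntegrable (by fun_prop) _ _
      rw [intervalIntegral.integral_sub ((c1.sub c2).const_mul _) c3,
        intervalIntegral.integral_const_mul, intervalIntegral.integral_sub c1 c2,
        intervalIntegral.integral_const_mul]
      simp [hIdef]
      ring
    simp only [h]
    simp
  have := key
  simp only [hDdef, hwdef, hφdef, zero_add, sub_zero] at this low zero ⊢
  linarith

end translation

section sequences

lemma abs_clip_le {M : ℝ} (hM : 0 ≤ M) (x : ℝ) : |max (-M) (min M x)| ≤ M :=
  abs_le.2 ⟨le_max_left _ _, max_le (by linarith) (min_le_left _ _)⟩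

lemma clip_eq_self {M x : ℝ} (hx : |x| ≤ M) : max (-M) (min M x) = x := by
  rw [min_eq_right (abs_le.1 hx).2, max_eq_right (abs_le.1 hx).1]

lemma abs_clip_sub_clip_le (M x y : ℝ) :
    |max (-M) (min M x) - max (-M) (min M y)| ≤ |x - y| := by
  refine (abs_max_sub_max_le_max _ _ _ _).trans (max_le (by simp) ?_)
  refine (abs_min_sub_min_le_max _ _ _ _).trans (max_le (by simp) le_rfl)

lemma exists_contDiff_integral_sub_le {f : ℝ → ℝ} (hf : Measurable f) {M R δ : ℝ}
    (hM : ∀ x, |f x| ≤ M) (hR : 0 ≤ R) (hδ : 0 < δ) :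
    ∃ w : ℝ → ℝ, ContDiff ℝ 2 w ∧ (∀ x ∈ Icc 0 R, |w x| ≤ M + 1) ∧
      ∫ x in (0:ℝ)..R, |f x - w x| ≤ δ := by
  have hM0 : 0 ≤ M := (abs_nonneg _).trans (hM 0)
  have hfi : IntegrableOn f (Icc 0 R) :=
    Measure.integrableOn_of_bounded (M := M) (by simp) hf.aestronglyMeasurable
      (Eventually.of_forall hM)
  obtain ⟨g, -, hg, hgc, hgi⟩ :=
    Integrable.exists_hasCompactSupport_integral_sub_le hfi (half_pos hδ)
  set h : ℝ → ℝ := fun x => max (-M) (min M (g x)) with hh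
  have hhc : Continuous h := by fun_prop
  obtain ⟨p, hp⟩ := exists_polynomial_near_of_continuousOn 0 R h hhc.continuousOn
    (min 1 (δ / 2 / (R + 1))) (lt_min one_pos (by positivity))
  have hp1 : ∀ x ∈ Icc 0 R, |p.eval x - h x| ≤ 1 := fun x hx =>
    (hp x hx).le.trans (min_le_left _ _)
  have hp2 : ∀ x ∈ Icc 0 R, |p.eval x - h x| ≤ δ / 2 / (R + 1) := fun x hx =>
    (hp x hx).le.trans (min_le_right _ _)
  refine ⟨fun x => p.eval x, by simpa [Polynomial.coe_aeval_eq_eval] using p.contDiff_aeval (𝕜 := ℝ) 2, fun x hx => ?_, ?_⟩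
  · have := abs_clip_le hM0 (g x)
    calc |p.eval x| = |h x + (p.eval x - h x)| := by ring_nf
      _ ≤ |h x| + |p.eval x - h x| := abs_add_le _ _
      _ ≤ M + 1 := add_le_add this (hp1 x hx)
  · rw [intervalIntegral.integral_of_le hR, ← integral_Icc_eq_integral_Ioc]
    have hpi : IntegrableOn (fun x => p.eval x) (Icc 0 R) :=
      Continuous.integrableOn_of_isCompact p.continuous isCompact_Icc
    have e : ∫ x in Icc 0 R, |f x - p.eval x|
        ≤ ∫ x in Icc 0 R, (‖f x - g x‖ + δ / 2 / (R + 1)) := by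
      apply setIntegral_mono_on (hfi.sub hpi).norm ((hfi.sub hgi).norm.add (by simp))
        measurableSet_Icc
      intro x hx
      have h1 : |f x - h x| ≤ |f x - g x| := by
        have := abs_clip_sub_clip_le M (f x) (g x)
        rwa [clip_eq_self (hM x)] at this
      have h2 := hp2 x hx
      calc |f x - p.eval x| = |(f x - h x) - (p.eval x - h x)| := by ring_nf
        _ ≤ |f x - h x| + |p.eval x - h x| := abs_sub _ _
        _ ≤ _ := add_le_add h1 h2
    have e' := integral_add (hfi.sub hgi).norm
      (g := fun _ => δ / 2 / (R + 1)) (integrableOn_const (by simp))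
    simp only [Pi.sub_apply] at e'
    rw [e'] at e
    simp only [setIntegral_const, smul_eq_mul] at e
    have e2 : (volume : Measure ℝ).real (Icc 0 R) = R := by simp [hR]
    rw [e2] at e
    have e3 : R * (δ / 2 / (R + 1)) ≤ δ / 2 := by
      rw [mul_div_assoc', div_le_iff₀ (by positivity)]; nlinarith
    linarith

lemma abs_sub_le_cube {u w κ : ℝ} (hκ : 0 < κ) :
    |u - w| ≤ κ + 4 / κ ^ 2 * |u ^ 3 - w ^ 3| := by
  have h1 : |u - w| ^ 3 ≤ 4 * |u ^ 3 - w ^ 3| := by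
    rw [← quadratic_mul_abs_sub]
    have h2 : |u - w| ^ 3 = (u - w) ^ 2 * |u - w| := by rw [← sq_abs]; ring
    rw [h2, ← mul_assoc]
    exact mul_le_mul_of_nonneg_right (by nlinarith [sq_nonneg (u + w)]) (abs_nonneg _)
  by_cases h : |u - w| ≤ κ
  · have : 0 ≤ 4 / κ ^ 2 * |u ^ 3 - w ^ 3| := by positivity
    linarith
  · push Not at h
    have h3 : |u - w| ≤ |u - w| ^ 3 / κ ^ 2 := by
      rw [le_div_iff₀ (by positivity)]
      have : κ ^ 2 ≤ |u - w| ^ 2 := pow_le_pow_left₀ hκ.le h.le 2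
      nlinarith [abs_nonneg (u - w)]
    have h4 : |u - w| ^ 3 / κ ^ 2 ≤ 4 / κ ^ 2 * |u ^ 3 - w ^ 3| := by
      rw [div_mul_eq_mul_div]; gcongr
    linarith

/-- A vanishing viscosity sequence together with the limits of its data. -/
structure IsViscousSequence (T M : ℝ) (e : ℕ → ℝ) (U : ℕ → ℝ → ℝ → ℝ) (u₀ g : ℝ → ℝ) : Prop where
  T_pos : 0 < T
  M_pos : 0 < M
  e_pos : ∀ n, 0 < e n
  e_lim : Tendsto e atTop (nhds 0)
  sol : ∀ n, IsViscousSolution (e n) T M (U n)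
  meas_u₀ : Measurable u₀
  meas_g : Measurable g
  bound_u₀ : ∀ x, |u₀ x| ≤ M
  bound_g : ∀ t, |g t| ≤ M
  lim_u₀ : ∀ R, 0 ≤ R → Tendsto (fun n => ∫ x in (0:ℝ)..R, |U n 0 x - u₀ x|) atTop (nhds 0)
  lim_g : Tendsto (fun n => ∫ t in (0:ℝ)..T, |U n t 0 - g t|) atTop (nhds 0)

namespace IsViscousSequence
variable {T M : ℝ} {e : ℕ → ℝ} {U : ℕ → ℝ → ℝ → ℝ} {u₀ g : ℝ → ℝ}

lemma comp_strictMono (h : IsViscousSequence T M e U u₀ g) {k : ℕ → ℕ} (hk : StrictMono k) :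
    IsViscousSequence T M (e ∘ k) (U ∘ k) u₀ g where
  T_pos := h.T_pos
  M_pos := h.M_pos
  e_pos _ := h.e_pos _
  e_lim := h.e_lim.comp hk.tendsto_atTop
  sol _ := h.sol _
  meas_u₀ := h.meas_u₀
  meas_g := h.meas_g
  bound_u₀ := h.bound_u₀
  bound_g := h.bound_g
  lim_u₀ R hR := (h.lim_u₀ R hR).comp hk.tendsto_atTop
  lim_g := h.lim_g.comp hk.tendsto_atTop

lemma continuous (h : IsViscousSequence T M e U u₀ g) (n : ℕ) :
    Continuous (Function.uncurry (U n)) := (h.sol n).contDiff.continuous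

/-- Uniform comparison of the sequence with a fixed smooth function. -/
lemma comparison (h : IsViscousSequence T M e U u₀ g) {w : ℝ → ℝ → ℝ} {R₀ : ℝ}
    (hw : ContDiff ℝ 2 (Function.uncurry w))
    (hwM : ∀ t ∈ Icc 0 T, ∀ x ∈ Icc 0 R₀, |w t x| ≤ M + 1) :
    ∃ C : ℝ, 0 ≤ C ∧ ∀ (R : ℝ) (φ : ℝ → ℝ), 0 ≤ R → R ≤ R₀ → ContDiff ℝ 2 φ →
      (∀ x ∈ Icc 0 R, 0 ≤ φ x) → (∀ x ∈ Icc 0 R, deriv φ x ≤ 0) → φ R = 0 → deriv φ R = 0 →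
      ∃ C' : ℝ, 0 ≤ C' ∧ ∀ᶠ n in atTop, ∀ τ ∈ Icc 0 T,
      (∫ x in (0:ℝ)..R, |U n τ x - w τ x| * φ x)
      + (∫ p in Icc 0 τ ×ˢ Icc 0 R, |U n p.1 p.2 ^ 3 - w p.1 p.2 ^ 3| * (-deriv φ p.2))
      ≤ (∫ x in (0:ℝ)..R, |U n 0 x - w 0 x| * φ x)
        + 3 * (M + 1) ^ 2 * φ 0 * (∫ t in (0:ℝ)..τ, |U n t 0 - w t 0|)
        + C * (τ * ∫ x in (0:ℝ)..R, φ x) + C' * e n := by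
  have hM := h.M_pos
  have hK : IsCompact (Icc 0 T ×ˢ Icc 0 R₀) := isCompact_Icc.prod isCompact_Icc
  have hwx : ContDiff ℝ 1 (Function.uncurry fun t x => deriv (w t) x) :=
    hw.deriv_right (by norm_num [one_add_one_eq_two])
  have cw : Continuous fun p : ℝ × ℝ => w p.1 p.2 := hw.continuous
  have c1 : Continuous fun p : ℝ × ℝ => deriv (w p.1) p.2 := hwx.continuous
  have c2 : Continuous fun p : ℝ × ℝ => deriv (fun s => w s p.2) p.1 :=
    (hw.deriv_left (m := 1) (by norm_num [one_add_one_eq_two])).continuous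
  have c3 : Continuous fun p : ℝ × ℝ => deriv (deriv (w p.1)) p.2 :=
    (hwx.deriv_right (m := 0) (by norm_num)).continuous
  obtain ⟨C₁, hC₁⟩ := hK.exists_bound_of_continuousOn (f := fun p : ℝ × ℝ =>
    deriv (fun s => w s p.2) p.1 + 3 * w p.1 p.2 ^ 2 * deriv (w p.1) p.2)
    (Continuous.continuousOn (by fun_prop))
  obtain ⟨C₂, hC₂⟩ := hK.exists_bound_of_continuousOn (f := fun p : ℝ × ℝ =>
    deriv (deriv (w p.1)) p.2) c3.continuousOn
  refine ⟨(M + 1) * |R₀| + |C₁| + |C₂|, by positivity, fun R φ hR hRR hφ hφ0 hφ' hφR hφR' => ?_⟩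
  obtain ⟨L₀, hL₀⟩ := isCompact_Icc.exists_bound_of_continuousOn (s := Icc 0 R)
    hφ.continuous.continuousOn
  obtain ⟨L₁, hL₁⟩ := isCompact_Icc.exists_bound_of_continuousOn (s := Icc 0 R)
    (hφ.continuous_deriv (by norm_num)).continuousOn
  have hφ1 : ContDiff ℝ 1 (deriv φ) := by
    have := (contDiff_succ_iff_deriv (n := 1) (f := φ)).1 (by simpa [one_add_one_eq_two] using hφ)
    exact this.2.2
  obtain ⟨L₂, hL₂⟩ := isCompact_Icc.exists_bound_of_continuousOn (s := Icc 0 R)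
    (hφ1.continuous_deriv (by norm_num)).continuousOn
  set L := |L₀| + |L₁| + |L₂| with hL
  have hLn : 0 ≤ L := by positivity
  refine ⟨2 * (M + 1) * L * (1 / (3 * (M + 1) ^ 2) + T + T * R), ?_, ?_⟩
  · have := h.T_pos
    positivity
  filter_upwards [h.e_lim.eventually (gt_mem_nhds one_pos)] with n hn τ hτ
  have hi : ∀ a b, IntervalIntegrable φ volume a b := fun a b =>
    hφ.continuous.intervalIntegrable a b
  have hIφ : 0 ≤ ∫ x in (0:ℝ)..R, φ x := intervalIntegral.integral_nonneg hR hφ0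
  have key := (h.sol n).comparison (τ := τ) (R := R) (L := L) (M' := M + 1) (C := |C₁| + |C₂|)
    hw hφ (h.e_pos n) hτ.1 hτ.2 hR (by positivity) (by linarith) hφ0 hφ' hφR hφR'
    (fun x hx => (le_abs_self _).trans ((hL₀ x hx).trans ((le_abs_self _).trans
      (by rw [hL]; linarith [abs_nonneg L₁, abs_nonneg L₂]))))
    (fun x hx => (neg_le_abs _).trans ((hL₁ x hx).trans ((le_abs_self _).trans
      (by rw [hL]; linarith [abs_nonneg L₀, abs_nonneg L₂]))))
    (fun x hx => (hL₂ x hx).trans ((le_abs_self _).trans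
      (by rw [hL]; linarith [abs_nonneg L₀, abs_nonneg L₁])))
    (fun t ht x hx => hwM t ⟨ht.1, ht.2.trans hτ.2⟩ x ⟨hx.1, hx.2.trans hRR⟩)
    (fun t ht x hx => by
      have hm : (t, x) ∈ Icc 0 T ×ˢ Icc 0 R₀ := ⟨⟨ht.1, ht.2.trans hτ.2⟩, hx.1, hx.2.trans hRR⟩
      have h1 := (hC₁ _ hm).trans (le_abs_self _)
      have h2 := (hC₂ _ hm).trans (le_abs_self _)
      simp only [Real.norm_eq_abs] at h1 h2
      refine (abs_sub _ _).trans (add_le_add h1 ?_)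
      rw [abs_mul, abs_of_pos (h.e_pos n)]
      calc e n * _ ≤ 1 * |C₂| := mul_le_mul hn.le h2 (abs_nonneg _) zero_le_one
        _ = |C₂| := one_mul _)
  refine key.trans ?_
  have k1 : ((M + 1) * R + (|C₁| + |C₂|)) * (τ * ∫ x in (0:ℝ)..R, φ x)
      ≤ ((M + 1) * |R₀| + |C₁| + |C₂|) * (τ * ∫ x in (0:ℝ)..R, φ x) := by
    apply mul_le_mul_of_nonneg_right _ (mul_nonneg hτ.1 hIφ)
    have : R ≤ |R₀| := hRR.trans (le_abs_self _)
    rw [add_assoc]; gcongr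
  have k2 : e n * (2 * (M + 1) * L * (1 / (3 * (M + 1) ^ 2) + τ + τ * R))
      ≤ 2 * (M + 1) * L * (1 / (3 * (M + 1) ^ 2) + T + T * R) * e n := by
    rw [mul_comm]
    have := (h.e_pos n).le
    have := hτ.2
    gcongr
  linarith

end IsViscousSequence
end sequences

section layers

lemma integral_abs_sub_triangle {a b c : ℝ → ℝ} {R : ℝ} (hR : 0 ≤ R)
    (hac : IntervalIntegrable (fun x => |a x - c x|) volume 0 R)
    (hab : IntervalIntegrable (fun x => |a x - b x|) volume 0 R)
    (hbc : IntervalIntegrable (fun x => |b x - c x|) volume 0 R) :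
    ∫ x in (0:ℝ)..R, |a x - c x|
      ≤ (∫ x in (0:ℝ)..R, |a x - b x|) + ∫ x in (0:ℝ)..R, |b x - c x| := by
  rw [← intervalIntegral.integral_add hab hbc]
  exact intervalIntegral.integral_mono_on hR hac (hab.add hbc) fun x _ => abs_sub_le _ _ _

lemma intervalIntegrable_of_bounded {f : ℝ → ℝ} (hf : Measurable f) {M : ℝ}
    (hM : ∀ x, |f x| ≤ M) (a b : ℝ) : IntervalIntegrable f volume a b := by
  rw [intervalIntegrable_iff]
  exact Measure.integrableOn_of_bounded (M := M) (by simp [uIoc]) hf.aestronglyMeasurable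
    (Eventually.of_forall hM)

lemma integral_le_mul_of_forall_le {f : ℝ → ℝ} {R K : ℝ} (hR : 0 ≤ R)
    (hf : IntervalIntegrable f volume 0 R) (h : ∀ x ∈ Icc 0 R, f x ≤ K) :
    ∫ x in (0:ℝ)..R, f x ≤ R * K := by
  have := intervalIntegral.integral_mono_on hR hf (g := fun _ => K) (by simp) h
  simpa using this

namespace IsViscousSequence
variable {T M : ℝ} {e : ℕ → ℝ} {U : ℕ → ℝ → ℝ → ℝ} {u₀ g : ℝ → ℝ}

/-- Uniform continuity in `L¹` of the sequence at the initial time. -/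
lemma initial_continuity (h : IsViscousSequence T M e U u₀ g) {R η : ℝ} (hR : 0 ≤ R) (hη : 0 < η) :
    ∃ r₀ > 0, ∀ᶠ n in atTop, ∀ s ∈ Icc 0 r₀, ∀ y ∈ Icc 0 r₀,
      ∫ x in (0:ℝ)..R, |U n s (x + y) - U n 0 x| ≤ η := by
  have hM := h.M_pos
  have hT := h.T_pos
  set R₂ := R + 2 with hR₂
  set F := R₂ ^ 3 with hF
  have hF1 : 1 ≤ F := one_le_pow₀ (by linarith)
  obtain ⟨w, hw, hwM, hwi⟩ := exists_contDiff_integral_sub_le h.meas_u₀ h.bound_u₀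
    (by linarith : 0 ≤ R₂) (δ := η / 8 / F) (by positivity)
  have hw1 : ContDiff ℝ 1 w := hw.of_le (by norm_num)
  obtain ⟨Lw, hLw⟩ := (isCompact_Icc (a := 0) (b := R₂)).exists_bound_of_continuousOn
    (hw1.continuous_deriv le_rfl).continuousOn
  have hLip : ∀ x ∈ Icc 0 R₂, ∀ z ∈ Icc 0 R₂, |w z - w x| ≤ |Lw| * |z - x| := fun x hx z hz =>
    (convex_Icc 0 R₂).norm_image_sub_le_of_norm_deriv_le
      (fun a _ => (hw1.differentiable (by norm_num)) a)
      (fun a ha => (hLw a ha).trans (le_abs_self _)) hx hz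
  have hw' : ContDiff ℝ 2 (Function.uncurry fun _ x : ℝ => w x) := by
    have : (Function.uncurry fun _ x : ℝ => w x) = w ∘ Prod.snd := rfl
    rw [this]; exact hw.comp contDiff_snd
  obtain ⟨C, hC, hcomp⟩ := h.comparison hw' (fun t _ x hx => hwM x hx)
  obtain ⟨C', hC', hcomp⟩ := hcomp R₂ (fun x => (R₂ - x) ^ 3) (by linarith) le_rfl (by fun_prop)
    (fun x hx => pow_nonneg (by linarith [hx.2]) 3)
    (fun x hx => by rw [deriv_cube_layer]; nlinarith [sq_nonneg (R₂ - x)])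
    (by simp) (by rw [deriv_cube_layer]; simp)
  set K := 3 * (M + 1) ^ 2 * F * (2 * M + 1) + C * (R₂ * F) + R * |Lw| with hK
  have hK0 : 0 ≤ K := by
    have : 0 ≤ R₂ := by linarith
    positivity
  refine ⟨min 1 (min T (η / 4 / (K + 1))), by positivity, ?_⟩
  have ev1 : ∀ᶠ n in atTop, F * (∫ x in (0:ℝ)..R₂, |U n 0 x - u₀ x|) < η / 8 := by
    have := (h.lim_u₀ R₂ (by linarith)).const_mul F
    rw [mul_zero] at this
    exact this.eventually (gt_mem_nhds (by positivity))
  have ev2 : ∀ᶠ n in atTop, C' * e n < η / 8 := by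
    have := h.e_lim.const_mul C'
    rw [mul_zero] at this
    exact this.eventually (gt_mem_nhds (by positivity))
  filter_upwards [hcomp, ev1, ev2] with n hn h1 h2 s hs y hy
  simp only [mem_Icc, le_min_iff] at hs hy
  have cU : ∀ t, Continuous (U n t) := fun t => (h.continuous n).uncurry_left t
  have cw : Continuous w := hw.continuous
  have hb : ∀ t ∈ Icc 0 T, ∀ x ∈ Ici (0:ℝ), |U n t x| ≤ M := (h.sol n).bound
  have key := hn s ⟨hs.1, hs.2.2.1⟩
  have pos : 0 ≤ ∫ p in Icc 0 s ×ˢ Icc 0 R₂, |U n p.1 p.2 ^ 3 - w p.2 ^ 3|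
      * (-deriv (fun x => (R₂ - x) ^ 3) p.2) := by
    apply setIntegral_nonneg (measurableSet_Icc.prod measurableSet_Icc)
    intro p _
    rw [deriv_cube_layer, neg_neg]
    positivity
  have hφF : ∀ x ∈ Icc 0 R₂, (R₂ - x) ^ 3 ≤ F := fun x hx =>
    pow_le_pow_left₀ (by linarith [hx.2]) (by linarith [hx.1]) 3
  have s1 : ∫ x in (0:ℝ)..R₂, |U n 0 x - w x| * (R₂ - x) ^ 3
      ≤ F * ∫ x in (0:ℝ)..R₂, |U n 0 x - w x| := by
    have := cU 0
    rw [← intervalIntegral.integral_const_mul]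
    apply intervalIntegral.integral_mono_on (by linarith)
    · exact Continuous.intervalIntegrable (by fun_prop) _ _
    · exact Continuous.intervalIntegrable (by fun_prop) _ _
    · intro x hx
      rw [mul_comm]
      exact mul_le_mul_of_nonneg_right (hφF x hx) (abs_nonneg _)
  have iu : IntervalIntegrable u₀ volume 0 R₂ :=
    intervalIntegrable_of_bounded h.meas_u₀ h.bound_u₀ _ _
  have s2 : ∫ x in (0:ℝ)..R₂, |U n 0 x - w x| ≤ (∫ x in (0:ℝ)..R₂, |U n 0 x - u₀ x|)
      + ∫ x in (0:ℝ)..R₂, |u₀ x - w x| :=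
    integral_abs_sub_triangle (by linarith)
      (((cU 0).intervalIntegrable _ _).sub (cw.intervalIntegrable _ _)).abs
      (((cU 0).intervalIntegrable _ _).sub iu).abs (iu.sub (cw.intervalIntegrable _ _)).abs
  have s3 : ∫ t in (0:ℝ)..s, |U n t 0 - w 0| ≤ s * (2 * M + 1) := by
    have := (h.continuous n).uncurry_right 0
    apply integral_le_mul_of_forall_le hs.1 (Continuous.intervalIntegrable (by fun_prop) _ _)
    intro t ht
    have := hb t ⟨ht.1, ht.2.trans hs.2.2.1⟩ 0 self_mem_Ici
    have := hwM 0 ⟨le_rfl, by linarith⟩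
    exact (abs_sub _ _).trans (by linarith)
  have s4 : ∫ x in (0:ℝ)..R₂, (R₂ - x) ^ 3 ≤ R₂ * F :=
    integral_le_mul_of_forall_le (by linarith) (Continuous.intervalIntegrable (by fun_prop) _ _) hφF
  have s5 : ∫ x in (0:ℝ)..R, |U n s (x + y) - w (x + y)|
      ≤ ∫ x in (0:ℝ)..R₂, |U n s x - w x| * (R₂ - x) ^ 3 := by
    have := cU s
    rw [intervalIntegral.integral_comp_add_right (fun x => |U n s x - w x|) y, zero_add]
    have e1 : ∫ x in y..R + y, |U n s x - w x| ≤ ∫ x in y..R + y, |U n s x - w x| * (R₂ - x) ^ 3 := by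
      apply intervalIntegral.integral_mono_on (by linarith)
      · exact Continuous.intervalIntegrable (by fun_prop) _ _
      · exact Continuous.intervalIntegrable (by fun_prop) _ _
      · intro x hx
        exact le_mul_of_one_le_right (abs_nonneg _) (one_le_pow₀ (by linarith [hx.2, hy.2.1]))
    refine e1.trans ?_
    apply intervalIntegral.integral_mono_interval hy.1 (by linarith) (by linarith [hy.2.1])
    · filter_upwards [ae_restrict_mem measurableSet_Ioc] with z hz
      exact mul_nonneg (abs_nonneg _) (pow_nonneg (by linarith [hz.2]) 3)
    · exact Continuous.intervalIntegrable (by fun_prop) _ _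
  have s6 : ∫ x in (0:ℝ)..R, |w (x + y) - w x| ≤ R * (|Lw| * y) := by
    apply integral_le_mul_of_forall_le hR (Continuous.intervalIntegrable (by fun_prop) _ _)
    intro x hx
    have := hLip x ⟨hx.1, by linarith [hx.2]⟩ (x + y)
      ⟨by linarith [hx.1, hy.1], by linarith [hx.2, hy.2.1]⟩
    rwa [add_sub_cancel_left, abs_of_nonneg hy.1] at this
  have s7 : ∫ x in (0:ℝ)..R, |w x - U n 0 x| ≤ ∫ x in (0:ℝ)..R₂, |U n 0 x - w x| := by
    have := cU 0
    simp only [abs_sub_comm (w _)]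
    apply intervalIntegral.integral_mono_interval le_rfl hR (by linarith)
    · exact Eventually.of_forall fun x => abs_nonneg _
    · exact Continuous.intervalIntegrable (by fun_prop) _ _
  have s8 : ∫ x in (0:ℝ)..R, |U n s (x + y) - U n 0 x| ≤ (∫ x in (0:ℝ)..R, |U n s (x + y) - w (x + y)|)
      + ((∫ x in (0:ℝ)..R, |w (x + y) - w x|) + ∫ x in (0:ℝ)..R, |w x - U n 0 x|) := by
    have := cU 0
    have := cU s
    refine (integral_abs_sub_triangle (b := fun x => w (x + y)) hR
      (Continuous.intervalIntegrable (by fun_prop) _ _)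
      (Continuous.intervalIntegrable (by fun_prop) _ _)
      (Continuous.intervalIntegrable (by fun_prop) _ _)).trans ?_
    gcongr
    exact integral_abs_sub_triangle hR
      (Continuous.intervalIntegrable (by fun_prop) _ _)
      (Continuous.intervalIntegrable (by fun_prop) _ _)
      (Continuous.intervalIntegrable (by fun_prop) _ _)
  set r₀ := min 1 (min T (η / 4 / (K + 1))) with hr₀
  have hKr : η / 4 / (K + 1) * K ≤ η / 4 := by
    rw [div_mul_eq_mul_div, div_le_iff₀ (by positivity)]; nlinarith
  have m1 : 3 * (M + 1) ^ 2 * (R₂ - 0) ^ 3 * (∫ t in (0:ℝ)..s, |U n t 0 - w 0|)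
      ≤ η / 4 / (K + 1) * (3 * (M + 1) ^ 2 * F * (2 * M + 1)) := by
    rw [sub_zero, ← hF]
    calc _ ≤ 3 * (M + 1) ^ 2 * F * (s * (2 * M + 1)) := by gcongr
      _ ≤ 3 * (M + 1) ^ 2 * F * (η / 4 / (K + 1) * (2 * M + 1)) := by gcongr; exact hs.2.2.2
      _ = _ := by ring
  have m2 : C * (s * ∫ x in (0:ℝ)..R₂, (R₂ - x) ^ 3) ≤ η / 4 / (K + 1) * (C * (R₂ * F)) := by
    have : 0 ≤ R₂ := by linarith
    calc _ ≤ C * (s * (R₂ * F)) := by have := hs.1; gcongr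
      _ ≤ C * (η / 4 / (K + 1) * (R₂ * F)) := by gcongr; exact hs.2.2.2
      _ = _ := by ring
  have m3 : R * (|Lw| * y) ≤ η / 4 / (K + 1) * (R * |Lw|) := by
    calc _ ≤ R * (|Lw| * (η / 4 / (K + 1))) := by gcongr; exact hy.2.2.2
      _ = _ := by ring
  have m4 : F * (∫ x in (0:ℝ)..R₂, |U n 0 x - w x|) ≤ η / 8 + η / 8 := by
    have : F * (∫ x in (0:ℝ)..R₂, |u₀ x - w x|) ≤ η / 8 := by
      calc _ ≤ F * (η / 8 / F) := by gcongr
        _ = η / 8 := by field_simp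
    have := mul_le_mul_of_nonneg_left s2 (by linarith : 0 ≤ F)
    linarith
  have m5 : ∫ x in (0:ℝ)..R₂, |U n 0 x - w x| ≤ F * (∫ x in (0:ℝ)..R₂, |U n 0 x - w x|) :=
    le_mul_of_one_le_left (intervalIntegral.integral_nonneg (by linarith) fun _ _ => abs_nonneg _)
      hF1
  have hsum : η / 4 / (K + 1) * K = η / 4 / (K + 1) * (3 * (M + 1) ^ 2 * F * (2 * M + 1))
      + η / 4 / (K + 1) * (C * (R₂ * F)) + η / 4 / (K + 1) * (R * |Lw|) := by rw [hK]; ring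
  linarith

set_option maxHeartbeats 1000000 in
/-- Uniform closeness of the sequence to a smooth function of time near the boundary. -/
lemma boundary_layer (h : IsViscousSequence T M e U u₀ g) {η : ℝ} (hη : 0 < η) :
    ∃ w : ℝ → ℝ, ContDiff ℝ 2 w ∧ (∀ᶠ n in atTop, ∫ t in (0:ℝ)..T, |U n t 0 - w t| ≤ η) ∧
      ∃ r₀ > 0, ∀ r, 0 < r → r ≤ r₀ →
        ∀ᶠ n in atTop, ∫ p in Icc 0 T ×ˢ Icc 0 r, |U n p.1 p.2 - w p.1| ≤ η * r := by
  have hM := h.M_pos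
  have hT := h.T_pos
  set κ := η / (4 * T) with hκ
  have hκ0 : 0 < κ := by positivity
  set A := 32 * (M + 1) ^ 2 / κ ^ 2 with hA
  have hA0 : 0 < A := by positivity
  obtain ⟨w, hw, hwM, hwi⟩ := exists_contDiff_integral_sub_le h.meas_g h.bound_g
    hT.le (δ := min (η / 2) (η / 4 / A)) (by positivity)
  have cw : Continuous w := hw.continuous
  have ig : IntervalIntegrable g volume 0 T :=
    intervalIntegrable_of_bounded h.meas_g h.bound_g _ _
  have s2 : ∀ n, ∫ x in (0:ℝ)..T, |U n x 0 - w x| ≤ (∫ x in (0:ℝ)..T, |U n x 0 - g x|)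
      + ∫ x in (0:ℝ)..T, |g x - w x| := fun n =>
    have c := (h.continuous n).uncurry_right 0
    integral_abs_sub_triangle hT.le
      ((c.intervalIntegrable _ _).sub (cw.intervalIntegrable _ _)).abs
      ((c.intervalIntegrable _ _).sub ig).abs (ig.sub (cw.intervalIntegrable _ _)).abs
  refine ⟨w, hw, ?_, ?_⟩
  · filter_upwards [h.lim_g.eventually (gt_mem_nhds (half_pos hη))] with n hn
    have := s2 n
    have := hwi.trans (min_le_left _ _)
    linarith
  have hw' : ContDiff ℝ 2 (Function.uncurry fun t _ : ℝ => w t) := by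
    have : (Function.uncurry fun t _ : ℝ => w t) = w ∘ Prod.fst := rfl
    rw [this]; exact hw.comp contDiff_fst
  obtain ⟨C, hC, hcomp⟩ := h.comparison (R₀ := 2) hw' (fun t ht _ _ => hwM t ht)
  set K := 64 / 3 / κ ^ 2 * (2 * M + 1 + C * T) with hK
  have hK0 : 0 ≤ K := by positivity
  refine ⟨min 1 (η / 8 / (K + 1)), by positivity, fun r hr hrr => ?_⟩
  rw [le_min_iff] at hrr
  obtain ⟨C', hC', hcomp⟩ := hcomp (2 * r) (fun x => (2 * r - x) ^ 3) (by linarith)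
    (by linarith) (by fun_prop)
    (fun x hx => pow_nonneg (by linarith [hx.2]) 3)
    (fun x hx => by rw [deriv_cube_layer]; nlinarith [sq_nonneg (2 * r - x)])
    (by simp) (by rw [deriv_cube_layer]; simp)
  have ev1 : ∀ᶠ n in atTop, A * (∫ x in (0:ℝ)..T, |U n x 0 - g x|) < η / 8 := by
    have := h.lim_g.const_mul A
    rw [mul_zero] at this
    exact this.eventually (gt_mem_nhds (by positivity))
  have ev2 : ∀ᶠ n in atTop, (4 / κ ^ 2 * (C' / (3 * r ^ 3))) * e n < η / 8 := by
    have := h.e_lim.const_mul (4 / κ ^ 2 * (C' / (3 * r ^ 3)))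
    rw [mul_zero] at this
    exact this.eventually (gt_mem_nhds (by positivity))
  filter_upwards [hcomp, ev1, ev2] with n hn h1 h2
  have cU : Continuous fun p : ℝ × ℝ => U n p.1 p.2 := h.continuous n
  have hb : ∀ t ∈ Icc 0 T, ∀ x ∈ Ici (0:ℝ), |U n t x| ≤ M := (h.sol n).bound
  have key := hn T ⟨hT.le, le_rfl⟩
  have hφF : ∀ x ∈ Icc 0 (2 * r), (2 * r - x) ^ 3 ≤ 8 * r ^ 3 := fun x hx =>
    (pow_le_pow_left₀ (by linarith [hx.2]) (by linarith [hx.1] : 2 * r - x ≤ 2 * r) 3).trans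
      (by ring_nf; exact le_rfl)
  have cU0 : Continuous (U n 0) := (h.continuous n).uncurry_left 0
  have cUT : Continuous (U n T) := (h.continuous n).uncurry_left T
  have pos : 0 ≤ ∫ x in (0:ℝ)..2 * r, |U n T x - w T| * (2 * r - x) ^ 3 :=
    intervalIntegral.integral_nonneg (by linarith) fun x hx =>
      mul_nonneg (abs_nonneg _) (pow_nonneg (by linarith [hx.2]) 3)
  have s1 : ∫ x in (0:ℝ)..2 * r, |U n 0 x - w 0| * (2 * r - x) ^ 3
      ≤ 2 * r * ((2 * M + 1) * (8 * r ^ 3)) := by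
    apply integral_le_mul_of_forall_le (by linarith)
      (Continuous.intervalIntegrable (by fun_prop) _ _)
    intro x hx
    have := hb 0 ⟨le_rfl, hT.le⟩ x hx.1
    have := hwM 0 ⟨le_rfl, hT.le⟩
    exact mul_le_mul ((abs_sub _ _).trans (by linarith)) (hφF x hx)
      (pow_nonneg (by linarith [hx.2]) 3) (by linarith)
  have s4 : ∫ x in (0:ℝ)..2 * r, (2 * r - x) ^ 3 ≤ 2 * r * (8 * r ^ 3) :=
    integral_le_mul_of_forall_le (by linarith) (Continuous.intervalIntegrable (by fun_prop) _ _) hφF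
  have hKc : IsCompact (Icc 0 T ×ˢ Icc 0 r) := isCompact_Icc.prod isCompact_Icc
  have s5 : 3 * r ^ 2 * (∫ p in Icc 0 T ×ˢ Icc 0 r, |U n p.1 p.2 ^ 3 - w p.1 ^ 3|)
      ≤ ∫ p in Icc 0 T ×ˢ Icc 0 (2 * r), |U n p.1 p.2 ^ 3 - w p.1 ^ 3|
        * (-deriv (fun x => (2 * r - x) ^ 3) p.2) := by
    rw [deriv_cube_layer, ← integral_const_mul]
    have hi : IntegrableOn (fun p : ℝ × ℝ => |U n p.1 p.2 ^ 3 - w p.1 ^ 3|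
        * (- -(3 * (2 * r - p.2) ^ 2))) (Icc 0 T ×ˢ Icc 0 (2 * r)) :=
      Continuous.integrableOn_of_isCompact (by fun_prop) (isCompact_Icc.prod isCompact_Icc)
    have hsub : Icc 0 T ×ˢ Icc 0 r ⊆ Icc 0 T ×ˢ Icc 0 (2 * r) :=
      prod_mono le_rfl (Icc_subset_Icc_right (by linarith))
    refine le_trans ?_ (setIntegral_mono_set hi ?_ (Eventually.of_forall hsub))
    · apply setIntegral_mono_on _ (hi.mono_set hsub) (measurableSet_Icc.prod measurableSet_Icc)
      · rintro ⟨t, x⟩ ⟨_, hx⟩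
        simp only at hx ⊢
        have : r ^ 2 ≤ (2 * r - x) ^ 2 := pow_le_pow_left₀ hr.le (by linarith [hx.2]) 2
        rw [neg_neg, mul_comm]
        exact mul_le_mul_of_nonneg_left (by linarith) (abs_nonneg _)
      · exact Continuous.integrableOn_of_isCompact (by fun_prop) hKc
    · refine Eventually.of_forall fun p => ?_
      simp only [Pi.zero_apply, neg_neg]
      positivity
  have s6 : ∫ p in Icc 0 T ×ˢ Icc 0 r, |U n p.1 p.2 - w p.1|
      ≤ T * r * κ + 4 / κ ^ 2 * ∫ p in Icc 0 T ×ˢ Icc 0 r, |U n p.1 p.2 ^ 3 - w p.1 ^ 3| := by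
    have i1 : IntegrableOn (fun p : ℝ × ℝ => 4 / κ ^ 2 * |U n p.1 p.2 ^ 3 - w p.1 ^ 3|)
      (Icc 0 T ×ˢ Icc 0 r) := Continuous.integrableOn_of_isCompact (by fun_prop) hKc
    have i2 : IntegrableOn (fun p : ℝ × ℝ => κ)
      (Icc 0 T ×ˢ Icc 0 r) := Continuous.integrableOn_of_isCompact (by fun_prop) hKc
    have e := integral_add i2 i1
    rw [integral_const_mul] at e
    have t6 : ∫ p in Icc 0 T ×ˢ Icc 0 r, κ ∂(volume : Measure (ℝ × ℝ)) = T * r * κ := by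
      rw [setIntegral_const, Measure.volume_eq_prod, measureReal_prod_prod]
      simp [hT.le, hr.le]
    rw [t6] at e
    rw [← e]
    exact setIntegral_mono_on (Continuous.integrableOn_of_isCompact (by fun_prop) hKc) (i2.add i1)
      (measurableSet_Icc.prod measurableSet_Icc) fun p _ => abs_sub_le_cube hκ0
  set J := ∫ p in Icc 0 T ×ˢ Icc 0 r, |U n p.1 p.2 ^ 3 - w p.1 ^ 3| with hJ
  set b := ∫ t in (0:ℝ)..T, |U n t 0 - w t| with hbdef
  have s7 : 3 * r ^ 2 * J ≤ 3 * r ^ 3 * (16 / 3 * (2 * M + 1 + C * T) * r + 8 * (M + 1) ^ 2 * b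
      + C' / (3 * r ^ 3) * e n) := by
    have e1 : 3 * r ^ 3 * (C' / (3 * r ^ 3) * e n) = C' * e n := by field_simp
    have e2 : C * (T * ∫ x in (0:ℝ)..2 * r, (2 * r - x) ^ 3) ≤ C * (T * (2 * r * (8 * r ^ 3))) := by
      gcongr
    have e3 : (2 * r - 0) ^ 3 = 8 * r ^ 3 := by ring
    rw [e3] at key
    have e4 : 3 * r ^ 3 * (16 / 3 * (2 * M + 1 + C * T) * r + 8 * (M + 1) ^ 2 * b
        + C' / (3 * r ^ 3) * e n) = 2 * r * ((2 * M + 1) * (8 * r ^ 3))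
        + 3 * (M + 1) ^ 2 * (8 * r ^ 3) * b + C * (T * (2 * r * (8 * r ^ 3)))
        + 3 * r ^ 3 * (C' / (3 * r ^ 3) * e n) := by ring
    rw [e4, e1]
    linarith
  have s8 : J ≤ r * (16 / 3 * (2 * M + 1 + C * T) * r + 8 * (M + 1) ^ 2 * b
      + C' / (3 * r ^ 3) * e n) := by
    have h3 : 0 < 3 * r ^ 2 := by positivity
    refine le_of_mul_le_mul_left (s7.trans_eq ?_) h3
    ring
  have s9 : 4 / κ ^ 2 * J ≤ r * (K * r + A * b + 4 / κ ^ 2 * (C' / (3 * r ^ 3)) * e n) := by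
    calc _ ≤ 4 / κ ^ 2 * (r * (16 / 3 * (2 * M + 1 + C * T) * r + 8 * (M + 1) ^ 2 * b
      + C' / (3 * r ^ 3) * e n)) := by gcongr
      _ = _ := by rw [hK, hA]; ring
  have hKr : K * r ≤ η / 8 := by
    calc K * r ≤ K * (η / 8 / (K + 1)) := by gcongr; exact hrr.2
      _ ≤ η / 8 := by rw [mul_div_assoc', div_le_iff₀ (by positivity)]; nlinarith
  have hAb : A * b ≤ η / 8 + η / 4 := by
    have i1 : A * (∫ x in (0:ℝ)..T, |g x - w x|) ≤ η / 4 := by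
      calc _ ≤ A * (η / 4 / A) := by gcongr; exact hwi.trans (min_le_right _ _)
        _ = η / 4 := by field_simp
    have := mul_le_mul_of_nonneg_left (s2 n) hA0.le
    linarith
  have hTκ : T * r * κ = r * (η / 4) := by rw [hκ]; field_simp
  have s10 : r * (K * r + A * b + 4 / κ ^ 2 * (C' / (3 * r ^ 3)) * e n)
      ≤ r * (η / 8 + (η / 8 + η / 4) + η / 8) := by
    have := h2.le
    gcongr
  have s11 : r * (η / 4) + r * (η / 8 + (η / 8 + η / 4) + η / 8) ≤ η * r := by
    have : 0 < r * η := by positivity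
    linarith
  linarith

end IsViscousSequence
end layers

section averages

lemma integral_rect_eq_swap {f : ℝ → ℝ → ℝ} (hf : Continuous (Function.uncurry f)) {τ R : ℝ}
    (hτ : 0 ≤ τ) (hR : 0 ≤ R) :
    ∫ p in Icc 0 τ ×ˢ Icc 0 R, f p.1 p.2 = ∫ x in (0:ℝ)..R, ∫ t in (0:ℝ)..τ, f t x := by
  have hi : Integrable (Function.uncurry f)
      ((volume.restrict (Icc 0 τ)).prod (volume.restrict (Icc 0 R))) := by
    rw [Measure.prod_restrict, ← Measure.volume_eq_prod]
    exact Continuous.integrableOn_of_isCompact hf (isCompact_Icc.prod isCompact_Icc)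
  have := integral_integral_swap hi
  rw [integral_rect_eq hf hτ hR]
  simpa only [integral_Icc_eq_integral_Ioc, intervalIntegral.integral_of_le hτ,
    intervalIntegral.integral_of_le hR] using this

lemma setIntegral_swap_of_continuous {X Y : Type*} [MeasurableSpace X] [TopologicalSpace X]
    [OpensMeasurableSpace X] [T2Space X] {μ : Measure X} [IsFiniteMeasureOnCompacts μ] [SFinite μ]
    [MeasurableSpace Y] [TopologicalSpace Y] [SecondCountableTopologyEither X Y]
    [OpensMeasurableSpace Y] [T2Space Y] {ν : Measure Y} [IsFiniteMeasureOnCompacts ν] [SFinite ν]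
    [SecondCountableTopology X] [SecondCountableTopology Y]
    [IsFiniteMeasureOnCompacts (μ.prod ν)]
    {f : X → Y → ℝ} (hf : Continuous (Function.uncurry f)) {K : Set X} {Q : Set Y}
    (hK : IsCompact K) (hQ : IsCompact Q) :
    ∫ x in K, ∫ y in Q, f x y ∂ν ∂μ = ∫ y in Q, ∫ x in K, f x y ∂μ ∂ν := by
  apply integral_integral_swap
  rw [Measure.prod_restrict]
  exact Continuous.integrableOn_of_isCompact hf (hK.prod hQ)

namespace IsViscousSequence
variable {T M : ℝ} {e : ℕ → ℝ} {U : ℕ → ℝ → ℝ → ℝ} {u₀ g : ℝ → ℝ}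

set_option maxHeartbeats 1000000 in
/-- Uniform `L¹` approximation of the sequence by averages over small squares. -/
lemma square_average (h : IsViscousSequence T M e U u₀ g) {T' R η : ℝ} (hT' : 0 ≤ T')
    (hT'T : T' < T) (hR : 0 ≤ R) (hη : 0 < η) :
    ∃ r > 0, T' + r ≤ T ∧ ∀ᶠ n in atTop, ∫ p in Icc 0 T' ×ˢ Icc 0 R,
      |U n p.1 p.2 - (r ^ 2)⁻¹ * ∫ q in Icc 0 r ×ˢ Icc 0 r, U n (p.1 + q.1) (p.2 + q.2)| ≤ η := by
  have hM := h.M_pos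
  have hT := h.T_pos
  set R₁ := R + 1 with hR₁
  have hR₁0 : 0 < R₁ := by linarith
  set X := Real.exp (R₁ * T) with hX
  set E := T * X with hE
  have hE0 : 0 < E := by positivity
  set N := 3 * M ^ 2 * R₁ ^ 3 with hN
  have hN0 : 0 < N := by positivity
  set θ := η / (8 * E * (N + R₁ ^ 3)) with hθ
  have hθ0 : 0 < θ := by positivity
  obtain ⟨r₁, hr₁, hinit⟩ := h.initial_continuity (R := R₁) hR₁0.le hθ0
  obtain ⟨w, hw, hw0, r₂, hr₂, hbdry⟩ := h.boundary_layer hθ0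
  have cw : Continuous w := hw.continuous
  have hw1 : ContDiff ℝ 1 w := hw.of_le (by norm_num)
  obtain ⟨Lw, hLw⟩ := (isCompact_Icc (a := 0) (b := T)).exists_bound_of_continuousOn
    (hw1.continuous_deriv le_rfl).continuousOn
  have hLip : ∀ x ∈ Icc 0 T, ∀ z ∈ Icc 0 T, |w z - w x| ≤ |Lw| * |z - x| := fun x hx z hz =>
    (convex_Icc 0 T).norm_image_sub_le_of_norm_deriv_le
      (fun a _ => (hw1.differentiable (by norm_num)) a)
      (fun a ha => (hLw a ha).trans (le_abs_self _)) hx hz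
  set H := E * (N * (T * |Lw|) + M * R₁ ^ 3 * (T * R₁)) with hH
  have hH0 : 0 ≤ H := by positivity
  set r := min (min r₁ r₂) (min (T - T') (η / 8 / (H + 1))) with hrdef
  have hr : 0 < r := by
    have : 0 < T - T' := by linarith
    positivity
  have hr_1 : r ≤ r₁ := (min_le_left _ _).trans (min_le_left _ _)
  have hr_2 : r ≤ r₂ := (min_le_left _ _).trans (min_le_right _ _)
  have hr_3 : r ≤ T - T' := (min_le_right _ _).trans (min_le_left _ _)
  have hr_4 : r ≤ η / 8 / (H + 1) := (min_le_right _ _).trans (min_le_right _ _)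
  set C := 2 * M * (R₁ ^ 3 + 3 * R₁ ^ 2 + 6 * R₁)
    * (1 / (3 * M ^ 2) + (R₁ + 3 * M ^ 2) * T / (3 * M ^ 2) + T * R₁) with hC
  have hC0 : 0 ≤ C := by positivity
  refine ⟨r, hr, by linarith, ?_⟩
  have ev2 : ∀ᶠ n in atTop, E * C * e n < η / 8 := by
    have := h.e_lim.const_mul (E * C)
    rw [mul_zero] at this
    exact this.eventually (gt_mem_nhds (by positivity))
  filter_upwards [hinit, hw0, hbdry r hr hr_2, ev2] with n hn1 hn2 hn3 hn4
  have cUp : Continuous fun p : ℝ × ℝ => U n p.1 p.2 := h.continuous n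
  have cU : ∀ t, Continuous (U n t) := fun t => (h.continuous n).uncurry_left t
  have cU' : ∀ x, Continuous (fun t => U n t x) := fun t => (h.continuous n).uncurry_right t
  set b : ℝ → ℝ := fun y => ∫ t in (0:ℝ)..T, |U n t y - w t| with hb
  have cb : Continuous b :=
    intervalIntegral.continuous_parametric_intervalIntegral_of_continuous' (by
      have : (Function.uncurry fun y t => |U n t y - w t|) =
        (fun p : ℝ × ℝ => |U n p.1 p.2 - w p.1|) ∘ Prod.swap := rfl
      rw [this]
      exact Continuous.comp (by fun_prop) continuous_swap) _ _
  set Y := R₁ ^ 3 * θ + N * (T * (|Lw| * r) + θ) + M * r * R₁ ^ 3 * (T * R₁) + C * e n with hY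
  -- the estimate for a fixed translation
  have step : ∀ s ∈ Icc 0 r, ∀ y ∈ Icc 0 r, ∀ τ ∈ Icc 0 T',
      ∫ x in (0:ℝ)..R, |U n τ x - U n (τ + s) (x + y)| ≤ X * (Y + N * b y) := by
    intro s hs y hy τ hτ
    have hτT : τ ≤ T := hτ.2.trans hT'T.le
    have tr := (h.sol n).translation (τ := τ) (s := s) (y := y) (R := R₁) (h.e_pos n) hM hτ.1 hs.1
      (by linarith [hτ.2, hs.2]) hy.1 hR₁0.le
    have c1 := cU τ
    have c2 := cU (τ + s)
    have a1 : ∫ x in (0:ℝ)..R, |U n τ x - U n (τ + s) (x + y)|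
        ≤ ∫ x in (0:ℝ)..R₁, |U n (τ + s) (x + y) - U n τ x| * (R₁ - x) ^ 3 := by
      simp only [abs_sub_comm (U n τ _)]
      have i1 : ∫ x in (0:ℝ)..R, |U n (τ + s) (x + y) - U n τ x|
          ≤ ∫ x in (0:ℝ)..R, |U n (τ + s) (x + y) - U n τ x| * (R₁ - x) ^ 3 := by
        apply intervalIntegral.integral_mono_on hR
          (Continuous.intervalIntegrable (by fun_prop) _ _)
          (Continuous.intervalIntegrable (by fun_prop) _ _)
        intro x hx
        exact le_mul_of_one_le_right (abs_nonneg _) (one_le_pow₀ (by linarith [hx.2]))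
      refine i1.trans ?_
      apply intervalIntegral.integral_mono_interval le_rfl hR (by linarith)
      · filter_upwards [ae_restrict_mem measurableSet_Ioc] with z hz
        exact mul_nonneg (abs_nonneg _) (pow_nonneg (by linarith [hz.2]) 3)
      · exact Continuous.intervalIntegrable (by fun_prop) _ _
    have a2 : ∫ x in (0:ℝ)..R₁, |U n s (x + y) - U n 0 x| * (R₁ - x) ^ 3 ≤ R₁ ^ 3 * θ := by
      have c1 := cU s
      have c2 := cU 0
      have := hn1 s ⟨hs.1, hs.2.trans hr_1⟩ y ⟨hy.1, hy.2.trans hr_1⟩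
      refine le_trans ?_ (mul_le_mul_of_nonneg_left this (by positivity : 0 ≤ R₁ ^ 3))
      rw [← intervalIntegral.integral_const_mul]
      apply intervalIntegral.integral_mono_on hR₁0.le
        (Continuous.intervalIntegrable (by fun_prop) _ _)
        (Continuous.intervalIntegrable (by fun_prop) _ _)
      intro x hx
      rw [mul_comm]
      exact mul_le_mul_of_nonneg_right
        (pow_le_pow_left₀ (by linarith [hx.2]) (by linarith [hx.1]) 3) (abs_nonneg _)
    have a3 : ∫ t in (0:ℝ)..τ, |U n (t + s) y - U n t 0| ≤ b y + (T * (|Lw| * r) + θ) := by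
      have c1 := cU' y
      have c2 := cU' 0
      have i1 : ∫ t in (0:ℝ)..τ, |U n (t + s) y - w (t + s)| ≤ b y := by
        rw [intervalIntegral.integral_comp_add_right (fun t => |U n t y - w t|) s, zero_add]
        apply intervalIntegral.integral_mono_interval hs.1 (by linarith [hτ.1])
          (by linarith [hτ.2, hs.2]) (Eventually.of_forall fun _ => abs_nonneg _)
        exact Continuous.intervalIntegrable (by fun_prop) _ _
      have i2 : ∫ t in (0:ℝ)..τ, |w (t + s) - w t| ≤ T * (|Lw| * r) := by
        refine (integral_le_mul_of_forall_le (K := |Lw| * r) hτ.1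
          (Continuous.intervalIntegrable (by fun_prop) _ _) ?_).trans (by gcongr)
        intro x hx
        have := hLip x ⟨hx.1, by linarith [hx.2]⟩ (x + s)
          ⟨by linarith [hx.1, hs.1], by linarith [hx.2, hs.2, hτ.2]⟩
        rw [add_sub_cancel_left, abs_of_nonneg hs.1] at this
        exact this.trans (by gcongr; exact hs.2)
      have i3 : ∫ t in (0:ℝ)..τ, |w t - U n t 0| ≤ θ := by
        refine le_trans ?_ hn2
        simp only [abs_sub_comm (w _)]
        apply intervalIntegral.integral_mono_interval le_rfl hτ.1 hτT
          (Eventually.of_forall fun _ => abs_nonneg _)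
        exact Continuous.intervalIntegrable (by fun_prop) _ _
      refine (integral_abs_sub_triangle (b := fun t => w (t + s)) hτ.1
        (Continuous.intervalIntegrable (by fun_prop) _ _)
        (Continuous.intervalIntegrable (by fun_prop) _ _)
        (Continuous.intervalIntegrable (by fun_prop) _ _)).trans (add_le_add i1 ?_)
      exact (integral_abs_sub_triangle hτ.1
        (Continuous.intervalIntegrable (by fun_prop) _ _)
        (Continuous.intervalIntegrable (by fun_prop) _ _)
        (Continuous.intervalIntegrable (by fun_prop) _ _)).trans (add_le_add i2 i3)
    have a4 : M * y * R₁ ^ 3 * (τ * R₁) ≤ M * r * R₁ ^ 3 * (T * R₁) := by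
      have := hy.2; have := hτ.1
      gcongr
    have a5 : e n * (2 * M * (R₁ ^ 3 + 3 * R₁ ^ 2 + 6 * R₁)
        * (1 / (3 * M ^ 2) + (R₁ + 3 * M ^ 2) * τ / (3 * M ^ 2) + τ * R₁)) ≤ C * e n := by
      rw [mul_comm, hC]
      have := (h.e_pos n).le
      gcongr
    have a6 : N * (∫ t in (0:ℝ)..τ, |U n (t + s) y - U n t 0|)
        ≤ N * (b y + (T * (|Lw| * r) + θ)) := by gcongr
    have a7 : X⁻¹ ≤ Real.exp (-(R₁ * τ)) := by
      rw [hX, ← Real.exp_neg]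
      exact Real.exp_le_exp.2 (by have := mul_le_mul_of_nonneg_left hτT hR₁0.le; linarith)
    set Z := ∫ x in (0:ℝ)..R₁, |U n (τ + s) (x + y) - U n τ x| * (R₁ - x) ^ 3 with hZ
    have hZ0 : 0 ≤ Z := intervalIntegral.integral_nonneg hR₁0.le fun x hx =>
      mul_nonneg (abs_nonneg _) (pow_nonneg (by linarith [hx.2]) 3)
    have a8 : X⁻¹ * Z ≤ Y + N * b y := by
      refine (mul_le_mul_of_nonneg_right a7 hZ0).trans (tr.trans ?_)
      rw [hY]; linarith
    have hXpos : 0 < X := Real.exp_pos _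
    refine a1.trans ?_
    rwa [inv_mul_le_iff₀ hXpos] at a8
  set K := Icc 0 T' ×ˢ Icc 0 R with hKdef
  set Q := Icc 0 r ×ˢ Icc 0 r with hQdef
  have hK : IsCompact K := isCompact_Icc.prod isCompact_Icc
  have hQ : IsCompact Q := isCompact_Icc.prod isCompact_Icc
  have cF : Continuous fun z : (ℝ × ℝ) × ℝ × ℝ =>
      |U n z.1.1 z.1.2 - U n (z.1.1 + z.2.1) (z.1.2 + z.2.2)| := by
    have c1 : Continuous fun z : (ℝ × ℝ) × ℝ × ℝ => U n z.1.1 z.1.2 :=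
      cUp.comp continuous_fst
    have c2 : Continuous fun z : (ℝ × ℝ) × ℝ × ℝ => U n (z.1.1 + z.2.1) (z.1.2 + z.2.2) :=
      cUp.comp (by fun_prop : Continuous fun z : (ℝ × ℝ) × ℝ × ℝ => (z.1.1 + z.2.1, z.1.2 + z.2.2))
    exact (c1.sub c2).abs
  have stepK : ∀ q ∈ Q, ∫ p in K, |U n p.1 p.2 - U n (p.1 + q.1) (p.2 + q.2)|
      ≤ T' * (X * (Y + N * b q.2)) := by
    rintro ⟨s, y⟩ ⟨hs, hy⟩
    have c2 : Continuous fun p : ℝ × ℝ => U n (p.1 + s) (p.2 + y) :=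
      cUp.comp (by fun_prop : Continuous fun p : ℝ × ℝ => (p.1 + s, p.2 + y))
    have c3 : Continuous (Function.uncurry fun t x => |U n t x - U n (t + s) (x + y)|) :=
      (cUp.sub c2).abs
    refine (integral_rect_eq c3 hT' hR).trans_le ?_
    apply integral_le_mul_of_forall_le hT'
    · exact (intervalIntegral.continuous_parametric_intervalIntegral_of_continuous' c3
        _ _).intervalIntegrable _ _
    · exact fun t ht => step s hs y hy t ht
  have volQ : (volume : Measure (ℝ × ℝ)).real Q = r ^ 2 := by
    rw [Measure.volume_eq_prod, measureReal_prod_prod]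
    simp [hr.le]; ring
  have intb : ∫ q in Q, b (q : ℝ × ℝ).2 ≤ r * (θ * r) := by
    have h1 := integral_rect_eq (f := fun _ y => b y) (by
      have : (Function.uncurry fun (_ : ℝ) y => b y) = fun p => b p.2 := rfl
      rw [this]; fun_prop) hr.le hr.le
    have h2 := integral_rect_eq_swap (f := fun t y => |U n t y - w t|) (by
      have : (Function.uncurry fun t y => |U n t y - w t|) =
        fun p => |U n p.1 p.2 - w p.1| := rfl
      rw [this]; fun_prop) hT.le hr.le
    rw [h1]
    simp only [intervalIntegral.integral_const, sub_zero, smul_eq_mul]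
    exact mul_le_mul_of_nonneg_left (h2 ▸ hn3) hr.le
  have tot : ∫ q in Q, ∫ p in K, |U n p.1 p.2 - U n (p.1 + q.1) (p.2 + q.2)| ≤ r ^ 2 * η := by
    have cG : Continuous fun q : ℝ × ℝ => ∫ p in K, |U n p.1 p.2 - U n (p.1 + q.1) (p.2 + q.2)| :=
      continuous_parametric_integral_of_continuous
        (f := fun q p : ℝ × ℝ => |U n p.1 p.2 - U n (p.1 + q.1) (p.2 + q.2)|)
        (cF.comp continuous_swap) hK
    have i1 : IntegrableOn (fun q : ℝ × ℝ => T' * (X * Y)) Q :=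
      Continuous.integrableOn_of_isCompact (by fun_prop) hQ
    have i2 : IntegrableOn (fun q : ℝ × ℝ => T' * X * N * b q.2) Q :=
      Continuous.integrableOn_of_isCompact (by fun_prop) hQ
    have m : ∫ q in Q, ∫ p in K, |U n p.1 p.2 - U n (p.1 + q.1) (p.2 + q.2)|
        ≤ ∫ q in Q, (T' * (X * Y) + T' * X * N * b q.2) := by
      apply setIntegral_mono_on (Continuous.integrableOn_of_isCompact cG hQ) (i1.add i2)
        (measurableSet_Icc.prod measurableSet_Icc)
      intro q hq
      exact (stepK q hq).trans_eq (by simp only [Pi.add_apply]; ring)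
    rw [integral_add i1 i2, setIntegral_const, volQ, smul_eq_mul, integral_const_mul] at m
    have hY0 : 0 ≤ Y := by have := (h.e_pos n).le; positivity
    have hX0 : 0 < X := Real.exp_pos _
    have hb0 : 0 ≤ ∫ q in Q, b (q : ℝ × ℝ).2 := by
      apply integral_nonneg
      exact fun _ => intervalIntegral.integral_nonneg hT.le fun _ _ => abs_nonneg _
    have m2 : T' * X * N * (∫ q in Q, b (q : ℝ × ℝ).2) ≤ r ^ 2 * (E * (N * θ)) := by
      calc _ ≤ T * X * N * (r * (θ * r)) := by gcongr
        _ = _ := by rw [hE]; ring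
    have m3 : r ^ 2 * (T' * (X * Y)) ≤ r ^ 2 * (E * Y) := by
      rw [hE, mul_assoc]; gcongr
    have m4 : E * Y + E * (N * θ) ≤ η := by
      have e1 : E * (N + R₁ ^ 3) * θ = η / 8 := by rw [hθ]; field_simp
      have e2 : H * r ≤ η / 8 := by
        calc H * r ≤ H * (η / 8 / (H + 1)) := by gcongr
          _ ≤ η / 8 := by rw [mul_div_assoc', div_le_iff₀ (by positivity)]; nlinarith
      have e3 : E * Y + E * (N * θ) = E * (N + R₁ ^ 3) * θ + E * N * θ + H * r + E * C * e n := by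
        rw [hY, hH]; ring
      have e4 : E * N * θ ≤ E * (N + R₁ ^ 3) * θ := by
        gcongr; linarith [pow_pos hR₁0 3]
      linarith
    calc _ ≤ r ^ 2 * (E * Y) + r ^ 2 * (E * (N * θ)) := m.trans (add_le_add m3 m2)
      _ = r ^ 2 * (E * Y + E * (N * θ)) := by ring
      _ ≤ r ^ 2 * η := by gcongr
  have swap := setIntegral_swap_of_continuous (μ := volume) (ν := volume)
    (f := fun p q : ℝ × ℝ => |U n p.1 p.2 - U n (p.1 + q.1) (p.2 + q.2)|) cF hK hQ
  have cAvg : Continuous fun p : ℝ × ℝ => ∫ q in Q, U n (p.1 + q.1) (p.2 + q.2) :=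
    continuous_parametric_integral_of_continuous
      (f := fun p q : ℝ × ℝ => U n (p.1 + q.1) (p.2 + q.2)) (cUp.comp
      (by fun_prop : Continuous fun z : (ℝ × ℝ) × ℝ × ℝ => (z.1.1 + z.2.1, z.1.2 + z.2.2))) hQ
  have cFp : Continuous fun p : ℝ × ℝ => ∫ q in Q, |U n p.1 p.2 - U n (p.1 + q.1) (p.2 + q.2)| :=
    continuous_parametric_integral_of_continuous
      (f := fun p q : ℝ × ℝ => |U n p.1 p.2 - U n (p.1 + q.1) (p.2 + q.2)|) cF hQ
  have fin : ∫ p in K, |U n p.1 p.2 - (r ^ 2)⁻¹ * ∫ q in Q, U n (p.1 + q.1) (p.2 + q.2)|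
      ≤ ∫ p in K, (r ^ 2)⁻¹ * ∫ q in Q, |U n p.1 p.2 - U n (p.1 + q.1) (p.2 + q.2)| := by
    apply setIntegral_mono_on (Continuous.integrableOn_of_isCompact (by fun_prop) hK)
      (Continuous.integrableOn_of_isCompact (by fun_prop) hK)
      (measurableSet_Icc.prod measurableSet_Icc)
    intro p _
    have c1 : IntegrableOn (fun q : ℝ × ℝ => U n (p.1 + q.1) (p.2 + q.2)) Q :=
      Continuous.integrableOn_of_isCompact (cUp.comp
        (by fun_prop : Continuous fun q : ℝ × ℝ => (p.1 + q.1, p.2 + q.2))) hQ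
    have c2 : IntegrableOn (fun q : ℝ × ℝ => U n p.1 p.2) Q :=
      Continuous.integrableOn_of_isCompact continuous_const hQ
    have e1 : U n p.1 p.2 - (r ^ 2)⁻¹ * ∫ q in Q, U n (p.1 + q.1) (p.2 + q.2)
        = (r ^ 2)⁻¹ * ∫ q in Q, (U n p.1 p.2 - U n (p.1 + q.1) (p.2 + q.2)) := by
      rw [integral_sub c2 c1, setIntegral_const, volQ, smul_eq_mul]
      field_simp
    rw [e1, abs_mul, abs_of_pos (by positivity : 0 < (r ^ 2)⁻¹)]
    gcongr
    exact abs_integral_le_integral_abs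
  refine fin.trans ?_
  rw [integral_const_mul, swap, inv_mul_le_iff₀ (by positivity)]
  exact tot

end IsViscousSequence
end averages

section compactness

/-- Equicontinuous pointwise bounded sequences on a separable space have pointwise convergent
subsequences. -/
lemma exists_subseq_tendsto_of_equicontinuous {X : Type*} [PseudoMetricSpace X]
    [TopologicalSpace.SeparableSpace X] {F : ℕ → X → ℝ} (hF : Equicontinuous F)
    (hb : ∀ x, ∃ C, ∀ n, |F n x| ≤ C) :
    ∃ k : ℕ → ℕ, StrictMono k ∧ ∀ x, ∃ l, Tendsto (fun n => F (k n) x) atTop (nhds l) := by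
  rcases isEmpty_or_nonempty X with hX | hX
  · exact ⟨id, strictMono_id, fun x => (hX.false x).elim⟩
  set D := TopologicalSpace.denseSeq X
  choose C hC using hb
  have hcomp : IsCompact (univ.pi fun i => Icc (-C (D i)) (C (D i))) :=
    isCompact_univ_pi fun i => isCompact_Icc
  obtain ⟨a, -, k, hk, hlim⟩ := hcomp.tendsto_subseq (x := fun n i => F n (D i))
    (fun n i _ => abs_le.1 (hC (D i) n))
  refine ⟨k, hk, fun x => cauchySeq_tendsto_of_complete ?_⟩
  rw [Metric.cauchySeq_iff']
  intro η hη
  obtain ⟨δ, hδ, hx⟩ := Metric.equicontinuousAt_iff.1 (hF x) (η / 4) (by positivity)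
  obtain ⟨i, hi⟩ := (TopologicalSpace.denseRange_denseSeq X).exists_dist_lt x hδ
  rw [dist_comm] at hi
  have hci : CauchySeq fun n => F (k n) (D i) := ((tendsto_pi_nhds.1 hlim) i).cauchySeq
  obtain ⟨N, hN⟩ := Metric.cauchySeq_iff'.1 hci (η / 4) (by positivity)
  refine ⟨N, fun n hn => ?_⟩
  have h1 := hx _ hi (k n)
  have h2 := hx _ hi (k N)
  have h3 := hN n hn
  rw [Real.dist_eq, abs_lt] at *
  constructor <;> linarith [h1.1, h1.2, h2.1, h2.2, h3.1, h3.2]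

namespace IsViscousSolution
variable {ε T M : ℝ} {U : ℝ → ℝ → ℝ}

lemma abs_primitive_le (hU : IsViscousSolution ε T M U) {t x : ℝ} (ht : t ∈ Icc 0 T)
    (hx : 0 ≤ x) : |spePrimitive U t x| ≤ M * x :=
  abs_spePrimitive_le hx fun y hy => hU.bound t ht y hy.1.le

lemma abs_double_primitive_sub_le (hU : IsViscousSolution ε T M U) {t t' x x' : ℝ}
    (ht : t ∈ Icc 0 T) (ht' : t' ∈ Icc 0 T) (hx : 0 ≤ x) (hx' : 0 ≤ x') :
    |(∫ s in (0:ℝ)..t, spePrimitive U s x) - ∫ s in (0:ℝ)..t', spePrimitive U s x'|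
      ≤ M * x * |t - t'| + M * |x - x'| * T := by
  have cP := continuous_spePrimitive hU.contDiff.continuous
  have cU : ∀ s, Continuous (U s) := fun s => hU.contDiff.continuous.uncurry_left s
  have hM : 0 ≤ M := (abs_nonneg _).trans (hU.bound t ht x hx)
  have c : ∀ x, Continuous fun s => spePrimitive U s x := fun x => cP.uncurry_right x
  have i : ∀ x a b, IntervalIntegrable (fun s => spePrimitive U s x) volume a b :=
    fun x a b => (c x).intervalIntegrable a b
  have e : (∫ s in (0:ℝ)..t, spePrimitive U s x) - ∫ s in (0:ℝ)..t', spePrimitive U s x'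
      = (∫ s in t'..t, spePrimitive U s x)
        + ∫ s in (0:ℝ)..t', (spePrimitive U s x - spePrimitive U s x') := by
    rw [intervalIntegral.integral_sub (i _ _ _) (i _ _ _),
      ← intervalIntegral.integral_add_adjacent_intervals (i x 0 t') (i x t' t)]
    ring
  rw [e]
  refine (abs_add_le _ _).trans (add_le_add ?_ ?_)
  · refine intervalIntegral.norm_integral_le_of_norm_le_const
      (f := fun s => spePrimitive U s x) (C := M * x) fun s hs => ?_
    refine hU.abs_primitive_le ?_ hx
    have := uIoc_subset_uIcc hs
    exact (uIcc_subset_Icc ht' ht) this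
  · have := intervalIntegral.norm_integral_le_of_norm_le_const (a := 0) (b := t')
      (f := fun s => spePrimitive U s x - spePrimitive U s x') (C := M * |x - x'|) fun s hs => ?_
    · refine this.trans ?_
      rw [sub_zero, abs_of_nonneg ht'.1]
      gcongr
      exact ht'.2
    · rw [uIoc_of_le ht'.1] at hs
      unfold spePrimitive
      rw [intervalIntegral.integral_interval_sub_left ((cU s).intervalIntegrable _ _)
        ((cU s).intervalIntegrable _ _)]
      refine intervalIntegral.norm_integral_le_of_norm_le_const (f := U s) (C := M) fun y hy => ?_
      refine hU.bound s ⟨hs.1.le, hs.2.trans ht'.2⟩ y ?_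
      exact (uIcc_subset_Icc (b₂ := max x x') ⟨hx', le_max_right _ _⟩ ⟨hx, le_max_left _ _⟩
        (uIoc_subset_uIcc hy)).1

end IsViscousSolution

lemma integral_square_eq {U : ℝ → ℝ → ℝ} (hU : Continuous (Function.uncurry U)) {r : ℝ}
    (hr : 0 ≤ r) (t x : ℝ) :
    ∫ q in Icc 0 r ×ˢ Icc 0 r, U (t + q.1) (x + q.2)
      = ((∫ s in (0:ℝ)..t + r, spePrimitive U s (x + r)) - ∫ s in (0:ℝ)..t, spePrimitive U s (x + r))
      - ((∫ s in (0:ℝ)..t + r, spePrimitive U s x) - ∫ s in (0:ℝ)..t, spePrimitive U s x) := by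
  have cP := continuous_spePrimitive hU
  have cU : ∀ s, Continuous (U s) := fun s => hU.uncurry_left s
  have i : ∀ x a b, IntervalIntegrable (fun s => spePrimitive U s x) volume a b :=
    fun x a b => (cP.uncurry_right x).intervalIntegrable a b
  rw [integral_rect_eq (f := fun a b => U (t + a) (x + b))
    (hU.comp (by fun_prop : Continuous fun q : ℝ × ℝ => (t + q.1, x + q.2))) hr hr]
  have e : ∀ a, ∫ b in (0:ℝ)..r, U (t + a) (x + b)
      = spePrimitive U (t + a) (x + r) - spePrimitive U (t + a) x := by
    intro a
    rw [intervalIntegral.integral_comp_add_left, add_zero]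
    unfold spePrimitive
    rw [intervalIntegral.integral_interval_sub_left ((cU _).intervalIntegrable _ _)
        ((cU _).intervalIntegrable _ _)]
  simp only [e]
  rw [intervalIntegral.integral_comp_add_left
    (fun a => spePrimitive U a (x + r) - spePrimitive U a x), add_zero,
    intervalIntegral.integral_sub (i _ _ _) (i _ _ _),
    intervalIntegral.integral_interval_sub_left (i _ _ _) (i _ _ _),
    intervalIntegral.integral_interval_sub_left (i _ _ _) (i _ _ _)]

namespace IsViscousSequence
variable {T M : ℝ} {e : ℕ → ℝ} {U : ℕ → ℝ → ℝ → ℝ} {u₀ g : ℝ → ℝ}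

lemma exists_subseq_double_primitive (h : IsViscousSequence T M e U u₀ g) :
    ∃ k : ℕ → ℕ, StrictMono k ∧ ∀ t ∈ Icc 0 T, ∀ x, 0 ≤ x → ∃ l,
      Tendsto (fun n => ∫ s in (0:ℝ)..t, spePrimitive (U (k n)) s x) atTop (nhds l) := by
  have hM := h.M_pos
  have hT := h.T_pos
  set F : ℕ → ↥(Icc 0 T ×ˢ Ici (0:ℝ)) → ℝ :=
    fun n p => ∫ s in (0:ℝ)..p.1.1, spePrimitive (U n) s p.1.2
  suffices hF : Equicontinuous F ∧ ∀ p, ∃ C, ∀ n, |F n p| ≤ C by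
    obtain ⟨k, hk, hlim⟩ := exists_subseq_tendsto_of_equicontinuous hF.1 hF.2
    exact ⟨k, hk, fun t ht x hx => hlim ⟨(t, x), ht, hx⟩⟩
  constructor
  · rintro ⟨⟨t, x⟩, ht, hx⟩
    rw [Metric.equicontinuousAt_iff]
    intro η hη
    have hx : 0 ≤ x := hx
    refine ⟨η / (M * x + M * T + 1), by positivity, ?_⟩
    rintro ⟨⟨t', x'⟩, ht', hx'⟩ hd n
    have hx' : 0 ≤ x' := hx'
    rw [dist_comm, Subtype.dist_eq, Prod.dist_eq, max_lt_iff, Real.dist_eq, Real.dist_eq] at hd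
    rw [Real.dist_eq]
    refine ((h.sol n).abs_double_primitive_sub_le ht ht' hx hx').trans_lt ?_
    set δ := η / (M * x + M * T + 1) with hδ
    have hδη : δ * (M * x + M * T + 1) = η := by rw [hδ]; field_simp
    have hδ0 : 0 < δ := by positivity
    have h1 : M * x * |t - t'| ≤ M * x * δ := by
      apply mul_le_mul_of_nonneg_left hd.1.le (by positivity)
    have h2 : M * |x - x'| * T ≤ M * δ * T := by
      have := hd.2.le
      simp only at this
      gcongr
    nlinarith
  · rintro ⟨⟨t, x⟩, ht, hx⟩
    have hx : 0 ≤ x := hx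
    refine ⟨M * x * |t - 0| + M * |x - x| * T, fun n => ?_⟩
    simpa using (h.sol n).abs_double_primitive_sub_le ht ⟨le_rfl, hT.le⟩ hx hx

end IsViscousSequence

namespace IsViscousSequence
variable {T M : ℝ} {e : ℕ → ℝ} {U : ℕ → ℝ → ℝ → ℝ} {u₀ g : ℝ → ℝ}

lemma cauchy_integral (h : IsViscousSequence T M e U u₀ g)
    (hV : ∀ t ∈ Icc 0 T, ∀ x, 0 ≤ x → ∃ l,
      Tendsto (fun n => ∫ s in (0:ℝ)..t, spePrimitive (U n) s x) atTop (nhds l))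
    {T' R η : ℝ} (hT' : 0 ≤ T') (hT'T : T' < T) (hR : 0 ≤ R) (hη : 0 < η) :
    ∃ N, ∀ n ≥ N, ∀ m ≥ N, ∫ p in Icc 0 T' ×ˢ Icc 0 R, |U n p.1 p.2 - U m p.1 p.2| ≤ η := by
  have hM := h.M_pos
  obtain ⟨r, hr, hrT, hav⟩ := h.square_average hT' hT'T hR (by positivity : 0 < η / 4)
  set K := Icc 0 T' ×ˢ Icc 0 R with hKdef
  have hK : IsCompact K := isCompact_Icc.prod isCompact_Icc
  have hKm : MeasurableSet K := measurableSet_Icc.prod measurableSet_Icc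
  set Q := Icc 0 r ×ˢ Icc 0 r with hQdef
  have hQ : IsCompact Q := isCompact_Icc.prod isCompact_Icc
  set A : ℕ → ℝ × ℝ → ℝ := fun n p => (r ^ 2)⁻¹ * ∫ q in Q, U n (p.1 + q.1) (p.2 + q.2) with hA
  have cA : ∀ n, Continuous (A n) := fun n => continuous_const.mul
    (continuous_parametric_integral_of_continuous
      (f := fun p q : ℝ × ℝ => U n (p.1 + q.1) (p.2 + q.2)) ((h.continuous n).comp
      (by fun_prop : Continuous fun z : (ℝ × ℝ) × ℝ × ℝ => (z.1.1 + z.2.1, z.1.2 + z.2.2))) hQ)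
  have hlim : ∀ p ∈ K, ∃ l, Tendsto (fun n => A n p) atTop (nhds l) := by
    rintro ⟨t, x⟩ ⟨ht, hx⟩
    have ht1 : t ∈ Icc 0 T := ⟨ht.1, ht.2.trans hT'T.le⟩
    have ht2 : t + r ∈ Icc 0 T := ⟨by linarith [ht.1], by linarith [ht.2]⟩
    obtain ⟨l₁, h₁⟩ := hV (t + r) ht2 (x + r) (by linarith [hx.1])
    obtain ⟨l₂, h₂⟩ := hV t ht1 (x + r) (by linarith [hx.1])
    obtain ⟨l₃, h₃⟩ := hV (t + r) ht2 x hx.1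
    obtain ⟨l₄, h₄⟩ := hV t ht1 x hx.1
    refine ⟨(r ^ 2)⁻¹ * ((l₁ - l₂) - (l₃ - l₄)), ?_⟩
    simp only [hA, hQdef, integral_square_eq (h.continuous _) hr.le]
    exact ((h₁.sub h₂).sub (h₃.sub h₄)).const_mul _
  have hAM : ∀ n, ∀ p ∈ K, |A n p| ≤ M := by
    rintro n ⟨t, x⟩ ⟨ht, hx⟩
    have volQ : (volume : Measure (ℝ × ℝ)).real Q = r ^ 2 := by
      rw [Measure.volume_eq_prod, measureReal_prod_prod]
      simp [hr.le]; ring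
    have := norm_setIntegral_le_of_norm_le_const (μ := volume) (s := Q) (C := M)
      (f := fun q : ℝ × ℝ => U n (t + q.1) (x + q.2)) hQ.measure_lt_top fun q hq =>
        (h.sol n).bound _ ⟨by linarith [ht.1, hq.1.1], by linarith [ht.2, hq.1.2]⟩ _
          (add_nonneg hx.1 hq.2.1)
    rw [volQ] at this
    rw [hA, abs_mul, abs_of_pos (by positivity : 0 < (r ^ 2)⁻¹), inv_mul_le_iff₀ (by positivity),
      mul_comm]
    exact this
  choose! f hf using hlim
  have hfM : ∀ p ∈ K, |f p| ≤ M := fun p hp =>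
    le_of_tendsto (hf p hp).abs (Eventually.of_forall fun n => hAM n p hp)
  have mf : AEStronglyMeasurable f (volume.restrict K) :=
    aestronglyMeasurable_of_tendsto_ae atTop (fun n => (cA n).aestronglyMeasurable)
      ((ae_restrict_iff' hKm).2 (Eventually.of_forall hf))
  have iA : ∀ n, IntegrableOn (A n) K := fun n => (cA n).integrableOn_of_isCompact hK
  have if' : IntegrableOn f K := by
    have : IsFiniteMeasure (volume.restrict K) := ⟨by simpa using hK.measure_lt_top⟩
    exact Integrable.of_bound mf M ((ae_restrict_iff' hKm).2 (Eventually.of_forall hfM))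
  have hdct : Tendsto (fun n => ∫ p in K, |A n p - f p|) atTop (nhds 0) := by
    have := tendsto_integral_of_dominated_convergence (μ := volume.restrict K)
      (F := fun n p => |A n p - f p|) (f := fun _ => 0) (fun _ => 2 * M)
      (fun n => ((iA n).sub if').norm.aestronglyMeasurable)
      (integrableOn_const hK.measure_lt_top.ne)
      (fun n => (ae_restrict_iff' hKm).2 (Eventually.of_forall fun p hp => by
        rw [Real.norm_eq_abs, abs_abs]
        linarith [abs_sub (A n p) (f p), hAM n p hp, hfM p hp]))
      ((ae_restrict_iff' hKm).2 (Eventually.of_forall fun p hp => by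
        simpa using ((hf p hp).sub_const (f p)).abs))
    simpa using this
  have ev := hav.and (hdct.eventually (ge_mem_nhds (by positivity : 0 < η / 4)))
  obtain ⟨N, hN⟩ := eventually_atTop.1 ev
  refine ⟨N, fun n hn m hm => ?_⟩
  obtain ⟨n1, n2⟩ := hN n hn
  obtain ⟨m1, m2⟩ := hN m hm
  have iU : ∀ n, IntegrableOn (fun p : ℝ × ℝ => U n p.1 p.2) K := fun n =>
    (h.continuous n).integrableOn_of_isCompact hK
  have k1 := ((iU n).sub (iA n)).norm
  have k2 := ((iA n).sub if').norm
  have k3 := ((iA m).sub if').norm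
  have k4 := ((iU m).sub (iA m)).norm
  have : ∫ p in K, |U n p.1 p.2 - U m p.1 p.2|
      ≤ ∫ p in K, ((|U n p.1 p.2 - A n p| + |A n p - f p|)
        + (|A m p - f p| + |U m p.1 p.2 - A m p|)) := by
    apply setIntegral_mono_on ((iU n).sub (iU m)).norm ((k1.add k2).add (k3.add k4)) hKm
    intro p _
    simp only [Pi.add_apply, Pi.sub_apply, Real.norm_eq_abs]
    have e1 := abs_add_le ((U n p.1 p.2 - A n p) + (A n p - f p))
      (-((A m p - f p) + (U m p.1 p.2 - A m p)))
    have e2 := abs_add_le (U n p.1 p.2 - A n p) (A n p - f p)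
    have e3 := abs_add_le (A m p - f p) (U m p.1 p.2 - A m p)
    rw [abs_neg] at e1
    have e4 : U n p.1 p.2 - U m p.1 p.2 = ((U n p.1 p.2 - A n p) + (A n p - f p))
      + (-((A m p - f p) + (U m p.1 p.2 - A m p))) := by ring
    rw [e4]
    linarith
  have s := integral_add (k1.add k2) (k3.add k4)
  have s1 := integral_add k1 k2
  have s2 := integral_add k3 k4
  simp only [Pi.add_apply, Pi.sub_apply, Real.norm_eq_abs] at s s1 s2
  rw [s, s1, s2] at this
  linarith

/-- Strong compactness of vanishing viscosity sequences. -/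
lemma exists_subseq_ae_tendsto (h : IsViscousSequence T M e U u₀ g) :
    ∃ k : ℕ → ℕ, StrictMono k ∧ ∃ f : ℝ × ℝ → ℝ, Measurable f ∧ (∀ p, |f p| ≤ M) ∧
      ∀ᵐ p ∂(volume.restrict (Ioo 0 T ×ˢ Ioi (0:ℝ))),
        Tendsto (fun n => U (k n) p.1 p.2) atTop (nhds (f p)) := by
  have hM := h.M_pos
  have hT := h.T_pos
  obtain ⟨k₁, hk₁, hV⟩ := h.exists_subseq_double_primitive
  have h₁ := h.comp_strictMono hk₁
  set W := U ∘ k₁ with hW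
  set K : ℕ → Set (ℝ × ℝ) := fun j => Icc 0 (T - T / (j + 1)) ×ˢ Icc 0 (j : ℝ) with hK
  have hKc : ∀ j, IsCompact (K j) := fun j => isCompact_Icc.prod isCompact_Icc
  have hKm : ∀ {i j}, i ≤ j → K i ⊆ K j := by
    intro i j hij
    have : (i : ℝ) ≤ j := by exact_mod_cast hij
    apply Set.prod_mono <;> apply Icc_subset_Icc_right
    · gcongr
    · exact this
  have ex : ∀ j : ℕ, ∃ N, ∀ n ≥ N, ∀ m ≥ n, ∫ p in K j, |W n p.1 p.2 - W m p.1 p.2|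
      ≤ (1 / 2) ^ j := by
    intro j
    have hj : T / (j + 1) ≤ T := div_le_self hT.le (by linarith [Nat.cast_nonneg (α := ℝ) j])
    obtain ⟨N, hN⟩ := h₁.cauchy_integral hV (T' := T - T / (j + 1)) (R := j) (by linarith)
      (by linarith [(by positivity : 0 < T / (j + 1))]) (Nat.cast_nonneg _)
      (by positivity : (0:ℝ) < (1 / 2) ^ j)
    exact ⟨N, fun n hn m hm => hN n hn m (le_trans hn hm)⟩
  obtain ⟨k₂, hk₂, hC⟩ := extraction_forall_of_eventually' ex
  have lim : ∀ J, ∀ᵐ p ∂(volume.restrict (K J)), ∃ l,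
      Tendsto (fun n => W (k₂ n) p.1 p.2) atTop (nhds l) := by
    intro J
    have c : ∀ n, Continuous fun p : ℝ × ℝ => W (k₂ (n + J)) p.1 p.2 := fun n => h₁.continuous _
    have := Lp.ae_tendsto_of_cauchy_eLpNorm (μ := volume.restrict (K J)) (p := 1)
      (f := fun n (p : ℝ × ℝ) => W (k₂ (n + J)) p.1 p.2)
      (B := fun n => ENNReal.ofReal (2 * (1 / 2) ^ n))
      (fun n => (c n).aestronglyMeasurable) le_rfl ?_ ?_
    · filter_upwards [this] with p ⟨l, hl⟩
      exact ⟨l, (tendsto_add_atTop_iff_nat (f := fun n => W (k₂ n) p.1 p.2) J).1 hl⟩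
    · have : Summable fun n : ℕ => (2 * (1 / 2) ^ n : ℝ) :=
        summable_geometric_two.mul_left 2
      rw [← ENNReal.ofReal_tsum_of_nonneg (fun n => by positivity) this]
      exact ENNReal.ofReal_ne_top
    · have aux : ∀ N n m : ℕ, N ≤ n → n ≤ m →
          ∫ p in K J, |W (k₂ (n + J)) p.1 p.2 - W (k₂ (m + J)) p.1 p.2| < 2 * (1 / 2) ^ N := by
        intro N n m hN hm
        have h1 := hC (n + J) (k₂ (m + J)) (hk₂.monotone (by lia))
        have h2 : ∫ p in K J, |W (k₂ (n + J)) p.1 p.2 - W (k₂ (m + J)) p.1 p.2|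
            ≤ ∫ p in K (n + J), |W (k₂ (n + J)) p.1 p.2 - W (k₂ (m + J)) p.1 p.2| := by
          apply setIntegral_mono_set
          · exact ((c n).sub (c m)).abs.integrableOn_of_isCompact (hKc _)
          · exact Eventually.of_forall fun _ => abs_nonneg _
          · exact (hKm (by lia)).eventuallyLE
        have h3 : ((1:ℝ) / 2) ^ (n + J) ≤ (1 / 2) ^ N :=
          pow_le_pow_of_le_one (by norm_num) (by norm_num) (by lia)
        have h4 : (0:ℝ) < (1 / 2) ^ N := by positivity
        linarith
      intro N n m hn hm
      rw [eLpNorm_one_eq_lintegral_enorm,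
        ← ofReal_integral_norm_eq_lintegral_enorm
          (((c n).sub (c m)).integrableOn_of_isCompact (hKc J)),
        ENNReal.ofReal_lt_ofReal_iff (by positivity)]
      simp only [Real.norm_eq_abs, Pi.sub_apply]
      rcases le_total n m with hnm | hnm
      · exact aux N n m hn hnm
      · simp only [abs_sub_comm (W (k₂ (n + J)) _ _)]
        exact aux N m n hm hnm
  have sub : Ioo 0 T ×ˢ Ioi (0:ℝ) ⊆ ⋃ j, K j := by
    rintro ⟨t, x⟩ ⟨ht, hx⟩
    have hx : 0 < x := hx
    obtain ⟨j, hj⟩ := exists_nat_gt (max x (T / (T - t)))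
    have hTt : 0 < T - t := by linarith [ht.2]
    have h1 : T / (T - t) < j := (le_max_right _ _).trans_lt hj
    have hj0 : (0:ℝ) < j + 1 := by positivity
    refine mem_iUnion.2 ⟨j, ⟨ht.1.le, ?_⟩, hx.le, ((le_max_left _ _).trans_lt hj).le⟩
    rw [div_lt_iff₀ hTt] at h1
    have : T / (j + 1) ≤ T - t := by
      rw [div_le_iff₀ hj0]; nlinarith
    simp only; linarith
  have lim' := ae_restrict_of_ae_restrict_of_subset sub
    ((ae_restrict_iUnion_iff K _).2 lim)
  obtain ⟨f, hfm, hf⟩ := measurable_limit_of_tendsto_metrizable_ae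
    (fun n => (h₁.continuous (k₂ n)).aemeasurable) lim'
  refine ⟨k₁ ∘ k₂, hk₁.comp hk₂, fun p => max (-M) (min M (f p)),
    measurable_const.max (measurable_const.min hfm), fun p => abs_clip_le hM.le _, ?_⟩
  filter_upwards [hf, ae_restrict_mem (measurableSet_Ioo.prod measurableSet_Ioi)] with p hp hpm
  rw [clip_eq_self]
  · exact hp
  · exact le_of_tendsto hp.abs (Eventually.of_forall fun n =>
      (h₁.sol _).bound _ (Ioo_subset_Icc_self hpm.1) _ (Ioi_subset_Ici_self hpm.2))

end IsViscousSequence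
end compactness

section trace

lemma tendsto_setIntegral_of_bounded {α : Type*} [MeasurableSpace α] {μ : Measure α} {s : Set α}
    (hs : MeasurableSet s) (hfin : μ s ≠ ⊤) {F : ℕ → α → ℝ} {f : α → ℝ} {C : ℝ}
    (hF : ∀ n, AEStronglyMeasurable (F n) (μ.restrict s)) (hC : ∀ n, ∀ p ∈ s, |F n p| ≤ C)
    (hlim : ∀ᵐ p ∂μ.restrict s, Tendsto (fun n => F n p) atTop (nhds (f p))) :
    Tendsto (fun n => ∫ p in s, F n p ∂μ) atTop (nhds (∫ p in s, f p ∂μ)) :=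
  tendsto_integral_of_dominated_convergence (fun _ => C) hF (integrableOn_const hfin)
    (fun n => (ae_restrict_iff' hs).2 (Eventually.of_forall (hC n))) hlim

lemma integrableOn_of_forall_le {α : Type*} [MeasurableSpace α] {μ : Measure α} {s : Set α}
    (hs : MeasurableSet s) (hfin : μ s ≠ ⊤) {f : α → ℝ} {C : ℝ}
    (hf : AEStronglyMeasurable f (μ.restrict s)) (hC : ∀ p ∈ s, |f p| ≤ C) :
    IntegrableOn f s μ := by
  have : IsFiniteMeasure (μ.restrict s) := ⟨by simpa using hfin.lt_top⟩
  exact Integrable.of_bound hf C ((ae_restrict_iff' hs).2 (Eventually.of_forall hC))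

lemma volume_restrict_rect (T R : ℝ) :
    (volume : Measure (ℝ × ℝ)).restrict (Icc 0 T ×ˢ Icc 0 R)
      = (volume.restrict (Ioo 0 T)).prod (volume.restrict (Ioc 0 R)) := by
  rw [Measure.restrict_congr_set Ioo_ae_eq_Icc, Measure.restrict_congr_set Ioc_ae_eq_Icc,
    Measure.prod_restrict,
    Measure.volume_eq_prod]

lemma ae_rect {T : ℝ} {p : ℝ × ℝ → Prop}
    (hp : ∀ᵐ z ∂volume.restrict (Ioo 0 T ×ˢ Ioi (0:ℝ)), p z) (R : ℝ) :
    ∀ᵐ z ∂(volume : Measure (ℝ × ℝ)).restrict (Icc 0 T ×ˢ Icc 0 R), p z := by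
  rw [volume_restrict_rect, Measure.prod_restrict, ← Measure.volume_eq_prod]
  exact ae_restrict_of_ae_restrict_of_subset (Set.prod_mono le_rfl Ioc_subset_Ioi_self) hp

lemma integral_rect_symm {T R : ℝ} {h : ℝ × ℝ → ℝ} (hh : IntegrableOn h (Icc 0 T ×ˢ Icc 0 R)) :
    ∫ p in Icc 0 T ×ˢ Icc 0 R, h p = ∫ x in Ioc 0 R, ∫ t in Ioo 0 T, h (t, x) := by
  rw [IntegrableOn, volume_restrict_rect] at hh
  rw [volume_restrict_rect, integral_prod_symm h hh]

lemma measure_rect_ne_top (T R : ℝ) : volume (Icc 0 T ×ˢ Icc 0 R : Set (ℝ × ℝ)) ≠ ⊤ :=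
  (isCompact_Icc.prod isCompact_Icc).measure_lt_top.ne

lemma measurableSet_rect (T R : ℝ) : MeasurableSet (Icc 0 T ×ˢ Icc 0 R : Set (ℝ × ℝ)) :=
  measurableSet_Icc.prod measurableSet_Icc

/-- The primitive of a bump function, vanishing to second order at the right end of its support. -/
lemma exists_decreasing_cutoff (x₀ : ℝ) (b : ContDiffBump (0 : ℝ)) :
    ∃ φ : ℝ → ℝ, ContDiff ℝ 2 φ ∧ (∀ x, 0 ≤ φ x) ∧ (∀ x, φ x ≤ 1) ∧
      (∀ x, deriv φ x = -b.normed volume (x₀ - x)) ∧ φ (x₀ + b.rOut) = 0 ∧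
      deriv φ (x₀ + b.rOut) = 0 := by
  set ζ : ℝ → ℝ := fun x => b.normed volume (x₀ - x) with hζ
  have hζ1 : ContDiff ℝ 1 ζ := (b.contDiff_normed (n := 1)).comp (contDiff_const.sub contDiff_id)
  have cζ := hζ1.continuous
  have hζ0 : ∀ x, 0 ≤ ζ x := fun x => b.nonneg_normed _
  have hsupp : ∀ x, x₀ + b.rOut ≤ x → ζ x = 0 := by
    intro x hxx
    by_contra hne
    have : x₀ - x ∈ Function.support (b.normed volume) := hne
    rw [b.support_normed_eq, mem_ball_zero_iff, Real.norm_eq_abs] at this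
    linarith [neg_le_abs (x₀ - x)]
  have h_int : Integrable ζ := by
    have h1 : Integrable (b.normed (volume : Measure ℝ)) := b.integrable_normed
    exact h1.comp_sub_left x₀
  have htot : ∫ x, ζ x = 1 := by
    rw [hζ, integral_sub_left_eq_self (fun x => b.normed volume x)]
    exact b.integral_normed
  have hd : ∀ x, HasDerivAt (fun x => ∫ y in x..x₀ + b.rOut, ζ y) (-ζ x) x := fun x =>
    intervalIntegral.integral_hasDerivAt_left (cζ.intervalIntegrable _ _)
      (cζ.stronglyMeasurableAtFilter _ _) cζ.continuousAt
  have hde : deriv (fun x => ∫ y in x..x₀ + b.rOut, ζ y) = fun x => -ζ x :=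
    funext fun x => (hd x).deriv
  refine ⟨fun x => ∫ y in x..x₀ + b.rOut, ζ y, ?_, ?_, ?_, fun x => (hd x).deriv, by simp, ?_⟩
  · rw [← one_add_one_eq_two, contDiff_succ_iff_deriv]
    refine ⟨fun x => (hd x).differentiableAt, by simp, ?_⟩
    rw [hde]
    exact hζ1.neg
  · intro x
    rcases le_total x (x₀ + b.rOut) with h | h
    · exact intervalIntegral.integral_nonneg h fun y _ => hζ0 y
    · have : ∫ y in x..x₀ + b.rOut, ζ y = ∫ y in x..x₀ + b.rOut, (0:ℝ) := by
        apply intervalIntegral.integral_congr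
        intro y hy
        rw [uIcc_of_ge h] at hy
        exact hsupp y hy.1
      simp only [this, intervalIntegral.integral_zero, le_rfl]
  · intro x
    rcases le_total x (x₀ + b.rOut) with h | h
    · simp only [intervalIntegral.integral_of_le h]
      rw [← htot]
      exact setIntegral_le_integral h_int (Eventually.of_forall hζ0)
    · have : ∫ y in x..x₀ + b.rOut, ζ y = ∫ y in x..x₀ + b.rOut, (0:ℝ) := by
        apply intervalIntegral.integral_congr
        intro y hy
        rw [uIcc_of_ge h] at hy
        exact hsupp y hy.1
      simp only [this, intervalIntegral.integral_zero, zero_le_one]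
  · rw [(hd _).deriv, hsupp _ le_rfl, neg_zero]

namespace IsViscousSequence
variable {T M : ℝ} {e : ℕ → ℝ} {U : ℕ → ℝ → ℝ → ℝ} {u₀ g : ℝ → ℝ} {f : ℝ × ℝ → ℝ}

lemma trace_cube_le (h : IsViscousSequence T M e U u₀ g) (hf : Measurable f)
    (hfM : ∀ p, |f p| ≤ M) (hlim : ∀ᵐ p ∂(volume.restrict (Ioo 0 T ×ˢ Ioi (0:ℝ))),
        Tendsto (fun n => U n p.1 p.2) atTop (nhds (f p)))
    {w : ℝ → ℝ} (hw : ContDiff ℝ 2 w) (hwM : ∀ t ∈ Icc 0 T, |w t| ≤ M + 1) :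
    ∃ C, 0 ≤ C ∧ ∀ᵐ x ∂(volume : Measure ℝ), x ∈ Ioo 0 1 →
      ∫ t in Ioo 0 T, |f (t, x) ^ 3 - w t ^ 3|
        ≤ C * x + 3 * (M + 1) ^ 2 * ∫ t in (0:ℝ)..T, |g t - w t| := by
  have hM := h.M_pos
  have hT := h.T_pos
  obtain ⟨C, hC, hcomp⟩ := h.comparison (w := fun t _ => w t) (R₀ := 2)
    (hw.comp contDiff_fst) (fun t ht x _ => hwM t ht)
  have hf3 : Measurable fun p : ℝ × ℝ => |f p ^ 3 - w p.1 ^ 3| := by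
    have := hw.continuous.measurable
    fun_prop
  set F : ℝ → ℝ := fun x => ∫ t in Ioo 0 T, |f (t, x) ^ 3 - w t ^ 3| with hF
  have cube_le : ∀ {a B : ℝ}, |a| ≤ B → |a ^ 3| ≤ B ^ 3 := fun {a B} ha => by
    rw [abs_pow]; exact pow_le_pow_left₀ (abs_nonneg _) ha 3
  set B := M ^ 3 + (M + 1) ^ 3 with hB
  have hFm : StronglyMeasurable F :=
    StronglyMeasurable.integral_prod_left' (μ := volume.restrict (Ioo 0 T)) hf3.stronglyMeasurable
  have hfB : ∀ t ∈ Icc 0 T, ∀ x, |(|f (t, x) ^ 3 - w t ^ 3|)| ≤ B := fun t ht x => by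
    rw [abs_abs]
    exact (abs_sub _ _).trans (add_le_add (cube_le (hfM _)) (cube_le (hwM t ht)))
  have hFB : ∀ x, ‖F x‖ ≤ B * (volume : Measure ℝ).real (Ioo 0 T) := fun x =>
    norm_setIntegral_le_of_norm_le_const (by simp) fun t ht =>
      hfB t (Ioo_subset_Icc_self ht) x
  have hFloc : LocallyIntegrable F volume := fun x =>
    ⟨Icc (x - 1) (x + 1), Icc_mem_nhds (by linarith) (by linarith),
      Measure.integrableOn_of_bounded (by simp) hFm.aestronglyMeasurable
        (Eventually.of_forall hFB)⟩
  set A := 3 * (M + 1) ^ 2 with hA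
  set I := ∫ t in (0:ℝ)..T, |g t - w t| with hI
  -- the estimate against a bump function
  have bump : ∀ (b : ContDiffBump (0:ℝ)) (x₀ : ℝ), b.rOut ≤ x₀ → b.rOut ≤ 1 → x₀ ≤ 1 →
      convolution (b.normed volume) F (ContinuousLinearMap.lsmul ℝ ℝ) volume x₀
        ≤ (2 * M + 1 + C * T) * (x₀ + b.rOut) + A * I := by
    intro b x₀ hbx hb1 hx1
    have hb := b.rOut_pos
    obtain ⟨φ, hφ, hφ0, hφ1, hφd, hφR, hφR'⟩ := exists_decreasing_cutoff x₀ b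
    set R := x₀ + b.rOut with hR
    have hR0 : 0 ≤ R := by linarith
    obtain ⟨C', hC', hev⟩ := hcomp R φ hR0 (by linarith) hφ (fun x _ => hφ0 x)
      (fun x _ => by rw [hφd]; linarith [b.nonneg_normed (μ := volume) (x₀ - x)]) hφR hφR'
    set ζ : ℝ → ℝ := fun x => b.normed volume (x₀ - x) with hζ
    have cζ : Continuous ζ := (b.continuous_normed).comp (by fun_prop)
    have hζ0 : ∀ x, 0 ≤ ζ x := fun x => b.nonneg_normed _
    obtain ⟨B', hB'⟩ := isCompact_Icc.exists_bound_of_continuousOn (s := Icc 0 R) cζ.continuousOn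
    have cw := hw.continuous
    -- convolution as an integral over the rectangle
    have h_int : IntegrableOn (fun p : ℝ × ℝ => |f p ^ 3 - w p.1 ^ 3| * ζ p.2)
        (Icc 0 T ×ˢ Icc 0 R) := by
      refine integrableOn_of_forall_le (C := B * B') (measurableSet_rect _ _)
        (measure_rect_ne_top _ _)
        (hf3.mul (cζ.measurable.comp measurable_snd)).aestronglyMeasurable ?_
      rintro ⟨t, x⟩ ⟨ht, hx⟩
      rw [abs_mul]
      exact mul_le_mul (hfB t ht x) (hB' x hx) (abs_nonneg _) ((abs_nonneg _).trans (hfB t ht x))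
    have econv : convolution (b.normed volume) F (ContinuousLinearMap.lsmul ℝ ℝ) volume x₀
        = ∫ p in Icc 0 T ×ˢ Icc 0 R, |f p ^ 3 - w p.1 ^ 3| * ζ p.2 := by
      rw [integral_rect_symm h_int, convolution_eq_swap]
      simp only [ContinuousLinearMap.lsmul_apply, smul_eq_mul, integral_mul_const]
      rw [← integral_indicator measurableSet_Ioc, ← integral_congr_ae]
      have : ∀ᵐ x : ℝ, x ≠ 0 := by simp [ae_iff]
      filter_upwards [this] with x hx0
      by_cases hx : x ∈ Ioc 0 R
      · rw [indicator_of_mem hx, mul_comm]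
      · rw [indicator_of_notMem hx]
        suffices b.normed volume (x₀ - x) = 0 by rw [this, zero_mul]
        by_contra hne
        have hm : x₀ - x ∈ Function.support (b.normed volume) := hne
        rw [b.support_normed_eq, mem_ball_zero_iff, Real.norm_eq_abs, abs_lt] at hm
        exact hx ⟨by linarith [hm.2], by linarith [hm.1]⟩
    have lim1 : Tendsto (fun n => ∫ p in Icc 0 T ×ˢ Icc 0 R, |U n p.1 p.2 ^ 3 - w p.1 ^ 3| * ζ p.2)
        atTop (nhds (∫ p in Icc 0 T ×ˢ Icc 0 R, |f p ^ 3 - w p.1 ^ 3| * ζ p.2)) := by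
      refine tendsto_setIntegral_of_bounded (C := B * B') (measurableSet_rect _ _)
        (measure_rect_ne_top _ _) (fun n => ?_) ?_ ?_
      · have := h.continuous n
        have c : Continuous fun p : ℝ × ℝ => U n p.1 p.2 := this
        exact Continuous.aestronglyMeasurable (by fun_prop)
      · rintro n ⟨t, x⟩ ⟨ht, hx⟩
        rw [abs_mul, abs_abs]
        refine mul_le_mul ?_ (hB' x hx) (abs_nonneg _) (by positivity)
        exact (abs_sub _ _).trans
          (add_le_add (cube_le ((h.sol n).bound t ht x hx.1)) (cube_le (hwM t ht)))
      · filter_upwards [ae_rect hlim R] with p hp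
        exact (((hp.pow 3).sub_const _).abs).mul_const _
    have ig : IntervalIntegrable g volume 0 T := intervalIntegrable_of_bounded h.meas_g h.bound_g _ _
    have lim2 : Tendsto (fun n => (2 * M + 1) * R + A * ((∫ t in (0:ℝ)..T, |U n t 0 - g t|) + I)
        + C * (T * R) + C' * e n) atTop
        (nhds ((2 * M + 1) * R + A * (0 + I) + C * (T * R) + C' * 0)) :=
      (((h.lim_g.add_const I).const_mul A).const_add _ |>.add_const _).add (h.e_lim.const_mul C')
    rw [econv]
    have hle := le_of_tendsto_of_tendsto lim1 lim2 (by
      filter_upwards [hev] with n hn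
      have key := hn T ⟨hT.le, le_rfl⟩
      have c0 : Continuous (U n 0) := (h.continuous n).uncurry_left 0
      have c1 : Continuous (fun t => U n t 0) := (h.continuous n).uncurry_right 0
      have cφ := hφ.continuous
      have k0 : 0 ≤ ∫ x in (0:ℝ)..R, |U n T x - w T| * φ x :=
        intervalIntegral.integral_nonneg hR0 fun x _ => mul_nonneg (abs_nonneg _) (hφ0 x)
      have k1 : ∫ x in (0:ℝ)..R, |U n 0 x - w 0| * φ x ≤ R * (2 * M + 1) := by
        apply integral_le_mul_of_forall_le hR0 (Continuous.intervalIntegrable (by fun_prop) _ _)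
        intro x hx
        have h0 : (0:ℝ) ∈ Icc 0 T := ⟨le_rfl, hT.le⟩
        have a1 := (h.sol n).bound 0 h0 x hx.1
        have a2 := hwM 0 h0
        have a3 := abs_sub (U n 0 x) (w 0)
        calc |U n 0 x - w 0| * φ x ≤ |U n 0 x - w 0| * 1 := by gcongr; exact hφ1 x
          _ ≤ _ := by linarith
      have k2 : ∫ t in (0:ℝ)..T, |U n t 0 - w t| ≤ (∫ t in (0:ℝ)..T, |U n t 0 - g t|) + I :=
        integral_abs_sub_triangle hT.le (Continuous.intervalIntegrable (by fun_prop) _ _)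
          ((c1.intervalIntegrable _ _).sub ig).abs (ig.sub (cw.intervalIntegrable _ _)).abs
      have k20 : 0 ≤ ∫ t in (0:ℝ)..T, |U n t 0 - w t| :=
        intervalIntegral.integral_nonneg hT.le fun x _ => abs_nonneg _
      have k3 : A * φ 0 * (∫ t in (0:ℝ)..T, |U n t 0 - w t|)
          ≤ A * ((∫ t in (0:ℝ)..T, |U n t 0 - g t|) + I) := by
        calc _ ≤ A * 1 * (∫ t in (0:ℝ)..T, |U n t 0 - w t|) := by gcongr; exact hφ1 0
          _ ≤ _ := by rw [mul_one]; gcongr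
      have k4 : ∫ x in (0:ℝ)..R, φ x ≤ R * 1 :=
        integral_le_mul_of_forall_le hR0 (cφ.intervalIntegrable _ _) fun x _ => hφ1 x
      have k5 : C * (T * ∫ x in (0:ℝ)..R, φ x) ≤ C * (T * R) := by
        rw [mul_one] at k4; gcongr
      simp only [hφd, neg_neg] at key
      linarith)
    refine hle.trans_eq ?_
    ring
  refine ⟨2 * M + 1 + C * T, by positivity, ?_⟩
  set b : ℕ → ContDiffBump (0:ℝ) := fun n =>
    ⟨1 / (n + 1) / 2, 1 / (n + 1), by positivity, half_lt_self (by positivity)⟩ with hb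
  have hbr : ∀ n, (b n).rOut = 1 / ((n:ℝ) + 1) := fun n => rfl
  have hb0 : Tendsto (fun n => (b n).rOut) atTop (nhds 0) :=
    tendsto_one_div_add_atTop_nhds_zero_nat
  have := ContDiffBump.ae_convolution_tendsto_right_of_locallyIntegrable (μ := volume) (K := 2)
    hb0 (Eventually.of_forall fun n => le_of_eq (by
      change 1 / ((n:ℝ) + 1) = 2 * (1 / ((n:ℝ) + 1) / 2); ring)) hFloc
  filter_upwards [this] with x hx hx1
  have lim3 : Tendsto (fun n => (2 * M + 1 + C * T) * (x + (b n).rOut) + A * I) atTop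
      (nhds ((2 * M + 1 + C * T) * (x + 0) + A * I)) :=
    ((hb0.const_add x).const_mul _).add_const _
  rw [add_zero] at lim3
  refine le_of_tendsto_of_tendsto hx lim3 ?_
  filter_upwards [hb0.eventually (ge_mem_nhds hx1.1)] with n hn
  exact bump (b n) x hn (hn.trans hx1.2.le) hx1.2.le

end IsViscousSequence
namespace IsViscousSequence
variable {T M : ℝ} {e : ℕ → ℝ} {U : ℕ → ℝ → ℝ → ℝ} {u₀ g : ℝ → ℝ} {f : ℝ × ℝ → ℝ}

/-- The limit attains the boundary datum strongly, outside a null set of positions. -/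
lemma exists_trace (h : IsViscousSequence T M e U u₀ g) (hf : Measurable f)
    (hfM : ∀ p, |f p| ≤ M) (hlim : ∀ᵐ p ∂(volume.restrict (Ioo 0 T ×ˢ Ioi (0:ℝ))),
        Tendsto (fun n => U n p.1 p.2) atTop (nhds (f p))) :
    ∃ N : Set ℝ, MeasurableSet N ∧ volume N = 0 ∧
      Tendsto (fun x => ∫ t in Ioo 0 T, |f (t, x) - g t|) (nhdsWithin 0 (Ioi 0 \ N)) (nhds 0) := by
  have hM := h.M_pos
  have hT := h.T_pos
  have hδ : ∀ j : ℕ, (0:ℝ) < 1 / (j + 1) := fun j => by positivity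
  choose w hw hwM hwg using fun j => exists_contDiff_integral_sub_le h.meas_g h.bound_g hT.le (hδ j)
  choose C hC hCx using fun j => h.trace_cube_le hf hfM hlim (hw j) (hwM j)
  have hae := ae_all_iff.2 hCx
  set N := toMeasurable volume {x : ℝ | ¬ ∀ j, x ∈ Ioo 0 1 →
      ∫ t in Ioo 0 T, |f (t, x) ^ 3 - w j t ^ 3|
        ≤ C j * x + 3 * (M + 1) ^ 2 * ∫ t in (0:ℝ)..T, |g t - w j t|} with hN
  refine ⟨N, measurableSet_toMeasurable _ _, by rw [hN, measure_toMeasurable]; exact hae, ?_⟩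
  rw [Metric.tendsto_nhdsWithin_nhds]
  intro η hη
  set κ := η / (4 * T) with hκ
  have hκ0 : 0 < κ := by positivity
  set A := 3 * (M + 1) ^ 2 with hA
  set L := 4 / κ ^ 2 * A + 1 with hL
  obtain ⟨j, hj⟩ := exists_nat_gt (4 * L / η)
  have hjL : L * (1 / ((j:ℝ) + 1)) ≤ η / 4 := by
    rw [div_lt_iff₀ hη] at hj
    rw [mul_one_div, div_le_iff₀ (by positivity)]
    nlinarith
  refine ⟨min 1 (η / 4 / (4 / κ ^ 2 * C j + 1)), ?_, ?_⟩
  · have := hC j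
    positivity
  rintro x ⟨hx0 : 0 < x, hxN⟩ hxd
  rw [Real.dist_eq, sub_zero, abs_of_pos hx0, lt_min_iff] at hxd
  have hCj := hC j
  have hgood : ∀ j, x ∈ Ioo 0 1 → ∫ t in Ioo 0 T, |f (t, x) ^ 3 - w j t ^ 3|
        ≤ C j * x + 3 * (M + 1) ^ 2 * ∫ t in (0:ℝ)..T, |g t - w j t| := by
    by_contra hne
    exact hxN (subset_toMeasurable _ _ hne)
  have h1 := hgood j ⟨hx0, hxd.1⟩
  have h2 := hwg j
  have cw := (hw j).continuous
  have mw := cw.measurable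
  have mg := h.meas_g
  have mx : Measurable fun t => f (t, x) := hf.comp (measurable_id.prodMk measurable_const)
  have bnd : ∀ t ∈ Ioo 0 T, |w j t| ≤ M + 1 := fun t ht => hwM j t (Ioo_subset_Icc_self ht)
  have cube_le : ∀ {a B : ℝ}, |a| ≤ B → |a ^ 3| ≤ B ^ 3 := fun {a B} ha => by
    rw [abs_pow]; exact pow_le_pow_left₀ (abs_nonneg _) ha 3
  have i1 : IntegrableOn (fun t => |f (t, x) ^ 3 - w j t ^ 3|) (Ioo 0 T) :=
    integrableOn_of_forall_le (C := M ^ 3 + (M + 1) ^ 3) measurableSet_Ioo (by simp)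
      (Measurable.aestronglyMeasurable (by fun_prop)) fun t ht => by
        rw [abs_abs]
        exact (abs_sub _ _).trans (add_le_add (cube_le (hfM _)) (cube_le (bnd t ht)))
  have i2 : IntegrableOn (fun t => |g t - w j t|) (Ioo 0 T) :=
    integrableOn_of_forall_le (C := M + (M + 1)) measurableSet_Ioo (by simp)
      (Measurable.aestronglyMeasurable (by fun_prop)) fun t ht => by
        rw [abs_abs]
        exact (abs_sub _ _).trans (add_le_add (h.bound_g t) (bnd t ht))
  have i3 : IntegrableOn (fun t => |f (t, x) - g t|) (Ioo 0 T) :=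
    integrableOn_of_forall_le (C := M + M) measurableSet_Ioo (by simp)
      (Measurable.aestronglyMeasurable (by fun_prop)) fun t ht => by
        rw [abs_abs]
        exact (abs_sub _ _).trans (add_le_add (hfM _) (h.bound_g t))
  have i4 : IntegrableOn (fun _ : ℝ => κ) (Ioo 0 T) := integrableOn_const (by simp)
  have main : ∫ t in Ioo 0 T, |f (t, x) - g t|
      ≤ ∫ t in Ioo 0 T, ((κ + 4 / κ ^ 2 * |f (t, x) ^ 3 - w j t ^ 3|) + |g t - w j t|) := by
    apply setIntegral_mono_on i3 ((i4.add (i1.const_mul _)).add i2) measurableSet_Ioo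
    intro t _
    have k1 := abs_sub_le_cube (u := f (t, x)) (w := w j t) hκ0
    have k2 := abs_sub_le (f (t, x)) (w j t) (g t)
    rw [abs_sub_comm (w j t)] at k2
    simp only [Pi.add_apply]
    linarith
  have s1 := integral_add (i4.add (i1.const_mul (4 / κ ^ 2))) i2
  have s2 := integral_add i4 (i1.const_mul (4 / κ ^ 2))
  simp only [Pi.add_apply] at s1 s2
  rw [s1, s2, setIntegral_const, integral_const_mul, smul_eq_mul] at main
  have s3 : ∫ t in Ioo 0 T, |g t - w j t| = ∫ t in (0:ℝ)..T, |g t - w j t| := by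
    rw [intervalIntegral.integral_of_le hT.le, integral_Ioc_eq_integral_Ioo]
  have s4 : (volume : Measure ℝ).real (Ioo 0 T) * κ = η / 4 := by
    simp [hT.le, hκ]; field_simp
  rw [s3, s4] at main
  rw [Real.dist_eq, sub_zero, abs_of_nonneg (integral_nonneg fun _ => abs_nonneg _)]
  set I := ∫ t in (0:ℝ)..T, |g t - w j t| with hI
  have t1 : 4 / κ ^ 2 * ∫ t in Ioo 0 T, |f (t, x) ^ 3 - w j t ^ 3|
      ≤ 4 / κ ^ 2 * (C j * x + A * I) := by gcongr
  have t2 : 4 / κ ^ 2 * C j * x ≤ η / 4 := by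
    have := hxd.2.le
    rw [le_div_iff₀ (by positivity)] at this
    nlinarith
  have t3 : L * I ≤ η / 4 := by
    refine le_trans ?_ hjL
    gcongr
  have t4 : 4 / κ ^ 2 * (C j * x + A * I) + I = 4 / κ ^ 2 * C j * x + L * I := by rw [hL]; ring
  linarith

end IsViscousSequence
end trace

section entropy

lemma ae_fst_of_ae {T : ℝ} {p : ℝ → Prop} (hp : ∀ᵐ t ∂(volume : Measure ℝ).restrict (Ioo 0 T), p t) :
    ∀ᵐ z ∂(volume : Measure (ℝ × ℝ)).restrict (Ioo 0 T ×ˢ Ioi (0:ℝ)), p z.1 := by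
  rw [Measure.volume_eq_prod, ← Measure.prod_restrict]
  exact Measure.quasiMeasurePreserving_fst.ae hp

namespace IsViscousSequence
variable {T M : ℝ} {e : ℕ → ℝ} {U : ℕ → ℝ → ℝ → ℝ} {u₀ g : ℝ → ℝ} {f : ℝ × ℝ → ℝ}

lemma ae_tendsto_spePrimitive (h : IsViscousSequence T M e U u₀ g)
    (hlim : ∀ᵐ p ∂(volume.restrict (Ioo 0 T ×ˢ Ioi (0:ℝ))),
        Tendsto (fun n => U n p.1 p.2) atTop (nhds (f p))) :
    ∀ᵐ t ∂(volume : Measure ℝ).restrict (Ioo 0 T), ∀ x, 0 ≤ x →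
      Tendsto (fun n => spePrimitive (U n) t x) atTop
        (nhds (spePrimitive (fun t x => f (t, x)) t x)) := by
  rw [Measure.volume_eq_prod, ← Measure.prod_restrict] at hlim
  have h1 := Measure.ae_ae_of_ae_prod hlim
  filter_upwards [h1, ae_restrict_mem measurableSet_Ioo] with t ht htI x hx
  refine intervalIntegral.tendsto_integral_filter_of_dominated_convergence (fun _ => M) ?_ ?_ ?_ ?_
  · refine Eventually.of_forall fun n => Continuous.aestronglyMeasurable ?_
    exact (h.continuous n).comp (by fun_prop : Continuous fun y : ℝ => (t, y))
  · refine Eventually.of_forall fun n => Eventually.of_forall fun y hy => ?_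
    rw [uIoc_of_le hx] at hy
    exact (h.sol n).bound t (Ioo_subset_Icc_self htI) y hy.1.le
  · simp
  · rw [ae_restrict_iff' measurableSet_Ioi] at ht
    filter_upwards [ht] with y hy hyx
    rw [uIoc_of_le hx] at hyx
    exact hy hyx.1

lemma ae_prod_tendsto_spePrimitive (h : IsViscousSequence T M e U u₀ g)
    (hlim : ∀ᵐ p ∂(volume.restrict (Ioo 0 T ×ˢ Ioi (0:ℝ))),
        Tendsto (fun n => U n p.1 p.2) atTop (nhds (f p))) :
    ∀ᵐ p ∂(volume : Measure (ℝ × ℝ)).restrict (Ioo 0 T ×ˢ Ioi (0:ℝ)),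
      Tendsto (fun n => spePrimitive (U n) p.1 p.2) atTop
        (nhds (spePrimitive (fun t x => f (t, x)) p.1 p.2)) := by
  filter_upwards [ae_fst_of_ae (h.ae_tendsto_spePrimitive hlim),
    ae_restrict_mem (measurableSet_Ioo.prod measurableSet_Ioi)] with p hp hpm
  exact hp p.2 (le_of_lt hpm.2)

lemma aestronglyMeasurable_spePrimitive (h : IsViscousSequence T M e U u₀ g)
    (hlim : ∀ᵐ p ∂(volume.restrict (Ioo 0 T ×ˢ Ioi (0:ℝ))),
        Tendsto (fun n => U n p.1 p.2) atTop (nhds (f p))) :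
    AEStronglyMeasurable (fun p : ℝ × ℝ => spePrimitive (fun t x => f (t, x)) p.1 p.2)
      (volume.restrict (Ioo 0 T ×ˢ Ioi (0:ℝ))) :=
  aestronglyMeasurable_of_tendsto_ae atTop
    (fun n => (continuous_spePrimitive (h.continuous n)).aestronglyMeasurable)
    (h.ae_prod_tendsto_spePrimitive hlim)

end IsViscousSequence

/-- The integrand of the entropy inequality on a rectangle. -/
noncomputable def entropyDensity (f : ℝ × ℝ → ℝ) (c : ℝ) (Φ : ℝ → ℝ → ℝ) (p : ℝ × ℝ) : ℝ :=
  |f p - c| * (deriv (fun s => Φ s p.2) p.1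
      + (f p ^ 2 + f p * c + c ^ 2) * deriv (Φ p.1) p.2)
    + (f p - c).sign * spePrimitive (fun t x => f (t, x)) p.1 p.2 * Φ p.1 p.2

lemma Real.continuousAt_sign {x : ℝ} (hx : x ≠ 0) : ContinuousAt Real.sign x := by
  rcases hx.lt_or_gt with h | h
  · refine (continuousAt_const (y := (-1:ℝ))).congr ?_
    filter_upwards [Iio_mem_nhds h] with y hy using (Real.sign_of_neg hy).symm
  · refine (continuousAt_const (y := (1:ℝ))).congr ?_
    filter_upwards [Ioi_mem_nhds h] with y hy using (Real.sign_of_pos hy).symm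


/-- Nonnegative test functions on `[0, ∞) × [0, R]` vanishing on the lateral boundary, to second
order at `x = R`. -/
structure IsStripTest (R : ℝ) (Φ : ℝ → ℝ → ℝ) : Prop where
  R_nonneg : 0 ≤ R
  contDiff : ContDiff ℝ 2 (Function.uncurry Φ)
  nonneg : ∀ t x, 0 ≤ x → 0 ≤ Φ t x
  left : ∀ t, Φ t 0 = 0
  right : ∀ t, Φ t R = 0
  deriv_right : ∀ t, deriv (Φ t) R = 0

lemma IsCompact.exists_nonneg_bound {α : Type*} [TopologicalSpace α] {K : Set α} (hK : IsCompact K)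
    {F : α → ℝ} (hF : Continuous F) : ∃ B, 0 ≤ B ∧ ∀ p ∈ K, |F p| ≤ B := by
  obtain ⟨B, hB⟩ := hK.exists_bound_of_continuousOn hF.continuousOn
  exact ⟨max B 0, le_max_right _ _, fun p hp => (hB p hp).trans (le_max_left _ _)⟩

lemma abs_entropyDensity_le {v c S p p₁ p₂ p₃ A B B₁ B₂ B₃ C e E : ℝ} (hv : |v| ≤ A) (hc : |c| ≤ A)
    (hvc : |v - c| ≤ A) (hp : |p| ≤ B) (hp₁ : |p₁| ≤ B₁) (hp₂ : |p₂| ≤ B₂) (hp₃ : |p₃| ≤ B₃)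
    (hS : |S| ≤ C) (he : |e| ≤ E) :
    |(|v - c|) * (p₁ + (v ^ 2 + v * c + c ^ 2) * p₂ + e * p₃) + (v - c).sign * S * p|
      ≤ A * (B₁ + 3 * A ^ 2 * B₂ + E * B₃) + C * B := by
  have hE := (abs_nonneg e).trans he
  have hC := (abs_nonneg S).trans hS
  have hA := (abs_nonneg v).trans hv
  have h1 : |p₁ + (v ^ 2 + v * c + c ^ 2) * p₂ + e * p₃| ≤ B₁ + 3 * A ^ 2 * B₂ + E * B₃ := by
    refine (abs_add_three _ _ _).trans ?_
    rw [abs_mul, abs_mul, abs_of_nonneg (quadratic_nonneg v c)]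
    have := quadratic_le hv hc
    gcongr
  have h2 : |(v - c).sign * S| ≤ C := by
    rw [abs_mul]
    exact (mul_le_of_le_one_left (abs_nonneg _) (abs_real_sign_le _)).trans hS
  refine (abs_add_le _ _).trans ?_
  rw [abs_mul, abs_mul, abs_abs]
  gcongr

namespace IsViscousSequence
variable {T M : ℝ} {e : ℕ → ℝ} {U : ℕ → ℝ → ℝ → ℝ} {u₀ g : ℝ → ℝ} {f : ℝ × ℝ → ℝ}

lemma entropy_of_null (h : IsViscousSequence T M e U u₀ g)
    (hlim : ∀ᵐ p ∂(volume.restrict (Ioo 0 T ×ˢ Ioi (0:ℝ))),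
        Tendsto (fun n => U n p.1 p.2) atTop (nhds (f p)))
    {R : ℝ} {Φ : ℝ → ℝ → ℝ} (hΦ : IsStripTest R Φ) {c : ℝ}
    (hc : ∀ᵐ p ∂(volume.restrict (Ioo 0 T ×ˢ Ioi (0:ℝ))), f p ≠ c) :
    0 ≤ (∫ x in (0:ℝ)..R, |u₀ x - c| * Φ 0 x)
      + ∫ p in Icc 0 T ×ˢ Icc 0 R, entropyDensity f c Φ p := by
  have hM := h.M_pos
  have hT := h.T_pos
  have hR := hΦ.R_nonneg
  have hΦx : ContDiff ℝ 1 (Function.uncurry fun t x => deriv (Φ t) x) :=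
    hΦ.contDiff.deriv_right (by norm_num [one_add_one_eq_two])
  have hΦt : ContDiff ℝ 1 (Function.uncurry fun t x => deriv (fun s => Φ s x) t) :=
    hΦ.contDiff.deriv_left (by norm_num [one_add_one_eq_two])
  have hΦxx : ContDiff ℝ 0 (Function.uncurry fun t x => deriv (deriv (Φ t)) x) :=
    hΦx.deriv_right (by norm_num)
  have cΦ : Continuous fun p : ℝ × ℝ => Φ p.1 p.2 := hΦ.contDiff.continuous
  have cΦx : Continuous fun p : ℝ × ℝ => deriv (Φ p.1) p.2 := hΦx.continuous
  have cΦt : Continuous fun p : ℝ × ℝ => deriv (fun s => Φ s p.2) p.1 := hΦt.continuous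
  have cΦxx : Continuous fun p : ℝ × ℝ => deriv (deriv (Φ p.1)) p.2 := hΦxx.continuous
  have hK : IsCompact (Icc 0 T ×ˢ Icc 0 R : Set (ℝ × ℝ)) := isCompact_Icc.prod isCompact_Icc
  obtain ⟨B, hB0, hB⟩ := hK.exists_nonneg_bound cΦ
  obtain ⟨B₁, hB₁0, hB₁⟩ := hK.exists_nonneg_bound cΦt
  obtain ⟨B₂, hB₂0, hB₂⟩ := hK.exists_nonneg_bound cΦx
  obtain ⟨B₃, hB₃0, hB₃⟩ := hK.exists_nonneg_bound cΦxx
  obtain ⟨E, hE⟩ := h.e_lim.bddAbove_range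
  have hE : ∀ n, |e n| ≤ E := fun n => by
    rw [abs_of_pos (h.e_pos n)]; exact hE (mem_range_self n)
  set A := M + |c| with hA
  have hcA : |c| ≤ A := by linarith
  have hMA : M ≤ A := by linarith [abs_nonneg c]
  have hUc : ∀ n, ∀ t ∈ Icc 0 T, ∀ x, 0 ≤ x → |U n t x - c| ≤ A := fun n t ht x hx =>
    (abs_sub _ _).trans (add_le_add ((h.sol n).bound t ht x hx) le_rfl)
  set G : ℕ → ℝ × ℝ → ℝ := fun n p =>
    |U n p.1 p.2 - c| * (deriv (fun s => Φ s p.2) p.1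
        + (U n p.1 p.2 ^ 2 + U n p.1 p.2 * c + c ^ 2) * deriv (Φ p.1) p.2
        + e n * deriv (deriv (Φ p.1)) p.2)
      + (U n p.1 p.2 - c).sign * spePrimitive (U n) p.1 p.2 * Φ p.1 p.2 with hG
  -- the entropy inequality along the sequence
  have kato : ∀ n, 0 ≤ ((∫ x in (0:ℝ)..R, |U n 0 x - c| * Φ 0 x)
      + ∫ p in Icc 0 T ×ˢ Icc 0 R, G n p) + e n * ∫ t in (0:ℝ)..T, |U n t 0 - c| * deriv (Φ t) 0 := by
    intro n
    have hU := (h.sol n).contDiff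
    have hU1 : ContDiff ℝ 1 (Function.uncurry (U n)) := hU.of_le (by norm_num)
    have hU' : ContDiff ℝ 1 fun p : ℝ × ℝ => U n p.1 p.2 := hU1
    have key := kato_inequality (D := fun t x => U n t x - c)
      (a := fun t x => U n t x ^ 2 + U n t x * c + c ^ 2) (S := spePrimitive (U n)) (Φ := Φ)
      (ε := e n) (τ := T) (R := R) (hU.sub contDiff_const)
      (((hU'.pow 2).add (hU'.mul contDiff_const)).add contDiff_const)
      (continuous_spePrimitive (h.continuous n)) hΦ.contDiff (h.e_pos n).le hT.le hR
      (fun t _ x hx => hΦ.nonneg t x hx.1) hΦ.left hΦ.right hΦ.deriv_right ?_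
    · refine le_trans (intervalIntegral.integral_nonneg hR fun x hx =>
        mul_nonneg (abs_nonneg _) (hΦ.nonneg T x hx.1)) key
    · intro t ht x hx
      have hx' : HasDerivAt (U n t) (deriv (U n t) x) x := hU1.hasDerivAt_right t x
      have d1 : deriv (fun s => U n s x - c) t = deriv (fun s => U n s x) t := by
        rw [deriv_sub_const]
      have d2 : deriv (fun x => U n t x - c) = deriv (U n t) := by
        funext y; rw [deriv_sub_const]
      have d3 : deriv (fun x => U n t x ^ 2 + U n t x * c + c ^ 2) x
          = 2 * U n t x * deriv (U n t) x + deriv (U n t) x * c := by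
        have := (((hx'.fun_pow 2).add (hx'.mul_const c)).add_const (c ^ 2)).deriv
        simpa using this
      have := (h.sol n).pde t ht x hx.1
      rw [d1, d2, d3, ← this]
      ring
  -- passage to the limit
  have cU : ∀ n, Continuous fun p : ℝ × ℝ => U n p.1 p.2 := fun n => h.continuous n
  have hlimR := ae_rect hlim R
  have hcR := ae_rect hc R
  have hPR := ae_rect (h.ae_prod_tendsto_spePrimitive hlim) R
  have lim1 : Tendsto (fun n => ∫ p in Icc 0 T ×ˢ Icc 0 R, G n p) atTop
      (nhds (∫ p in Icc 0 T ×ˢ Icc 0 R, entropyDensity f c Φ p)) := by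
    refine tendsto_setIntegral_of_bounded (measurableSet_rect T R) (measure_rect_ne_top T R)
      (C := A * (B₁ + 3 * A ^ 2 * B₂ + E * B₃) + M * R * B) ?_ ?_ ?_
    · intro n
      have m1 := (cU n).measurable
      have m2 : Measurable fun p : ℝ × ℝ => spePrimitive (U n) p.1 p.2 :=
        (continuous_spePrimitive (h.continuous n)).measurable
      have m3 := cΦ.measurable
      have m4 := cΦx.measurable
      have m5 := cΦt.measurable
      have m6 := cΦxx.measurable
      have m7 : Measurable fun p : ℝ × ℝ => (U n p.1 p.2 - c).sign :=
        measurable_real_sign.comp (m1.sub_const c)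
      apply Measurable.aestronglyMeasurable
      fun_prop
    · intro n p hp
      refine abs_entropyDensity_le (((h.sol n).bound _ hp.1 _ hp.2.1).trans hMA) hcA
        (hUc n _ hp.1 _ hp.2.1) (hB p hp) (hB₁ p hp) (hB₂ p hp) (hB₃ p hp) ?_ (hE n)
      refine ((h.sol n).abs_primitive_le hp.1 hp.2.1).trans ?_
      have := hp.2.2
      gcongr
    · filter_upwards [hlimR, hcR, hPR] with p h1 h2 h3
      have hs := (Real.continuousAt_sign (sub_ne_zero.2 h2)).tendsto.comp (h1.sub_const c)
      have hab := (h1.sub_const c).abs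
      have hq := ((h1.pow 2).add (h1.mul_const c)).add_const (c ^ 2)
      have he := h.e_lim.mul_const (deriv (deriv (Φ p.1)) p.2)
      have := (hab.mul (((hq.mul_const (deriv (Φ p.1) p.2)).const_add
        (deriv (fun s => Φ s p.2) p.1)).add he)).add ((hs.mul h3).mul_const (Φ p.1 p.2))
      simpa [entropyDensity] using this
  have hcont0 : ∀ n, Continuous fun x => U n 0 x := fun n =>
    (cU n).comp (by fun_prop : Continuous fun x : ℝ => ((0:ℝ), x))
  have cΦ0 : Continuous fun x => Φ 0 x := cΦ.comp (by fun_prop : Continuous fun x : ℝ => ((0:ℝ), x))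
  have hu₀i : IntervalIntegrable (fun x => |u₀ x - c|) volume 0 R :=
    intervalIntegrable_of_bounded (M := M + |c|) (by have := h.meas_u₀; fun_prop) (fun x => by
      rw [abs_abs]; exact (abs_sub _ _).trans (add_le_add (h.bound_u₀ x) le_rfl)) 0 R
  have hdi : ∀ n, IntervalIntegrable (fun x => |U n 0 x - u₀ x|) volume 0 R := fun n =>
    (((hcont0 n).intervalIntegrable _ _).sub
      (intervalIntegrable_of_bounded h.meas_u₀ h.bound_u₀ 0 R)).abs
  have init : ∀ n, ∫ x in (0:ℝ)..R, |U n 0 x - c| * Φ 0 x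
      ≤ (∫ x in (0:ℝ)..R, |u₀ x - c| * Φ 0 x) + B * ∫ x in (0:ℝ)..R, |U n 0 x - u₀ x| := by
    intro n
    rw [← intervalIntegral.integral_const_mul, ← intervalIntegral.integral_add
      (hu₀i.mul_continuousOn cΦ0.continuousOn) ((hdi n).const_mul B)]
    refine intervalIntegral.integral_mono_on hR
      (Continuous.intervalIntegrable (by have := hcont0 n; fun_prop) _ _)
      ((hu₀i.mul_continuousOn cΦ0.continuousOn).add ((hdi n).const_mul B)) fun x hx => ?_
    have k1 := abs_sub_le (U n 0 x) (u₀ x) c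
    have k2 := hΦ.nonneg 0 x hx.1
    have k3 := (le_abs_self _).trans (hB (0, x) ⟨⟨le_rfl, hT.le⟩, hx⟩)
    have k4 := abs_nonneg (U n 0 x - u₀ x)
    simp only at k3
    nlinarith
  have bdry : ∀ n, e n * ∫ t in (0:ℝ)..T, |U n t 0 - c| * deriv (Φ t) 0 ≤ e n * (T * (A * B₂)) := by
    intro n
    refine mul_le_mul_of_nonneg_left ?_ (h.e_pos n).le
    have ct : Continuous fun t : ℝ => (t, (0:ℝ)) := by fun_prop
    have c1 : Continuous fun t => U n t 0 := (cU n).comp ct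
    have c2 : Continuous fun t => deriv (Φ t) 0 := cΦx.comp ct
    refine integral_le_mul_of_forall_le hT.le
      (Continuous.intervalIntegrable (by fun_prop) _ _) fun t ht => ?_
    have k1 := hUc n t ht 0 le_rfl
    have k2 := (le_abs_self _).trans (hB₂ (t, 0) ⟨ht, le_rfl, hR⟩)
    exact (mul_le_mul_of_nonneg_left k2 (abs_nonneg _)).trans
      (mul_le_mul_of_nonneg_right k1 hB₂0)
  have lim2 := ((((h.lim_u₀ R hR).const_mul B).const_add
    (∫ x in (0:ℝ)..R, |u₀ x - c| * Φ 0 x)).add lim1).add (h.e_lim.mul_const (T * (A * B₂)))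
  simp only [mul_zero, add_zero, zero_mul] at lim2
  refine ge_of_tendsto' lim2 fun n => ?_
  linarith [kato n, init n, bdry n]

end IsViscousSequence

lemma entropyDensity_eq (f : ℝ × ℝ → ℝ) (c : ℝ) (Φ : ℝ → ℝ → ℝ) (p : ℝ × ℝ) :
    entropyDensity f c Φ p = |f p - c| * (deriv (fun s => Φ s p.2) p.1
      + (f p ^ 2 + f p * c + c ^ 2) * deriv (Φ p.1) p.2 + 0 * 0)
    + (f p - c).sign * spePrimitive (fun t x => f (t, x)) p.1 p.2 * Φ p.1 p.2 := by
  simp [entropyDensity]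

lemma exists_bound_entropyDensity {f : ℝ × ℝ → ℝ} {M : ℝ} (hM : 0 ≤ M) (hfM : ∀ p, |f p| ≤ M)
    {Φ : ℝ → ℝ → ℝ} (hΦ : ContDiff ℝ 2 (Function.uncurry Φ)) (T R C : ℝ) :
    ∃ B, ∀ c, |c| ≤ C → ∀ p ∈ (Icc 0 T ×ˢ Icc 0 R : Set (ℝ × ℝ)),
      |entropyDensity f c Φ p| ≤ B := by
  have hΦx : ContDiff ℝ 1 (Function.uncurry fun t x => deriv (Φ t) x) :=
    hΦ.deriv_right (by norm_num [one_add_one_eq_two])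
  have hΦt : ContDiff ℝ 1 (Function.uncurry fun t x => deriv (fun s => Φ s x) t) :=
    hΦ.deriv_left (by norm_num [one_add_one_eq_two])
  have hK : IsCompact (Icc 0 T ×ˢ Icc 0 R : Set (ℝ × ℝ)) := isCompact_Icc.prod isCompact_Icc
  obtain ⟨B, hB0, hB⟩ := hK.exists_nonneg_bound hΦ.continuous
  obtain ⟨B₁, hB₁0, hB₁⟩ := hK.exists_nonneg_bound hΦt.continuous
  obtain ⟨B₂, hB₂0, hB₂⟩ := hK.exists_nonneg_bound hΦx.continuous
  refine ⟨(M + C) * (B₁ + 3 * (M + C) ^ 2 * B₂ + 0 * 0) + M * R * B, fun c hc p hp => ?_⟩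
  have hC := (abs_nonneg c).trans hc
  rw [entropyDensity_eq]
  refine abs_entropyDensity_le ((hfM p).trans (by linarith)) (by linarith)
    ((abs_sub _ _).trans (add_le_add (hfM p) hc)) (hB p hp) (hB₁ p hp) (hB₂ p hp) (by simp) ?_
    (by simp)
  refine (abs_spePrimitive_le hp.2.1 fun y _ => hfM _).trans ?_
  have := hp.2.2
  gcongr

namespace IsViscousSequence
variable {T M : ℝ} {e : ℕ → ℝ} {U : ℕ → ℝ → ℝ → ℝ} {u₀ g : ℝ → ℝ} {f : ℝ × ℝ → ℝ}

lemma aestronglyMeasurable_entropyDensity (h : IsViscousSequence T M e U u₀ g) (hf : Measurable f)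
    (hlim : ∀ᵐ p ∂(volume.restrict (Ioo 0 T ×ˢ Ioi (0:ℝ))),
        Tendsto (fun n => U n p.1 p.2) atTop (nhds (f p)))
    {Φ : ℝ → ℝ → ℝ} (hΦ : ContDiff ℝ 2 (Function.uncurry Φ)) (c R : ℝ) :
    AEStronglyMeasurable (entropyDensity f c Φ) (volume.restrict (Icc 0 T ×ˢ Icc 0 R)) := by
  have hΦx : ContDiff ℝ 1 (Function.uncurry fun t x => deriv (Φ t) x) :=
    hΦ.deriv_right (by norm_num [one_add_one_eq_two])
  have hΦt : ContDiff ℝ 1 (Function.uncurry fun t x => deriv (fun s => Φ s x) t) :=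
    hΦ.deriv_left (by norm_num [one_add_one_eq_two])
  have m1 : Measurable fun p : ℝ × ℝ => Φ p.1 p.2 := hΦ.continuous.measurable
  have m2 : Measurable fun p : ℝ × ℝ => deriv (Φ p.1) p.2 := hΦx.continuous.measurable
  have m3 : Measurable fun p : ℝ × ℝ => deriv (fun s => Φ s p.2) p.1 := hΦt.continuous.measurable
  have m4 : Measurable fun p : ℝ × ℝ => (f p - c).sign := measurable_real_sign.comp (hf.sub_const c)
  have m5 : AEStronglyMeasurable (fun p : ℝ × ℝ => spePrimitive (fun t x => f (t, x)) p.1 p.2)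
      (volume.restrict (Icc 0 T ×ˢ Icc 0 R)) := by
    rw [volume_restrict_rect, Measure.prod_restrict, ← Measure.volume_eq_prod]
    exact (h.aestronglyMeasurable_spePrimitive hlim).mono_set
      (Set.prod_mono le_rfl Ioc_subset_Ioi_self)
  have m6 : Measurable fun p : ℝ × ℝ => |f p - c| * (deriv (fun s => Φ s p.2) p.1
      + (f p ^ 2 + f p * c + c ^ 2) * deriv (Φ p.1) p.2) := by fun_prop
  exact m6.aestronglyMeasurable.add
    ((m4.aestronglyMeasurable.mul m5).mul m1.aestronglyMeasurable)

lemma integrableOn_entropyDensity (h : IsViscousSequence T M e U u₀ g) (hf : Measurable f)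
    (hfM : ∀ p, |f p| ≤ M) (hlim : ∀ᵐ p ∂(volume.restrict (Ioo 0 T ×ˢ Ioi (0:ℝ))),
        Tendsto (fun n => U n p.1 p.2) atTop (nhds (f p)))
    {Φ : ℝ → ℝ → ℝ} (hΦ : ContDiff ℝ 2 (Function.uncurry Φ)) (c R : ℝ) :
    IntegrableOn (entropyDensity f c Φ) (Icc 0 T ×ˢ Icc 0 R) := by
  obtain ⟨B, hB⟩ := exists_bound_entropyDensity h.M_pos.le hfM hΦ T R |c|
  exact integrableOn_of_forall_le (measurableSet_rect T R) (measure_rect_ne_top T R)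
    (h.aestronglyMeasurable_entropyDensity hf hlim hΦ c R) (hB c le_rfl)

lemma entropy_of_isStripTest (h : IsViscousSequence T M e U u₀ g) (hf : Measurable f)
    (hfM : ∀ p, |f p| ≤ M) (hlim : ∀ᵐ p ∂(volume.restrict (Ioo 0 T ×ˢ Ioi (0:ℝ))),
        Tendsto (fun n => U n p.1 p.2) atTop (nhds (f p)))
    {R : ℝ} {Φ : ℝ → ℝ → ℝ} (hΦ : IsStripTest R Φ) (c : ℝ) :
    0 ≤ (∫ x in (0:ℝ)..R, |u₀ x - c| * Φ 0 x)
      + ∫ p in Icc 0 T ×ˢ Icc 0 R, entropyDensity f c Φ p := by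
  have hR := hΦ.R_nonneg
  set μ := (volume : Measure (ℝ × ℝ)).restrict (Ioo 0 T ×ˢ Ioi (0:ℝ)) with hμ
  have hcount : {c : ℝ | 0 < μ {p | f p = c}}.Countable := Measure.countable_meas_level_set_pos hf
  have hdense := hcount.dense_compl ℝ
  obtain ⟨a, _, ha, hac⟩ := hdense.exists_seq_strictMono_tendsto c
  obtain ⟨b, _, hb, hbc⟩ := hdense.exists_seq_strictAnti_tendsto c
  have hgood : ∀ d ∈ {c : ℝ | 0 < μ {p | f p = c}}ᶜ, ∀ᵐ p ∂μ, f p ≠ d := fun d hd => by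
    simpa [ae_iff] using hd
  obtain ⟨C₁, hC₁⟩ := hac.abs.bddAbove_range
  obtain ⟨C₂, hC₂⟩ := hbc.abs.bddAbove_range
  obtain ⟨B₁, hB₁⟩ := exists_bound_entropyDensity h.M_pos.le hfM hΦ.contDiff T R C₁
  obtain ⟨B₂, hB₂⟩ := exists_bound_entropyDensity h.M_pos.le hfM hΦ.contDiff T R C₂
  have hB₁ := fun n => hB₁ (a n) (hC₁ (mem_range_self n))
  have hB₂ := fun n => hB₂ (b n) (hC₂ (mem_range_self n))
  have hmeas := fun d => h.aestronglyMeasurable_entropyDensity hf hlim hΦ.contDiff d R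
  have h_int := fun d => h.integrableOn_entropyDensity hf hfM hlim hΦ.contDiff d R
  have lim1 : Tendsto (fun n => ∫ p in Icc 0 T ×ˢ Icc 0 R,
      (entropyDensity f (a n) Φ p + entropyDensity f (b n) Φ p)) atTop
      (nhds (∫ p in Icc 0 T ×ˢ Icc 0 R, 2 * entropyDensity f c Φ p)) := by
    refine tendsto_setIntegral_of_bounded (measurableSet_rect T R) (measure_rect_ne_top T R)
      (fun n => (hmeas (a n)).add (hmeas (b n)))
      (fun n p hp => (abs_add_le _ _).trans (add_le_add (hB₁ n p hp) (hB₂ n p hp)))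
      (Eventually.of_forall fun p => ?_)
    have main : ∀ d : ℕ → ℝ, Tendsto d atTop (nhds c) →
        Tendsto (fun n => |f p - d n| * (deriv (fun s => Φ s p.2) p.1
          + (f p ^ 2 + f p * d n + d n ^ 2) * deriv (Φ p.1) p.2)) atTop
        (nhds (|f p - c| * (deriv (fun s => Φ s p.2) p.1
          + (f p ^ 2 + f p * c + c ^ 2) * deriv (Φ p.1) p.2))) := fun d hd =>
      ((Continuous.tendsto (by fun_prop : Continuous fun d : ℝ =>
        |f p - d| * (deriv (fun s => Φ s p.2) p.1
          + (f p ^ 2 + f p * d + d ^ 2) * deriv (Φ p.1) p.2)) c)).comp hd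
    have hsign : Tendsto (fun n => (f p - a n).sign + (f p - b n).sign) atTop
        (nhds (2 * (f p - c).sign)) := by
      by_cases hfc : f p = c
      · have : ∀ n, (f p - a n).sign + (f p - b n).sign = 0 := fun n => by
          have ha' : a n < c := (ha n).1
          have hb' : c < b n := (hb n).1
          rw [Real.sign_of_pos (by linarith), Real.sign_of_neg (by linarith)]
          norm_num
        simp only [this]
        simp [hfc]
      · have hs := (Real.continuousAt_sign (sub_ne_zero.2 hfc)).tendsto
        rw [two_mul]
        exact (hs.comp (hac.const_sub (f p))).add (hs.comp (hbc.const_sub (f p)))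
    have := ((main a hac).add (main b hbc)).add
      ((hsign.mul_const (spePrimitive (fun t x => f (t, x)) p.1 p.2)).mul_const (Φ p.1 p.2))
    refine (this.congr fun n => ?_).trans (le_of_eq ?_)
    · simp only [entropyDensity]; ring
    · simp only [entropyDensity]; congr 1; ring
  have cΦ0 : Continuous fun x => Φ 0 x :=
    hΦ.contDiff.continuous.comp (by fun_prop : Continuous fun x : ℝ => ((0:ℝ), x))
  have iu : ∀ d, IntervalIntegrable (fun x => |u₀ x - d| * Φ 0 x) volume 0 R := fun d =>
    (intervalIntegrable_of_bounded (M := M + |d|) (by have := h.meas_u₀; fun_prop) (fun x => by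
      rw [abs_abs]; exact (abs_sub _ _).trans (add_le_add (h.bound_u₀ x) le_rfl)) 0 R).mul_continuousOn
      cΦ0.continuousOn
  have hlip : ∀ d, ∫ x in (0:ℝ)..R, |u₀ x - d| * Φ 0 x
      ≤ (∫ x in (0:ℝ)..R, |u₀ x - c| * Φ 0 x) + |c - d| * ∫ x in (0:ℝ)..R, Φ 0 x := by
    intro d
    rw [← intervalIntegral.integral_const_mul, ← intervalIntegral.integral_add (iu c)
      ((cΦ0.intervalIntegrable _ _).const_mul _)]
    refine intervalIntegral.integral_mono_on hR (iu d)
      ((iu c).add ((cΦ0.intervalIntegrable _ _).const_mul _)) fun x hx => ?_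
    rw [← add_mul]
    exact mul_le_mul_of_nonneg_right (abs_sub_le _ _ _) (hΦ.nonneg 0 x hx.1)
  set I := ∫ x in (0:ℝ)..R, |u₀ x - c| * Φ 0 x with hI
  set J := ∫ x in (0:ℝ)..R, Φ 0 x with hJ
  have lim2 := (((((hac.const_sub c).abs.add (hbc.const_sub c).abs)).mul_const J).const_add
    (2 * I)).add lim1
  have hpos : 0 ≤ 2 * I + ∫ p in Icc 0 T ×ˢ Icc 0 R, 2 * entropyDensity f c Φ p := by
    rw [sub_self, abs_zero, add_zero, zero_mul, add_zero] at lim2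
    refine ge_of_tendsto' lim2 fun n => ?_
    have e1 := h.entropy_of_null hlim hΦ (hgood _ (ha n).2)
    have e2 := h.entropy_of_null hlim hΦ (hgood _ (hb n).2)
    have e3 := integral_add (h_int (a n)) (h_int (b n))
    linarith [hlip (a n), hlip (b n)]
  rw [integral_const_mul] at hpos
  linarith

end IsViscousSequence
end entropy

section boundary

lemma integral_mul_exp_layer_le {m : ℝ} (hm : 0 < m) {R : ℝ} (hR : 0 ≤ R) :
    ∫ x in (0:ℝ)..R, x * (m * Real.exp (-(m * x))) ≤ 1 / m := by
  have hd : ∀ x, HasDerivAt (fun x => -((x + 1 / m) * Real.exp (-(m * x))))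
      (x * (m * Real.exp (-(m * x)))) x := fun x => by
    have := (((hasDerivAt_id x).add_const (1 / m)).fun_mul
      ((hasDerivAt_id x).const_mul m).fun_neg.exp).fun_neg
    exact this.congr_deriv (by simp; field_simp; ring)
  rw [intervalIntegral.integral_eq_sub_of_hasDerivAt (fun x _ => hd x)
    (Continuous.intervalIntegrable (by fun_prop) _ _)]
  have : 0 ≤ (R + 1 / m) * Real.exp (-(m * R)) := by positivity
  simp at this ⊢
  linarith

namespace IsViscousSequence
variable {T M : ℝ} {e : ℕ → ℝ} {U : ℕ → ℝ → ℝ → ℝ} {u₀ g : ℝ → ℝ} {f : ℝ × ℝ → ℝ}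

lemma entropy_exp_layer (h : IsViscousSequence T M e U u₀ g) (hf : Measurable f)
    (hfM : ∀ p, |f p| ≤ M) (hlim : ∀ᵐ p ∂(volume.restrict (Ioo 0 T ×ˢ Ioi (0:ℝ))),
        Tendsto (fun n => U n p.1 p.2) atTop (nhds (f p)))
    {φ : ℝ → ℝ → ℝ} {R : ℝ} (hR : 0 ≤ R) (hφ : ContDiff ℝ 2 (Function.uncurry φ))
    (hφ0 : ∀ t x, 0 ≤ φ t x) (hφR : ∀ t, φ t R = 0) (hφR' : ∀ t, deriv (φ t) R = 0)
    (c : ℝ) {m : ℝ} (hm : 0 < m) :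
    0 ≤ (∫ x in (0:ℝ)..R, |u₀ x - c| * φ 0 x)
      + (∫ p in Icc 0 T ×ˢ Icc 0 R, (1 - Real.exp (-(m * p.2))) * entropyDensity f c φ p)
      + ∫ p in Icc 0 T ×ˢ Icc 0 R,
          |f p ^ 3 - c ^ 3| * φ p.1 p.2 * (m * Real.exp (-(m * p.2))) := by
  have hφ1 : ContDiff ℝ 1 (Function.uncurry φ) := hφ.of_le (by norm_num)
  have cφ : Continuous fun p : ℝ × ℝ => φ p.1 p.2 := hφ.continuous
  set Φ : ℝ → ℝ → ℝ := fun t x => φ t x * (1 - Real.exp (-(m * x))) with hΦ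
  have he : ∀ x, HasDerivAt (fun x => 1 - Real.exp (-(m * x))) (m * Real.exp (-(m * x))) x :=
    fun x => by
      have := (((hasDerivAt_id x).const_mul m).fun_neg.exp).const_sub 1
      exact this.congr_deriv (by simp; ring)
  have dt : ∀ t x, deriv (fun s => Φ s x) t
      = deriv (fun s => φ s x) t * (1 - Real.exp (-(m * x))) := fun t x => by
    rw [hΦ]; exact deriv_mul_const_field _
  have dx : ∀ t x, deriv (Φ t) x = deriv (φ t) x * (1 - Real.exp (-(m * x)))
      + φ t x * (m * Real.exp (-(m * x))) := fun t x =>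
    ((hφ1.hasDerivAt_right t x).mul (he x)).deriv
  have e_le : ∀ x, 0 ≤ x → Real.exp (-(m * x)) ≤ 1 := fun x hx =>
    Real.exp_le_one_iff.2 (by have := mul_nonneg hm.le hx; linarith)
  have test : IsStripTest R Φ :=
    { R_nonneg := hR
      contDiff := by
        have : ContDiff ℝ 2 fun p : ℝ × ℝ => φ p.1 p.2 := hφ
        have h2 : ContDiff ℝ 2 fun p : ℝ × ℝ => 1 - Real.exp (-(m * p.2)) := by fun_prop
        exact this.mul h2
      nonneg := fun t x hx => mul_nonneg (hφ0 t x) (sub_nonneg.2 (e_le x hx))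
      left := fun t => by simp [hΦ]
      right := fun t => by simp [hΦ, hφR]
      deriv_right := fun t => by simp [dx, hφR, hφR'] }
  have key := h.entropy_of_isStripTest hf hfM hlim test c
  have hden : ∀ p, entropyDensity f c Φ p = (1 - Real.exp (-(m * p.2))) * entropyDensity f c φ p
      + |f p ^ 3 - c ^ 3| * φ p.1 p.2 * (m * Real.exp (-(m * p.2))) := fun p => by
    simp only [entropyDensity, dt, dx, ← quadratic_mul_abs_sub]
    simp only [hΦ]
    ring
  have hED := h.integrableOn_entropyDensity hf hfM hlim hφ c R
  have hK : IsCompact (Icc 0 T ×ˢ Icc 0 R : Set (ℝ × ℝ)) := isCompact_Icc.prod isCompact_Icc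
  have i1 : IntegrableOn (fun p : ℝ × ℝ => (1 - Real.exp (-(m * p.2))) * entropyDensity f c φ p)
      (Icc 0 T ×ˢ Icc 0 R) :=
    hED.continuousOn_mul (Continuous.continuousOn (by fun_prop)) hK
  have i2 : IntegrableOn (fun p : ℝ × ℝ =>
      |f p ^ 3 - c ^ 3| * φ p.1 p.2 * (m * Real.exp (-(m * p.2)))) (Icc 0 T ×ˢ Icc 0 R) := by
    have : IntegrableOn (fun p : ℝ × ℝ => |f p ^ 3 - c ^ 3|) (Icc 0 T ×ˢ Icc 0 R) :=
      integrableOn_of_forall_le (C := M ^ 3 + |c| ^ 3) (measurableSet_rect T R)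
        (measure_rect_ne_top T R) (Measurable.aestronglyMeasurable (by fun_prop)) fun p _ => by
          rw [abs_abs]
          refine (abs_sub _ _).trans ?_
          rw [abs_pow, abs_pow]
          have := hfM p
          gcongr
    exact (this.mul_continuousOn cφ.continuousOn hK).mul_continuousOn
      (Continuous.continuousOn (by fun_prop)) hK
  rw [setIntegral_congr_fun (measurableSet_rect T R) (fun p _ => hden p),
    integral_add i1 i2] at key
  have iu : IntervalIntegrable (fun x => |u₀ x - c|) volume 0 R :=
    intervalIntegrable_of_bounded (M := M + |c|) (by have := h.meas_u₀; fun_prop) (fun x => by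
      rw [abs_abs]; exact (abs_sub _ _).trans (add_le_add (h.bound_u₀ x) le_rfl)) 0 R
  have c0 : Continuous fun x => φ 0 x :=
    cφ.comp (by fun_prop : Continuous fun x : ℝ => ((0:ℝ), x))
  have init : ∫ x in (0:ℝ)..R, |u₀ x - c| * Φ 0 x ≤ ∫ x in (0:ℝ)..R, |u₀ x - c| * φ 0 x := by
    refine intervalIntegral.integral_mono_on hR
      (iu.mul_continuousOn (Continuous.continuousOn (by fun_prop)))
      (iu.mul_continuousOn c0.continuousOn) fun x hx => ?_
    have := Real.exp_pos (-(m * x))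
    exact mul_le_mul_of_nonneg_left (mul_le_of_le_one_right (hφ0 0 x) (by linarith))
      (abs_nonneg _)
  linarith

/-- The entropy inequality up to the boundary, with the strong trace as boundary value. -/
lemma entropy_of_trace (h : IsViscousSequence T M e U u₀ g) (hf : Measurable f)
    (hfM : ∀ p, |f p| ≤ M) (hlim : ∀ᵐ p ∂(volume.restrict (Ioo 0 T ×ˢ Ioi (0:ℝ))),
        Tendsto (fun n => U n p.1 p.2) atTop (nhds (f p)))
    {φ : ℝ → ℝ → ℝ} {R : ℝ} (hR : 0 ≤ R) (hφ : ContDiff ℝ 2 (Function.uncurry φ))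
    (hφ0 : ∀ t x, 0 ≤ φ t x) (hφR : ∀ t, φ t R = 0) (hφR' : ∀ t, deriv (φ t) R = 0) (c : ℝ) :
    0 ≤ (∫ x in (0:ℝ)..R, |u₀ x - c| * φ 0 x)
      + (∫ p in Icc 0 T ×ˢ Icc 0 R, entropyDensity f c φ p)
      + ∫ t in Ioo 0 T, |g t ^ 3 - c ^ 3| * φ t 0 := by
  have hM := h.M_pos
  have hT := h.T_pos
  obtain ⟨N, -, hN, htr⟩ := h.exists_trace hf hfM hlim
  have hφ1 : ContDiff ℝ 1 (Function.uncurry φ) := hφ.of_le (by norm_num)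
  have cφ : Continuous fun p : ℝ × ℝ => φ p.1 p.2 := hφ.continuous
  have hφx : ContDiff ℝ 1 (Function.uncurry fun t x => deriv (φ t) x) :=
    hφ.deriv_right (by norm_num [one_add_one_eq_two])
  have hK : IsCompact (Icc 0 T ×ˢ Icc 0 R : Set (ℝ × ℝ)) := isCompact_Icc.prod isCompact_Icc
  obtain ⟨B, hB0, hB⟩ := hK.exists_nonneg_bound cφ
  obtain ⟨B₂, hB₂0, hB₂⟩ := hK.exists_nonneg_bound hφx.continuous
  obtain ⟨E, hE⟩ := exists_bound_entropyDensity hM.le hfM hφ T R |c|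
  have hE := hE c le_rfl
  have mg := h.meas_g
  set C := M ^ 3 + |c| ^ 3 with hC
  have hC0 : 0 ≤ C := by positivity
  have cube : ∀ {a : ℝ}, |a| ≤ M → |a ^ 3 - c ^ 3| ≤ C := fun {a} ha => by
    refine (abs_sub _ _).trans ?_
    rw [abs_pow, abs_pow, hC]
    gcongr
  have lip : ∀ t ∈ Icc 0 T, ∀ x ∈ Icc 0 R, φ t x ≤ φ t 0 + B₂ * x := by
    intro t ht x hx
    have := (convex_Icc 0 R).norm_image_sub_le_of_norm_hasDerivWithin_le
      (f := φ t) (f' := deriv (φ t)) (C := B₂) (x := 0) (y := x)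
      (fun y hy => (hφ1.hasDerivAt_right t y).hasDerivWithinAt)
      (fun y hy => hB₂ (t, y) ⟨ht, hy⟩) (left_mem_Icc.2 hR) hx
    rw [sub_zero, Real.norm_eq_abs, Real.norm_of_nonneg hx.1] at this
    linarith [le_abs_self (φ t x - φ t 0)]
  set I : ℝ → ℝ := fun x => ∫ t in Ioo 0 T, |f (t, x) - g t| with hI
  set J : ℝ → ℝ := fun x => ∫ t in Ioo 0 T, |f (t, x) ^ 3 - c ^ 3| * φ t x with hJ
  set J₀ := ∫ t in Ioo 0 T, |g t ^ 3 - c ^ 3| * φ t 0 with hJ₀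
  have hJ₀0 : 0 ≤ J₀ := integral_nonneg fun t => mul_nonneg (abs_nonneg _) (hφ0 _ _)
  have mx : ∀ x, Measurable fun t => f (t, x) := fun x =>
    hf.comp (measurable_id.prodMk measurable_const)
  have mφ : ∀ x, Measurable fun t => φ t x := fun x =>
    (cφ.comp (by fun_prop : Continuous fun t : ℝ => (t, x))).measurable
  have iI : ∀ x, IntegrableOn (fun t => |f (t, x) - g t|) (Ioo 0 T) := fun x =>
    integrableOn_of_forall_le (C := M + M) measurableSet_Ioo (by simp)
      (Measurable.aestronglyMeasurable (by have := mx x; fun_prop)) fun t _ => by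
        rw [abs_abs]
        exact (abs_sub _ _).trans (add_le_add (hfM _) (h.bound_g t))
  have hIb : ∀ x, I x ≤ 2 * M * T := fun x => by
    have := setIntegral_mono_on (iI x) (integrableOn_const (C := 2 * M) (by simp))
      measurableSet_Ioo fun t _ => (abs_sub _ _).trans
        ((add_le_add (hfM (t, x)) (h.bound_g t)).trans (two_mul M).ge)
    rw [setIntegral_const] at this
    simp only [measureReal_def, Real.volume_Ioo, sub_zero, ENNReal.toReal_ofReal hT.le,
      smul_eq_mul] at this
    linarith
  have hJle : ∀ x ∈ Icc 0 R, J x ≤ J₀ + 3 * M ^ 2 * B * I x + C * B₂ * T * x := by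
    intro x hx
    have i1 : IntegrableOn (fun t => |g t ^ 3 - c ^ 3| * φ t 0) (Ioo 0 T) :=
      integrableOn_of_forall_le (C := C * B) measurableSet_Ioo (by simp)
        (Measurable.aestronglyMeasurable (by have := mφ 0; fun_prop)) fun t ht => by
          rw [abs_mul, abs_abs]
          exact mul_le_mul (cube (h.bound_g t)) (hB (t, 0) ⟨Ioo_subset_Icc_self ht, le_rfl, hR⟩)
            (abs_nonneg _) hC0
    have i2 : IntegrableOn (fun t => |f (t, x) ^ 3 - c ^ 3| * φ t x) (Ioo 0 T) :=
      integrableOn_of_forall_le (C := C * B) measurableSet_Ioo (by simp)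
        (Measurable.aestronglyMeasurable (by have := mφ x; have := mx x; fun_prop)) fun t ht => by
          rw [abs_mul, abs_abs]
          exact mul_le_mul (cube (hfM _)) (hB (t, x) ⟨Ioo_subset_Icc_self ht, hx⟩)
            (abs_nonneg _) hC0
    have i3 : IntegrableOn (fun _ : ℝ => C * (B₂ * x)) (Ioo 0 T) := integrableOn_const (by simp)
    have i4 := i1.add ((iI x).const_mul (3 * M ^ 2 * B))
    have := setIntegral_mono_on i2 (i4.add i3) measurableSet_Ioo fun t ht => by
      have ht' := Ioo_subset_Icc_self ht
      have k1 := lip t ht' x hx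
      have k2 : |f (t, x) ^ 3 - c ^ 3| ≤ |f (t, x) ^ 3 - g t ^ 3| + |g t ^ 3 - c ^ 3| :=
        abs_sub_le _ _ _
      have k3 : |f (t, x) ^ 3 - g t ^ 3| ≤ 3 * M ^ 2 * |f (t, x) - g t| := by
        rw [← quadratic_mul_abs_sub]
        exact mul_le_mul_of_nonneg_right (quadratic_le (hfM _) (h.bound_g t)) (abs_nonneg _)
      have k4 := (le_abs_self _).trans (hB (t, 0) ⟨ht', le_rfl, hR⟩)
      have k5 := hφ0 t 0
      have k6 := cube (hfM (t, x))
      have k7 : 0 ≤ B₂ * x := mul_nonneg hB₂0 hx.1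
      calc |f (t, x) ^ 3 - c ^ 3| * φ t x
          ≤ |f (t, x) ^ 3 - c ^ 3| * (φ t 0 + B₂ * x) :=
            mul_le_mul_of_nonneg_left k1 (abs_nonneg _)
        _ = |f (t, x) ^ 3 - c ^ 3| * φ t 0 + |f (t, x) ^ 3 - c ^ 3| * (B₂ * x) := by ring
        _ ≤ (|f (t, x) ^ 3 - g t ^ 3| + |g t ^ 3 - c ^ 3|) * φ t 0 + C * (B₂ * x) := by gcongr
        _ = |g t ^ 3 - c ^ 3| * φ t 0 + |f (t, x) ^ 3 - g t ^ 3| * φ t 0 + C * (B₂ * x) := by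
            ring
        _ ≤ |g t ^ 3 - c ^ 3| * φ t 0 + 3 * M ^ 2 * |f (t, x) - g t| * B + C * (B₂ * x) := by
            gcongr
        _ = _ := by simp only [Pi.add_apply]; ring
    have s1 := integral_add i4 i3
    have s2 := integral_add i1 ((iI x).const_mul (3 * M ^ 2 * B))
    simp only [Pi.add_apply] at s1 s2 this
    rw [s1, s2, integral_const_mul, setIntegral_const] at this
    simp only [measureReal_def, Real.volume_Ioo, sub_zero, ENNReal.toReal_ofReal hT.le,
      smul_eq_mul] at this
    linarith
  -- the boundary layer concentrates on the trace
  have layer : ∀ η > 0, ∃ D, 0 ≤ D ∧ ∀ m > 0, ∫ p in Icc 0 T ×ˢ Icc 0 R,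
      |f p ^ 3 - c ^ 3| * φ p.1 p.2 * (m * Real.exp (-(m * p.2))) ≤ J₀ + η + D * (1 / m) := by
    intro η hη
    rw [Metric.tendsto_nhdsWithin_nhds] at htr
    set K := 3 * M ^ 2 * B + 1 with hKdef
    have hK0 : 0 < K := by positivity
    obtain ⟨δ, hδ, hδI⟩ := htr (η / K) (by positivity)
    refine ⟨K * (2 * M * T) / δ + C * B₂ * T, by positivity, fun m hm => ?_⟩
    set D := K * (2 * M * T) / δ + C * B₂ * T with hD
    have hJb : ∀ x ∈ Icc 0 R, 0 < x → x ∉ N → J x ≤ J₀ + η + D * x := by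
      intro x hx hx0 hxN
      have h1 := hJle x hx
      have hI0 : 0 ≤ I x := integral_nonneg fun _ => abs_nonneg _
      have h2 : 3 * M ^ 2 * B * I x ≤ K * I x := by gcongr; linarith
      have h3 : K * I x ≤ η + K * (2 * M * T) / δ * x := by
        rcases lt_or_ge x δ with hlt | hge
        · have := hδI ⟨hx0, hxN⟩ (by rwa [Real.dist_eq, sub_zero, abs_of_pos hx0])
          rw [Real.dist_eq, sub_zero, abs_of_nonneg hI0, lt_div_iff₀ hK0] at this
          have : 0 ≤ K * (2 * M * T) / δ * x := by positivity
          linarith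
        · have k1 : K * I x ≤ K * (2 * M * T) := mul_le_mul_of_nonneg_left (hIb x) hK0.le
          have k2 : K * (2 * M * T) ≤ K * (2 * M * T) / δ * x := by
            rw [div_mul_eq_mul_div, le_div_iff₀ hδ]
            gcongr
          linarith
      rw [hD]
      linarith
    have int : IntegrableOn (fun p : ℝ × ℝ =>
        |f p ^ 3 - c ^ 3| * φ p.1 p.2 * (m * Real.exp (-(m * p.2)))) (Icc 0 T ×ˢ Icc 0 R) := by
      have : IntegrableOn (fun p : ℝ × ℝ => |f p ^ 3 - c ^ 3|) (Icc 0 T ×ˢ Icc 0 R) :=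
        integrableOn_of_forall_le (C := C) (measurableSet_rect T R)
          (measure_rect_ne_top T R) (Measurable.aestronglyMeasurable (by fun_prop)) fun p _ => by
            rw [abs_abs]
            exact cube (hfM p)
      exact (this.mul_continuousOn cφ.continuousOn hK).mul_continuousOn
        (Continuous.continuousOn (by fun_prop)) hK
    have intJ : IntegrableOn (fun x => J x * (m * Real.exp (-(m * x)))) (Ioc 0 R) := by
      rw [IntegrableOn, volume_restrict_rect] at int
      refine (int.integral_prod_right).congr (Eventually.of_forall fun x => ?_)
      simp only [hJ]
      rw [integral_mul_const]
    rw [integral_rect_symm int]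
    have e1 : ∀ x, ∫ t in Ioo 0 T, |f (t, x) ^ 3 - c ^ 3| * φ t x * (m * Real.exp (-(m * x)))
        = J x * (m * Real.exp (-(m * x))) := fun x => by rw [hJ, integral_mul_const]
    simp only [e1]
    have i5 : IntegrableOn (fun x => (J₀ + η) * (m * Real.exp (-(m * x)))) (Ioc 0 R) :=
      (intervalIntegrable_iff_integrableOn_Ioc_of_le hR).1
        (Continuous.intervalIntegrable (by fun_prop) _ _)
    have i6 : IntegrableOn (fun x => D * (x * (m * Real.exp (-(m * x))))) (Ioc 0 R) :=
      (intervalIntegrable_iff_integrableOn_Ioc_of_le hR).1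
        (Continuous.intervalIntegrable (by fun_prop) _ _)
    have hNae : ∀ᵐ x ∂(volume : Measure ℝ).restrict (Ioc 0 R), x ∉ N :=
      ae_restrict_of_ae (measure_eq_zero_iff_ae_notMem.1 hN)
    have step := integral_mono_ae intJ (i5.add i6) (by
      filter_upwards [hNae, ae_restrict_mem measurableSet_Ioc] with x hxN hx
      have := hJb x (Ioc_subset_Icc_self hx) hx.1 hxN
      have hw : 0 ≤ m * Real.exp (-(m * x)) := by positivity
      have := mul_le_mul_of_nonneg_right this hw
      simp only [Pi.add_apply]
      linarith)
    have s := integral_add i5 i6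
    simp only [Pi.add_apply] at s step
    rw [s, integral_const_mul (J₀ + η) fun x => m * Real.exp (-(m * x)),
      integral_const_mul D fun x => x * (m * Real.exp (-(m * x)))] at step
    have l1 : ∫ x in (0:ℝ)..R, m * Real.exp (-(m * x)) ≤ 1 := by
      rw [intervalIntegral.integral_const_mul, mul_comm]
      exact (le_div_iff₀ hm).1 (integral_exp_layer_le hm)
    have l2 := integral_mul_exp_layer_le hm hR
    rw [intervalIntegral.integral_of_le hR] at l1 l2
    have hD0 : 0 ≤ D := by positivity
    have l3 : (J₀ + η) * ∫ x in Ioc 0 R, m * Real.exp (-(m * x)) ≤ (J₀ + η) * 1 :=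
      mul_le_mul_of_nonneg_left l1 (by linarith)
    have l4 := mul_le_mul_of_nonneg_left l2 hD0
    linarith
  have hED := h.aestronglyMeasurable_entropyDensity hf hlim hφ c R
  have hpos : ∀ᵐ p ∂(volume : Measure (ℝ × ℝ)).restrict (Icc 0 T ×ˢ Icc 0 R), 0 < p.2 := by
    refine ae_rect (p := fun p => 0 < p.2) ?_ R
    filter_upwards [ae_restrict_mem (measurableSet_Ioo.prod measurableSet_Ioi)] with p hp
    exact hp.2
  have hmlim : Tendsto (fun k : ℕ => (k:ℝ) + 1) atTop atTop :=
    tendsto_atTop_add_const_right _ _ tendsto_natCast_atTop_atTop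
  have lim : Tendsto (fun k : ℕ => ∫ p in Icc 0 T ×ˢ Icc 0 R,
      (1 - Real.exp (-(((k:ℝ) + 1) * p.2))) * entropyDensity f c φ p) atTop
      (nhds (∫ p in Icc 0 T ×ˢ Icc 0 R, entropyDensity f c φ p)) := by
    refine tendsto_setIntegral_of_bounded (measurableSet_rect T R) (measure_rect_ne_top T R)
      (C := E) (fun k => ?_) (fun k p hp => ?_) ?_
    · exact (Continuous.aestronglyMeasurable (by fun_prop)).mul hED
    · have k1 : Real.exp (-(((k:ℝ) + 1) * p.2)) ≤ 1 :=
        Real.exp_le_one_iff.2 (by have := mul_nonneg (by positivity : (0:ℝ) ≤ k + 1) hp.2.1; linarith)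
      have k2 := Real.exp_pos (-(((k:ℝ) + 1) * p.2))
      rw [abs_mul, abs_of_nonneg (sub_nonneg.2 k1)]
      exact (mul_le_of_le_one_left (abs_nonneg _) (by linarith)).trans (hE p hp)
    · filter_upwards [hpos] with p hp
      have := (Real.tendsto_exp_neg_atTop_nhds_zero.comp (hmlim.atTop_mul_const hp))
      have := (this.const_sub 1).mul_const (entropyDensity f c φ p)
      simpa using this
  refine le_of_forall_pos_le_add fun η hη => ?_
  obtain ⟨D, hD0, hD⟩ := layer η hη
  have lim2 := ((lim.const_add (∫ x in (0:ℝ)..R, |u₀ x - c| * φ 0 x)).add_const (J₀ + η)).add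
    ((tendsto_one_div_add_atTop_nhds_zero_nat (𝕜 := ℝ)).const_mul D)
  rw [mul_zero, add_zero, ← add_assoc] at lim2
  refine ge_of_tendsto' lim2 fun k => ?_
  have hk : (0:ℝ) < k + 1 := by positivity
  have k1 := h.entropy_exp_layer hf hfM hlim hR hφ hφ0 hφR hφR' c hk
  have k2 := hD _ hk
  linarith

end IsViscousSequence
end boundary

section wild

lemma Real.sign_sub_mul_cube_sub (a c : ℝ) : (a - c).sign * (a ^ 3 - c ^ 3) = |a ^ 3 - c ^ 3| := by
  rcases lt_trichotomy a c with h | h | h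
  · have : a ^ 3 ≤ c ^ 3 := (Odd.strictMono_pow (by decide : Odd 3)).monotone h.le
    rw [Real.sign_of_neg (by linarith), abs_of_nonpos (by linarith)]
    ring
  · simp [h]
  · have : c ^ 3 ≤ a ^ 3 := (Odd.strictMono_pow (by decide : Odd 3)).monotone h.le
    rw [Real.sign_of_pos (by linarith), abs_of_nonneg (by linarith)]
    ring

/-- There is a measurable function which is not integrable on any open interval. -/
lemma exists_measurable_not_integrableOn :
    ∃ H : ℝ → ℝ, Measurable H ∧ ∀ a b : ℝ, a < b → ¬ IntegrableOn H (Ioo a b) := by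
  obtain ⟨q, hq⟩ := exists_surjective_nat ℚ
  set s : ℕ → Set ℝ := fun n => Metric.ball (q n : ℝ) ((1 / 2) ^ n) with hs
  set F : ℕ → ℝ → ENNReal := fun n => (s n).indicator fun x => ENNReal.ofReal |(x - q n)⁻¹| with hF
  have hFm : ∀ n, Measurable (F n) := fun n =>
    Measurable.indicator (by fun_prop) Metric.isOpen_ball.measurableSet
  have hfin : ∀ᵐ x : ℝ, {n | x ∈ s n}.Finite := by
    apply ae_finite_setOfPred_mem
    have : ∀ n, volume (s n) = ENNReal.ofReal (2 * (1 / 2) ^ n) := fun n => by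
      rw [hs, Real.volume_ball]
    simp only [this]
    exact (summable_geometric_two.mul_left 2).tsum_ofReal_ne_top
  set H : ℝ → ℝ := fun x => (∑' n, F n x).toReal with hH
  have hsum : ∀ᵐ x : ℝ, ∑' n, F n x ≠ ⊤ := by
    filter_upwards [hfin] with x hx
    rw [tsum_eq_sum (s := hx.toFinset) fun n hn => by
      simp only [Finite.mem_toFinset, mem_ofPred_eq] at hn
      exact indicator_of_notMem hn _]
    refine ENNReal.sum_ne_top.2 fun n _ => ?_
    simp only [hF, indicator]
    split_ifs <;> simp
  refine ⟨H, (Measurable.tsum hFm).ennreal_toReal, fun a b hab h_int => ?_⟩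
  obtain ⟨r, har, hrb⟩ := exists_rat_btwn hab
  obtain ⟨n, rfl⟩ := hq r
  set d := min (b - q n) ((1 / 2) ^ n) with hd
  have hd0 : 0 < d := lt_min (by linarith) (by positivity)
  have hsub : Ioo (q n : ℝ) (q n + d) ⊆ Ioo a b := fun x hx =>
    ⟨har.trans hx.1, by have := min_le_left (b - q n) ((1 / 2 : ℝ) ^ n); linarith [hx.2]⟩
  have key : IntegrableOn (fun x : ℝ => (x - q n)⁻¹) (Ioo (q n : ℝ) (q n + d)) := by
    refine Integrable.mono' (h_int.mono_set hsub)
      (Measurable.aestronglyMeasurable (by fun_prop)) ?_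
    filter_upwards [ae_restrict_of_ae hsum, ae_restrict_mem measurableSet_Ioo] with x hx hxI
    have hxs : x ∈ s n := by
      rw [hs, Metric.mem_ball, Real.dist_eq, abs_of_pos (by linarith [hxI.1])]
      have := min_le_right (b - q n) ((1 / 2 : ℝ) ^ n)
      linarith [hxI.2]
    have h1 : F n x ≤ ∑' n, F n x := ENNReal.le_tsum n
    have h2 := ENNReal.toReal_mono hx h1
    simpa [hF, hxs, hH] using h2
  have := (intervalIntegrable_iff_integrableOn_Ioo_of_le (by linarith)).2 key
  rw [intervalIntegrable_sub_inv_iff] at this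
  rcases this with h | h
  · linarith
  · exact h left_mem_uIcc

lemma exists_le_mul_cube_sub {κ B : ℝ} (hκ : 0 < κ) (hB : 0 ≤ B) :
    ∃ K, ∀ h : ℝ, 0 ≤ h → h ≤ κ * h ^ 3 - B * h + K := by
  refine ⟨(B + 1) * ((B + 1) / κ + 1), fun h hh => ?_⟩
  set L := (B + 1) / κ with hL
  have hL0 : 0 < L := by positivity
  have hκL : κ * L = B + 1 := by rw [hL]; field_simp
  rcases le_total L (h ^ 2) with h1 | h1
  · have : κ * L * h ≤ κ * h ^ 2 * h := by gcongr
    have : 0 ≤ (B + 1) * (L + 1) := by positivity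
    nlinarith
  · have h2 : h ≤ L + 1 := by nlinarith
    have : (B + 1) * h ≤ (B + 1) * (L + 1) := by gcongr
    have : 0 ≤ κ * h ^ 3 := by positivity
    nlinarith

end wild

section extension

/-- Nonnegative `C²` functions of `(t, x)` vanishing when `t > L - 1` or `x > L - 1`. -/
structure IsQuadrantTest (L : ℝ) (φ : ℝ → ℝ → ℝ) : Prop where
  contDiff : ContDiff ℝ 2 (Function.uncurry φ)
  nonneg : ∀ t x, 0 ≤ φ t x
  zero_left : ∀ t x, L - 1 < t → φ t x = 0
  zero_right : ∀ t x, L - 1 < x → φ t x = 0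

lemma exists_isQuadrantTest {φ : ℝ → ℝ → ℝ} (hφ : ContDiff ℝ 2 (Function.uncurry φ))
    (hs : HasCompactSupport (Function.uncurry φ)) (hφ0 : ∀ t x, 0 ≤ φ t x) (T : ℝ) :
    ∃ L, 0 < L ∧ T < L ∧ IsQuadrantTest L φ := by
  obtain ⟨r, hr⟩ := hs.isCompact.isBounded.subset_closedBall (0 : ℝ × ℝ)
  have key : ∀ t x, φ t x ≠ 0 → |t| ≤ r ∧ |x| ≤ r := fun t x hne => by
    have : (t, x) ∈ Metric.closedBall (0 : ℝ × ℝ) r := hr (subset_tsupport _ hne)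
    rw [mem_closedBall_zero_iff, Prod.norm_def, max_le_iff] at this
    exact this
  have m1 := le_max_left (r + 1) (max (T + 1) 1)
  have m2 := le_max_right (r + 1) (max (T + 1) 1)
  have m3 := le_max_left (T + 1) 1
  have m4 := le_max_right (T + 1) 1
  refine ⟨max (r + 1) (max (T + 1) 1), by linarith, by linarith, hφ, hφ0, fun t x ht => ?_,
    fun t x hx => ?_⟩
  · by_contra hne
    linarith [(key t x hne).1, le_abs_self t]
  · by_contra hne
    linarith [(key t x hne).2, le_abs_self x]

namespace IsQuadrantTest
variable {L : ℝ} {φ : ℝ → ℝ → ℝ}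

lemma continuous (h : IsQuadrantTest L φ) : Continuous fun p : ℝ × ℝ => φ p.1 p.2 :=
  h.contDiff.continuous

lemma contDiff_one (h : IsQuadrantTest L φ) : ContDiff ℝ 1 (Function.uncurry φ) :=
  h.contDiff.of_le (by norm_num)

lemma continuous_deriv_left (h : IsQuadrantTest L φ) :
    Continuous fun p : ℝ × ℝ => deriv (fun s => φ s p.2) p.1 :=
  (h.contDiff.deriv_left (m := 1) (by norm_num [one_add_one_eq_two])).continuous

lemma continuous_deriv_right (h : IsQuadrantTest L φ) :
    Continuous fun p : ℝ × ℝ => deriv (φ p.1) p.2 :=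
  (h.contDiff.deriv_right (m := 1) (by norm_num [one_add_one_eq_two])).continuous

lemma deriv_zero_left (h : IsQuadrantTest L φ) {t : ℝ} (ht : L - 1 < t) (x : ℝ) :
    deriv (fun s => φ s x) t = 0 ∧ deriv (φ t) x = 0 := by
  constructor
  · have : (fun s => φ s x) =ᶠ[nhds t] fun _ => 0 := by
      filter_upwards [Ioi_mem_nhds ht] with s hs using h.zero_left s x hs
    rw [this.deriv_eq, deriv_const]
  · have : φ t = fun _ => 0 := funext fun x => h.zero_left t x ht
    rw [this, deriv_const]

lemma deriv_zero_right (h : IsQuadrantTest L φ) (t : ℝ) {x : ℝ} (hx : L - 1 < x) :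
    deriv (fun s => φ s x) t = 0 ∧ deriv (φ t) x = 0 := by
  constructor
  · have : (fun s => φ s x) = fun _ => 0 := funext fun s => h.zero_right s x hx
    rw [this, deriv_const]
  · have : φ t =ᶠ[nhds x] fun _ => 0 := by
      filter_upwards [Ioi_mem_nhds hx] with y hy using h.zero_right t y hy
    rw [this.deriv_eq, deriv_const]

lemma exists_abs_integral_deriv_ge (h : IsQuadrantTest L φ) {T t₀ x₀ : ℝ}
    (ht₀ : T < t₀) (hx₀ : 0 < x₀) (hne : φ t₀ x₀ ≠ 0) :
    ∃ a b κ : ℝ, 0 < a ∧ a < b ∧ 0 < κ ∧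
      ∀ x ∈ Ioo a b, κ ≤ |∫ t in T..L, deriv (φ t) x| := by
  have ht₀L : t₀ < L := by
    by_contra! hge
    exact hne (h.zero_left _ _ (by linarith))
  have hx₀L : x₀ < L := by
    by_contra! hge
    exact hne (h.zero_right _ _ (by linarith))
  have cΨ : Continuous fun x => ∫ t in T..L, deriv (φ t) x :=
    intervalIntegral.continuous_parametric_intervalIntegral_of_continuous'
      (f := fun x t => deriv (φ t) x)
      (h.continuous_deriv_right.comp (continuous_swap : Continuous (Prod.swap : ℝ × ℝ → ℝ × ℝ))) T L
  have cx : Continuous fun t : ℝ => φ t x₀ :=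
    h.continuous.comp (by fun_prop : Continuous fun t : ℝ => (t, x₀))
  obtain ⟨x₁, hx₁, hne₁⟩ : ∃ x, 0 < x ∧ ∫ t in T..L, deriv (φ t) x ≠ 0 := by
    by_contra! hcon
    have h0 : ∫ x in x₀..L, ∫ t in T..L, deriv (φ t) x = 0 := by
      rw [intervalIntegral.integral_congr (g := fun _ => (0:ℝ)), intervalIntegral.integral_zero]
      intro x hx
      rw [uIcc_of_le hx₀L.le] at hx
      exact hcon x (by linarith [hx.1])
    have h_int : IntegrableOn (Function.uncurry fun t x => deriv (φ t) x)
        (uIoc T L ×ˢ uIoc x₀ L) :=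
      (h.continuous_deriv_right.integrableOn_of_isCompact
        (isCompact_uIcc.prod isCompact_uIcc)).mono_set
          (prod_mono uIoc_subset_uIcc uIoc_subset_uIcc)
    rw [← intervalIntegral_intervalIntegral_swap h_int] at h0
    have h1 : ∀ t, ∫ x in x₀..L, deriv (φ t) x = -φ t x₀ := fun t => by
      rw [intervalIntegral.integral_eq_sub_of_hasDerivAt
        (fun x _ => h.contDiff_one.hasDerivAt_right t x)
        (Continuous.intervalIntegrable (h.continuous_deriv_right.comp
          (by fun_prop : Continuous fun x : ℝ => (t, x))) _ _), h.zero_right t L (by linarith)]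
      ring
    simp only [h1, intervalIntegral.integral_neg] at h0
    have := intervalIntegral.integral_pos (ht₀.trans ht₀L) cx.continuousOn
      (fun t _ => h.nonneg t x₀) ⟨t₀, ⟨ht₀.le, ht₀L.le⟩, (h.nonneg _ _).lt_of_ne' hne⟩
    linarith
  set κ := |∫ t in T..L, deriv (φ t) x₁| / 2 with hκ
  have hκ0 : 0 < κ := by have := abs_pos.2 hne₁; linarith
  have hnhds : {x | 0 < x ∧ κ < |∫ t in T..L, deriv (φ t) x|} ∈ nhds x₁ :=
    (((isOpen_lt continuous_const continuous_id).inter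
      (isOpen_lt continuous_const cΨ.abs)).mem_nhds ⟨hx₁, half_lt_self (abs_pos.2 hne₁)⟩)
  obtain ⟨a, b, hab, hsub⟩ := mem_nhds_iff_exists_Ioo_subset.1 hnhds
  obtain ⟨a', ha, ha'⟩ := exists_between hab.1
  refine ⟨a', b, κ, (hsub ⟨ha, ha'.trans hab.2⟩).1, ha'.trans hab.2, hκ0, fun x hx => ?_⟩
  exact (hsub ⟨ha.trans hx.1, hx.2⟩).2.le

end IsQuadrantTest


/-- The function equal to `f (t, x)` for `t < T` and to `H x` afterwards. -/
noncomputable def extendAfter (T : ℝ) (f : ℝ × ℝ → ℝ) (H : ℝ → ℝ) (t x : ℝ) : ℝ :=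
  if t < T then f (t, x) else H x

lemma extendAfter_of_lt {T t : ℝ} (ht : t < T) (f : ℝ × ℝ → ℝ) (H : ℝ → ℝ) (x : ℝ) :
    extendAfter T f H t x = f (t, x) := if_pos ht

lemma extendAfter_of_le {T t : ℝ} (ht : T ≤ t) (f : ℝ × ℝ → ℝ) (H : ℝ → ℝ) (x : ℝ) :
    extendAfter T f H t x = H x := if_neg ht.not_gt

lemma measurable_extendAfter {T : ℝ} {f : ℝ × ℝ → ℝ} {H : ℝ → ℝ} (hf : Measurable f)
    (hH : Measurable H) : Measurable (Function.uncurry (extendAfter T f H)) :=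
  Measurable.ite (measurableSet_Iio.preimage measurable_fst) hf (hH.comp measurable_snd)

lemma spePrimitive_extendAfter_of_lt {T t : ℝ} (ht : t < T) (f : ℝ × ℝ → ℝ) (H : ℝ → ℝ) (x : ℝ) :
    spePrimitive (extendAfter T f H) t x = spePrimitive (fun t x => f (t, x)) t x := by
  simp only [spePrimitive, extendAfter_of_lt ht]

lemma spePrimitive_extendAfter_of_le {T t x : ℝ} (ht : T ≤ t) (hx : 0 < x) (f : ℝ × ℝ → ℝ)
    {H : ℝ → ℝ} (hH : ∀ a b : ℝ, a < b → ¬ IntegrableOn H (Ioo a b)) :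
    spePrimitive (extendAfter T f H) t x = 0 := by
  simp only [spePrimitive, extendAfter_of_le ht]
  refine intervalIntegral.integral_undef fun h_int => hH 0 x hx ?_
  exact h_int.1.mono_set Ioo_subset_Ioc_self

/-- The integrand of the entropy inequality. -/
noncomputable def entropyIntegrand (v : ℝ → ℝ → ℝ) (c : ℝ) (φ : ℝ → ℝ → ℝ) (t x : ℝ) : ℝ :=
  |v t x - c| * deriv (fun s => φ s x) t
    + Real.sign (v t x - c) * ((v t x) ^ 3 - c ^ 3) * deriv (fun y => φ t y) x
    + Real.sign (v t x - c) * spePrimitive v t x * φ t x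

lemma abs_cube_sub_cube (a c : ℝ) : |a ^ 3 - c ^ 3| = |a - c| * (a ^ 2 + a * c + c ^ 2) := by
  rw [show a ^ 3 - c ^ 3 = (a - c) * (a ^ 2 + a * c + c ^ 2) by ring, abs_mul,
    abs_of_nonneg (a := a ^ 2 + a * c + c ^ 2) (by nlinarith [sq_nonneg (a + c), sq_nonneg a, sq_nonneg c])]

lemma entropyIntegrand_extendAfter_of_lt {T t : ℝ} (ht : t < T) (f : ℝ × ℝ → ℝ) (H : ℝ → ℝ)
    (c : ℝ) (φ : ℝ → ℝ → ℝ) (x : ℝ) :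
    entropyIntegrand (extendAfter T f H) c φ t x = entropyDensity f c φ (t, x) := by
  simp only [entropyIntegrand, entropyDensity, extendAfter_of_lt ht,
    spePrimitive_extendAfter_of_lt ht, Real.sign_sub_mul_cube_sub, abs_cube_sub_cube]
  ring

lemma entropyIntegrand_extendAfter_of_le {T t x : ℝ} (ht : T ≤ t) (hx : 0 < x) (f : ℝ × ℝ → ℝ)
    {H : ℝ → ℝ} (hH : ∀ a b : ℝ, a < b → ¬ IntegrableOn H (Ioo a b)) (c : ℝ) (φ : ℝ → ℝ → ℝ) :
    entropyIntegrand (extendAfter T f H) c φ t x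
      = |H x - c| * deriv (fun s => φ s x) t + |H x ^ 3 - c ^ 3| * deriv (φ t) x := by
  simp only [entropyIntegrand, extendAfter_of_le ht, spePrimitive_extendAfter_of_le ht hx f hH,
    Real.sign_sub_mul_cube_sub]
  ring

lemma measurable_spePrimitive_left {f : ℝ × ℝ → ℝ} (hf : Measurable f) {x : ℝ} (hx : 0 ≤ x) :
    Measurable fun t => spePrimitive (fun t x => f (t, x)) t x := by
  simp only [spePrimitive, intervalIntegral.integral_of_le hx]
  exact (StronglyMeasurable.integral_prod_right' (ν := volume.restrict (Ioc 0 x))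
    hf.stronglyMeasurable).measurable

namespace IsQuadrantTest
variable {L : ℝ} {φ : ℝ → ℝ → ℝ}

lemma measurable_entropyDensity_left (h : IsQuadrantTest L φ) {f : ℝ × ℝ → ℝ} (hf : Measurable f)
    (c : ℝ) {x : ℝ} (hx : 0 ≤ x) : Measurable fun t => entropyDensity f c φ (t, x) := by
  have m0 : Measurable fun t : ℝ => f (t, x) := hf.comp (by fun_prop)
  have hi : Continuous fun t : ℝ => (t, x) := by fun_prop
  have m1 := (h.continuous.comp hi).measurable
  have m2 := (h.continuous_deriv_left.comp hi).measurable
  have m3 := (h.continuous_deriv_right.comp hi).measurable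
  have m4 := measurable_real_sign.comp (m0.sub_const c)
  have m5 := measurable_spePrimitive_left hf hx
  have m6 : Measurable fun t : ℝ => |f (t, x) - c| := by fun_prop
  have m7 : Measurable fun t : ℝ => f (t, x) ^ 2 + f (t, x) * c + c ^ 2 := by fun_prop
  exact (m6.mul (m2.add (m7.mul m3))).add ((m4.mul m5).mul m1)

lemma integrableOn_entropyDensity_left (h : IsQuadrantTest L φ) {f : ℝ × ℝ → ℝ} (hf : Measurable f)
    {M : ℝ} (hM : 0 ≤ M) (hfM : ∀ p, |f p| ≤ M) (T c : ℝ) {x : ℝ} (hx : 0 ≤ x) :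
    IntegrableOn (fun t => entropyDensity f c φ (t, x)) (Ioo 0 T) := by
  obtain ⟨B, hB⟩ := exists_bound_entropyDensity hM hfM h.contDiff T x |c|
  refine integrableOn_of_forall_le measurableSet_Ioo (by simp) (C := B)
    (h.measurable_entropyDensity_left hf c hx).aestronglyMeasurable fun t ht => ?_
  exact hB c le_rfl _ ⟨⟨ht.1.le, ht.2.le⟩, hx, le_rfl⟩

lemma integral_entropyIntegrand_extendAfter (h : IsQuadrantTest L φ) {f : ℝ × ℝ → ℝ}
    (hf : Measurable f) {M : ℝ} (hM : 0 ≤ M) (hfM : ∀ p, |f p| ≤ M) {H : ℝ → ℝ}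
    (hH : ∀ a b : ℝ, a < b → ¬ IntegrableOn H (Ioo a b)) {T : ℝ} (hT : 0 < T) (hTL : T < L) (c : ℝ)
    {x : ℝ} (hx : 0 < x) :
    ∫ t in Ioi (0:ℝ), entropyIntegrand (extendAfter T f H) c φ t x
      = (∫ t in Ioo 0 T, entropyDensity f c φ (t, x))
        + (|H x ^ 3 - c ^ 3| * (∫ t in T..L, deriv (φ t) x) - |H x - c| * φ T x) := by
  have hi : Continuous fun t : ℝ => (t, x) := by fun_prop
  have i2 : IntervalIntegrable (fun t => deriv (fun s => φ s x) t) volume T L :=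
    (h.continuous_deriv_left.comp hi).intervalIntegrable _ _
  have i3 : IntervalIntegrable (fun t => deriv (φ t) x) volume T L :=
    (h.continuous_deriv_right.comp hi).intervalIntegrable _ _
  have e1 : EqOn (fun t => entropyIntegrand (extendAfter T f H) c φ t x)
      (fun t => entropyDensity f c φ (t, x)) (Ioo 0 T) := fun t ht =>
    entropyIntegrand_extendAfter_of_lt ht.2 f H c φ x
  have e2 : EqOn (fun t => entropyIntegrand (extendAfter T f H) c φ t x)
      (fun t => |H x - c| * deriv (fun s => φ s x) t + |H x ^ 3 - c ^ 3| * deriv (φ t) x)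
      (Ici T) := fun t ht => entropyIntegrand_extendAfter_of_le ht hx f hH c φ
  have j1 : IntegrableOn (fun t => entropyIntegrand (extendAfter T f H) c φ t x) (Ioo 0 T) :=
    (h.integrableOn_entropyDensity_left hf hM hfM T c hx.le).congr_fun e1.symm measurableSet_Ioo
  have j2 : IntegrableOn (fun t => entropyIntegrand (extendAfter T f H) c φ t x) (Ioc T L) :=
    ((i2.const_mul _).add (i3.const_mul _)).1.congr_fun
      (fun t ht => (e2 (show T ≤ t from ht.1.le)).symm) measurableSet_Ioc
  rw [setIntegral_eq_of_subset_of_forall_sdiff_eq_zero measurableSet_Ioi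
    (Ioc_subset_Ioi_self : Ioc 0 L ⊆ Ioi 0), ← Ioc_union_Ioc_eq_Ioc hT.le hTL.le,
    setIntegral_union (Ioc_disjoint_Ioc_of_le le_rfl) measurableSet_Ioc
      ((integrableOn_Ioc_iff_integrableOn_Ioo (by simp)).2 j1) j2, integral_Ioc_eq_integral_Ioo,
    setIntegral_congr_fun measurableSet_Ioo e1,
    setIntegral_congr_fun measurableSet_Ioc (e2.mono fun t ht => ht.1.le),
    ← intervalIntegral.integral_of_le hTL.le,
    intervalIntegral.integral_add (i2.const_mul _) (i3.const_mul _),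
    intervalIntegral.integral_const_mul, intervalIntegral.integral_const_mul,
    intervalIntegral.integral_eq_sub_of_hasDerivAt
      (fun t _ => h.contDiff_one.hasDerivAt_left t x) i2, h.zero_left L x (by linarith)]
  · ring
  · intro t ht
    have htL : L < t := by
      by_contra! hle
      exact ht.2 ⟨ht.1, hle⟩
    have hd := h.deriv_zero_left (show L - 1 < t by linarith) x
    simp [entropyIntegrand, hd.1, hd.2, h.zero_left t x (by linarith)]

end IsQuadrantTest


namespace IsQuadrantTest
variable {L : ℝ} {φ : ℝ → ℝ → ℝ}

lemma not_integrableOn_entropyIntegrand (h : IsQuadrantTest L φ) {f : ℝ × ℝ → ℝ}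
    (hf : Measurable f) {M : ℝ} (hM : 0 ≤ M) (hfM : ∀ p, |f p| ≤ M) {H : ℝ → ℝ}
    (hHm : Measurable H) (hH : ∀ a b : ℝ, a < b → ¬ IntegrableOn H (Ioo a b)) {T : ℝ} (hT : 0 < T)
    (hTL : T < L) (c : ℝ) {t₀ x₀ : ℝ} (ht₀ : T < t₀) (hx₀ : 0 < x₀) (hne : φ t₀ x₀ ≠ 0) :
    ¬ IntegrableOn (fun x => ∫ t in Ioi (0:ℝ), entropyIntegrand (extendAfter T f H) c φ t x)
      (Ioi 0) := by
  intro h_int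
  obtain ⟨a, b, κ, ha, hab, hκ, hJ⟩ := h.exists_abs_integral_deriv_ge ht₀ hx₀ hne
  obtain ⟨B, hB⟩ := exists_bound_entropyDensity hM hfM h.contDiff T b |c|
  obtain ⟨D, hD0, hD⟩ := (isCompact_Icc.prod isCompact_Icc :
    IsCompact (Icc 0 T ×ˢ Icc 0 b : Set (ℝ × ℝ))).exists_nonneg_bound h.continuous
  obtain ⟨K, hK⟩ := exists_le_mul_cube_sub hκ hD0
  refine hH a b hab ?_
  have hW := h_int.mono_set (fun x hx => ha.trans hx.1 : Ioo a b ⊆ Ioi 0)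
  refine Integrable.mono' (hW.abs.add (integrableOn_const
    (C := B * T + D * |c| + κ * |c| ^ 3 + K) (by simp))) hHm.aestronglyMeasurable
    ((ae_restrict_iff' measurableSet_Ioo).2 (Eventually.of_forall fun x hx => ?_))
  have hx0 : 0 < x := ha.trans hx.1
  have e := h.integral_entropyIntegrand_extendAfter hf hM hfM hH hT hTL c hx0
  set W := ∫ t in Ioi (0:ℝ), entropyIntegrand (extendAfter T f H) c φ t x with hWdef
  set J := ∫ t in T..L, deriv (φ t) x with hJdef
  have hI : |∫ t in Ioo 0 T, entropyDensity f c φ (t, x)| ≤ B * T := by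
    have := norm_setIntegral_le_of_norm_le_const (μ := volume) (s := Ioo 0 T) (C := B)
      (f := fun t => entropyDensity f c φ (t, x)) (by simp)
      (fun t ht => hB c le_rfl (t, x) ⟨⟨ht.1.le, ht.2.le⟩, hx0.le, hx.2.le⟩)
    simpa [Measure.real, hT.le] using this
  have hφ : |φ T x| ≤ D := hD (T, x) ⟨⟨hT.le, le_rfl⟩, hx0.le, hx.2.le⟩
  have k1 : |H x - c| * φ T x ≤ (|H x| + |c|) * D := by
    refine mul_le_mul (abs_sub _ _) ((le_abs_self _).trans hφ) (h.nonneg _ _) (by positivity)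
  have k2 : κ * (|H x| ^ 3 - |c| ^ 3) ≤ |H x ^ 3 - c ^ 3| * |J| := by
    have := abs_sub_abs_le_abs_sub (H x ^ 3) (c ^ 3)
    rw [abs_pow, abs_pow] at this
    calc κ * (|H x| ^ 3 - |c| ^ 3) ≤ κ * |H x ^ 3 - c ^ 3| := by gcongr
      _ ≤ |J| * |H x ^ 3 - c ^ 3| := by gcongr; exact hJ x hx
      _ = _ := mul_comm _ _
  have k3 : |H x ^ 3 - c ^ 3| * |J| ≤ |W| + B * T + |H x - c| * φ T x := by
    have e' : |H x ^ 3 - c ^ 3| * J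
        = W - (∫ t in Ioo 0 T, entropyDensity f c φ (t, x)) + |H x - c| * φ T x := by
      rw [e]; ring
    calc |H x ^ 3 - c ^ 3| * |J| = abs (|H x ^ 3 - c ^ 3| * J) := by rw [abs_mul, abs_abs]
      _ ≤ |W - (∫ t in Ioo 0 T, entropyDensity f c φ (t, x))| + |(|H x - c| * φ T x)| := by
        rw [e']; exact abs_add_le _ _
      _ ≤ _ := by
        rw [abs_of_nonneg (mul_nonneg (abs_nonneg _) (h.nonneg T x))]
        have := abs_sub W (∫ t in Ioo 0 T, entropyDensity f c φ (t, x))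
        linarith
  have := hK |H x| (abs_nonneg _)
  simp only [Pi.add_apply, Real.norm_eq_abs]
  linarith

end IsQuadrantTest

lemma IsViscousSequence.entropy_extendAfter {T M : ℝ} {e : ℕ → ℝ} {U : ℕ → ℝ → ℝ → ℝ}
    {u₀ g : ℝ → ℝ} {f : ℝ × ℝ → ℝ} (h : IsViscousSequence T M e U u₀ g) (hf : Measurable f)
    (hfM : ∀ p, |f p| ≤ M)
    (hlim : ∀ᵐ p ∂(volume.restrict (Ioo 0 T ×ˢ Ioi (0:ℝ))),
        Tendsto (fun n => U n p.1 p.2) atTop (nhds (f p))) {H : ℝ → ℝ}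
    (hHm : Measurable H) (hH : ∀ a b : ℝ, a < b → ¬ IntegrableOn H (Ioo a b))
    {u₁ g₁ : ℝ → ℝ} {C : ℝ} (hu₁ : ∀ᵐ x ∂(volume.restrict (Ioi 0)), u₁ x = u₀ x)
    (hg₁m : Measurable g₁) (hg₁C : ∀ᵐ t ∂(volume.restrict (Ioi 0)), |g₁ t| ≤ C)
    (hg₁ : ∀ᵐ t ∂(volume.restrict (Ioo 0 T)), g₁ t = g t)
    {φ : ℝ → ℝ → ℝ} (hφ : ContDiff ℝ 2 (Function.uncurry φ))
    (hs : HasCompactSupport (Function.uncurry φ)) (hφ0 : ∀ t x, 0 ≤ φ t x) (c : ℝ) :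
    0 ≤ (∫ x in Ioi (0:ℝ), ∫ t in Ioi (0:ℝ), entropyIntegrand (extendAfter T f H) c φ t x)
      + (∫ t in Ioi (0:ℝ), Real.sign (g₁ t - c) * ((g₁ t) ^ 3 - c ^ 3) * φ t 0)
      + (∫ x in Ioi (0:ℝ), |u₁ x - c| * φ 0 x) := by
  obtain ⟨L, hL, hTL, hL'⟩ := exists_isQuadrantTest hφ hs hφ0 T
  have hT := h.T_pos
  have hM := h.M_pos.le
  simp only [Real.sign_sub_mul_cube_sub]
  have s1 : 0 ≤ ∫ t in Ioi (0:ℝ), |g₁ t ^ 3 - c ^ 3| * φ t 0 :=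
    integral_nonneg fun t => mul_nonneg (abs_nonneg _) (hφ0 _ _)
  have s2 : 0 ≤ ∫ x in Ioi (0:ℝ), |u₁ x - c| * φ 0 x :=
    integral_nonneg fun x => mul_nonneg (abs_nonneg _) (hφ0 _ _)
  by_cases hne : ∃ t₀ x₀, T < t₀ ∧ 0 < x₀ ∧ φ t₀ x₀ ≠ 0
  · obtain ⟨t₀, x₀, ht₀, hx₀, hne⟩ := hne
    rw [integral_undef
      (hL'.not_integrableOn_entropyIntegrand hf hM hfM hHm hH hT hTL c ht₀ hx₀ hne)]
    linarith
  push Not at hne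
  have hφT : ∀ x, 0 < x → φ T x = 0 := fun x hx => by
    have hc : Continuous fun t => φ t x :=
      hL'.continuous.comp (by fun_prop : Continuous fun t : ℝ => (t, x))
    refine tendsto_nhds_unique (hc.continuousAt.tendsto.mono_left (nhdsWithin_le_nhds (s := Ioi T)))
      (tendsto_const_nhds.congr' ?_)
    filter_upwards [self_mem_nhdsWithin] with t ht using (hne t x ht hx).symm
  have hW : ∀ x ∈ Ioi (0:ℝ),
      ∫ t in Ioi (0:ℝ), entropyIntegrand (extendAfter T f H) c φ t x
        = ∫ t in Ioo 0 T, entropyDensity f c φ (t, x) := fun x hx => by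
    have hJ : ∫ t in T..L, deriv (φ t) x = 0 := by
      rw [intervalIntegral.integral_of_le hTL.le]
      refine setIntegral_eq_zero_of_forall_eq_zero fun t ht => ?_
      have : φ t =ᶠ[nhds x] fun _ => 0 := by
        filter_upwards [Ioi_mem_nhds (show (0:ℝ) < x from hx)] with y hy using hne t y ht.1 hy
      rw [this.deriv_eq, deriv_const]
    rw [hL'.integral_entropyIntegrand_extendAfter hf hM hfM hH hT hTL c hx, hJ, hφT x hx]
    ring
  have ent := h.entropy_of_trace hf hfM hlim hL.le hφ hφ0
    (fun t => hL'.zero_right t L (by linarith))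
    (fun t => (hL'.deriv_zero_right t (by linarith)).2) c
  rw [integral_rect_symm (h.integrableOn_entropyDensity hf hfM hlim hφ c L)] at ent
  have e1 : ∫ x in Ioi (0:ℝ), ∫ t in Ioi (0:ℝ), entropyIntegrand (extendAfter T f H) c φ t x
      = ∫ x in Ioc 0 L, ∫ t in Ioo 0 T, entropyDensity f c φ (t, x) := by
    rw [setIntegral_congr_fun measurableSet_Ioi hW]
    refine setIntegral_eq_of_subset_of_forall_sdiff_eq_zero measurableSet_Ioi
      Ioc_subset_Ioi_self fun x hx => ?_
    refine setIntegral_eq_zero_of_forall_eq_zero fun t _ => ?_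
    have hxL : L < x := by
      by_contra! hle
      exact hx.2 ⟨hx.1, hle⟩
    have hd := hL'.deriv_zero_right t (show L - 1 < x by linarith)
    simp [entropyDensity, hd.1, hd.2, hL'.zero_right t x (by linarith)]
  have e2 : ∫ x in Ioi (0:ℝ), |u₁ x - c| * φ 0 x = ∫ x in (0:ℝ)..L, |u₀ x - c| * φ 0 x := by
    rw [intervalIntegral.integral_of_le hL.le]
    trans ∫ x in Ioi (0:ℝ), |u₀ x - c| * φ 0 x
    · refine integral_congr_ae ?_
      filter_upwards [hu₁] with x hx
      rw [hx]
    · refine setIntegral_eq_of_subset_of_forall_sdiff_eq_zero measurableSet_Ioi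
        Ioc_subset_Ioi_self fun x hx => ?_
      have hxL : L < x := by
        by_contra! hle
        exact hx.2 ⟨hx.1, hle⟩
      rw [hL'.zero_right 0 x (by linarith), mul_zero]
  have e3 : ∫ t in Ioo 0 T, |g t ^ 3 - c ^ 3| * φ t 0
      ≤ ∫ t in Ioi (0:ℝ), |g₁ t ^ 3 - c ^ 3| * φ t 0 := by
    have hc : Continuous fun t => φ t 0 :=
      hL'.continuous.comp (by fun_prop : Continuous fun t : ℝ => (t, (0:ℝ)))
    have hci : IntegrableOn (fun t => φ t 0) (Ioi 0) := by
      refine (hc.integrableOn_of_isCompact (isCompact_Icc (a := 0) (b := L))).of_forall_sdiff_eq_zero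
        measurableSet_Ioi fun t ht => ?_
      have htL : L < t := by
        by_contra! hle
        exact ht.2 ⟨(show (0:ℝ) < t from ht.1).le, hle⟩
      exact hL'.zero_left t 0 (by linarith)
    have h_int : IntegrableOn (fun t => |g₁ t ^ 3 - c ^ 3| * φ t 0) (Ioi 0) := by
      refine hci.bdd_mul (c := C ^ 3 + |c| ^ 3) (Measurable.aestronglyMeasurable (by fun_prop)) ?_
      filter_upwards [hg₁C] with t ht
      rw [Real.norm_eq_abs, abs_abs]
      refine (abs_sub _ _).trans ?_
      rw [abs_pow, abs_pow]
      gcongr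
    rw [integral_congr_ae (g := fun t => |g₁ t ^ 3 - c ^ 3| * φ t 0)
      (by filter_upwards [hg₁] with t ht; rw [ht])]
    exact setIntegral_mono_set h_int
      (Eventually.of_forall fun t => mul_nonneg (abs_nonneg _) (hφ0 _ _))
      Ioo_subset_Ioi_self.eventuallyLE
  rw [e1, e2]
  linarith

end extension

section limit

lemma integrableOn_abs_sub_rpow {α : Type*} [MeasurableSpace α] {μ : Measure α} {s : Set α}
    (hs : MeasurableSet s) (hfin : μ s ≠ ⊤) {F f : α → ℝ} {C q : ℝ} (hq : 0 ≤ q)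
    (hF : AEStronglyMeasurable F (μ.restrict s)) (hf : AEStronglyMeasurable f (μ.restrict s))
    (hFC : ∀ p ∈ s, |F p| ≤ C) (hfC : ∀ p ∈ s, |f p| ≤ C) :
    IntegrableOn (fun p => |F p - f p| ^ q) s μ := by
  refine integrableOn_of_forall_le hs hfin (C := (C + C) ^ q)
    ((Real.continuous_rpow_const hq).comp_aestronglyMeasurable (hF.sub hf).norm) fun p hp => ?_
  rw [abs_of_nonneg (by positivity)]
  exact Real.rpow_le_rpow (abs_nonneg _)
    ((abs_sub _ _).trans (add_le_add (hFC p hp) (hfC p hp))) hq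

lemma tendsto_setIntegral_abs_sub_rpow {α : Type*} [MeasurableSpace α] {μ : Measure α} {s : Set α}
    (hs : MeasurableSet s) (hfin : μ s ≠ ⊤) {F : ℕ → α → ℝ} {f : α → ℝ} {C q : ℝ} (hq : 0 < q)
    (hF : ∀ n, AEStronglyMeasurable (F n) (μ.restrict s))
    (hf : AEStronglyMeasurable f (μ.restrict s))
    (hFC : ∀ n, ∀ p ∈ s, |F n p| ≤ C) (hfC : ∀ p ∈ s, |f p| ≤ C)
    (hlim : ∀ᵐ p ∂μ.restrict s, Tendsto (fun n => F n p) atTop (nhds (f p))) :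
    Tendsto (fun n => ∫ p in s, |F n p - f p| ^ q ∂μ) atTop (nhds 0) := by
  have := tendsto_setIntegral_of_bounded hs hfin (F := fun n p => |F n p - f p| ^ q)
    (f := fun _ => 0) (C := (C + C) ^ q)
    (fun n => (Real.continuous_rpow_const hq.le).comp_aestronglyMeasurable ((hF n).sub hf).norm)
    (fun n p hp => by
      rw [abs_of_nonneg (by positivity)]
      exact Real.rpow_le_rpow (abs_nonneg _)
        ((abs_sub _ _).trans (add_le_add (hFC n p hp) (hfC p hp))) hq.le)
    (by
      filter_upwards [hlim] with p hp
      have h1 := (hp.sub_const (f p)).abs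
      rw [sub_self, abs_zero] at h1
      have h2 := h1.rpow_const (p := q) (Or.inr hq.le)
      rwa [Real.zero_rpow hq.ne'] at h2)
  simpa using this

lemma IsViscousSequence.exists_limit {T M M' : ℝ} {e : ℕ → ℝ} {U : ℕ → ℝ → ℝ → ℝ} {u₀ g : ℝ → ℝ}
    (h : IsViscousSequence T M' e U u₀ g) (hM : 0 ≤ M) (hMM' : M ≤ M')
    (hb : ∀ n, IsViscousSolution (e n) T M (U n)) (hg : ∀ t, |g t| ≤ M) :
    ∃ k : ℕ → ℕ, StrictMono k ∧ ∃ f : ℝ × ℝ → ℝ, Measurable f ∧ (∀ p, |f p| ≤ M) ∧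
      (∀ᵐ p ∂(volume.restrict (Ioo 0 T ×ˢ Ioi (0:ℝ))),
        Tendsto (fun n => U (k n) p.1 p.2) atTop (nhds (f p))) ∧
      Tendsto (fun x => ∫ t in Ioo 0 T, |f (t, x) - g t|) (nhdsWithin 0 (Ioi 0)) (nhds 0) := by
  obtain ⟨k, hk, f₀, hf₀, -, hlim₀⟩ := h.exists_subseq_ae_tendsto
  set f₁ : ℝ × ℝ → ℝ := fun p => max (-M) (min M (f₀ p)) with hf₁
  have hf₁m : Measurable f₁ := by fun_prop
  have hf₁M : ∀ p, |f₁ p| ≤ M := fun p => abs_clip_le hM _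
  have hlim₁ : ∀ᵐ p ∂(volume.restrict (Ioo 0 T ×ˢ Ioi (0:ℝ))),
      Tendsto (fun n => U (k n) p.1 p.2) atTop (nhds (f₁ p)) := by
    filter_upwards [hlim₀, ae_restrict_mem (measurableSet_Ioo.prod measurableSet_Ioi)] with p hp hm
    have : |f₀ p| ≤ M := le_of_tendsto' hp.abs fun n =>
      (hb _).bound _ ⟨hm.1.1.le, hm.1.2.le⟩ _ (mem_Ici.2 (le_of_lt (mem_Ioi.1 hm.2)))
    rwa [show f₁ p = f₀ p from clip_eq_self this]
  obtain ⟨N, hN, hN0, htr⟩ := (h.comp_strictMono hk).exists_trace hf₁m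
    (fun p => (hf₁M p).trans hMM') hlim₁
  classical
  refine ⟨k, hk, fun p => if p.2 ∈ N then g p.1 else f₁ p,
    Measurable.ite (hN.preimage measurable_snd) (h.meas_g.comp measurable_fst) hf₁m,
    fun p => ?_, ?_, ?_⟩
  · dsimp only
    split_ifs
    exacts [hg _, hf₁M p]
  · have hae : ∀ᵐ p : ℝ × ℝ, p.2 ∉ N :=
      Measure.quasiMeasurePreserving_snd.ae (measure_eq_zero_iff_ae_notMem.1 hN0)
    filter_upwards [hlim₁, ae_restrict_of_ae hae] with p hp hn
    simpa only [hn, if_false] using hp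
  · rw [← sdiff_union_inter (Ioi (0:ℝ)) N, nhdsWithin_union]
    refine Tendsto.sup (htr.congr' ?_) (tendsto_const_nhds.congr' ?_)
    · filter_upwards [self_mem_nhdsWithin] with x hx
      simp [hx.2]
    · filter_upwards [self_mem_nhdsWithin] with x hx
      simp [hx.2]

lemma tendsto_integral_abs_sub_of_ae {F : ℕ → ℝ → ℝ} {f : ℝ → ℝ} {R M : ℝ} (hR : 0 ≤ R)
    (hF : ∀ n, Continuous (F n)) (hf : Measurable f) (hFM : ∀ n, ∀ x ∈ Ioc 0 R, |F n x| ≤ M)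
    (hfM : ∀ x, |f x| ≤ M)
    (hlim : ∀ᵐ x ∂(volume.restrict (Ioc 0 R)), Tendsto (fun n => F n x) atTop (nhds (f x))) :
    Tendsto (fun n => ∫ x in (0:ℝ)..R, |F n x - f x|) atTop (nhds 0) := by
  simp only [intervalIntegral.integral_of_le hR]
  simpa using tendsto_setIntegral_abs_sub_rpow measurableSet_Ioc (by simp) (q := 1) one_pos
    (fun n => (hF n).aestronglyMeasurable) hf.aestronglyMeasurable hFM (fun x _ => hfM x) hlim

end limit

/-- **Lemma 3.2 (compensated compactness).** Let `T > 0` and let `{u_ε}` be the family of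
smooth solutions of the viscous approximations of the short pulse equation, uniformly
bounded in `L^∞((0,T)×(0,∞))`. Then there are `ε_k → 0⁺` and
`u ∈ L^∞((0,T)×(0,∞))` with `u_{ε_k} → u` a.e. and in `L^p_loc`, `1 ≤ p < ∞`;
moreover `P_{ε_k} → P = ∫_0^· u dy` a.e. and in `L^p_loc(0,T;W^{1,p}_loc(0,∞))`,
and the limit `u` satisfies the entropy inequality of the initial-boundary
value problem. -/
theorem viscous_compensated_compactness
    (T : ℝ) (hT : 0 < T)
    -- the data
    (u₀ g : ℝ → ℝ)
    (hu₀_meas : Measurable u₀)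
    (hu₀_inf : eLpNorm u₀ ⊤ (volume.restrict (Ioi (0:ℝ))) < ⊤)
    (hu₀_L1 : IntegrableOn u₀ (Ioi (0:ℝ)))
    (hu₀_mean : ∫ x in Ioi (0:ℝ), u₀ x = 0)
    (hP₀_L2 : IntegrableOn (fun x => (∫ y in (0:ℝ)..x, u₀ y) ^ 2) (Ioi (0:ℝ)))
    (hg_meas : Measurable g)
    (hg_inf : eLpNorm g ⊤ (volume.restrict (Ioi (0:ℝ))) < ⊤)
    -- the family of viscous solutions and approximate data
    (u P : ℝ → ℝ → ℝ → ℝ) (gε u₀ε : ℝ → ℝ → ℝ)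
    (hu_smooth : ∀ ε > (0:ℝ), ContDiff ℝ (⊤ : ℕ∞) (Function.uncurry (u ε)))
    (hgε_smooth : ∀ ε > (0:ℝ), ContDiff ℝ (⊤ : ℕ∞) (gε ε))
    (hu₀ε_smooth : ∀ ε > (0:ℝ), ContDiff ℝ (⊤ : ℕ∞) (u₀ε ε))
    (hPdef : ∀ ε > (0:ℝ), ∀ t x : ℝ, P ε t x = ∫ y in (0:ℝ)..x, u ε t y)
    (hPDE : ∀ ε > (0:ℝ), ∀ t > (0:ℝ), ∀ x > (0:ℝ),
        deriv (fun s => u ε s x) t + 3 * (u ε t x) ^ 2 * deriv (u ε t) x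
          = P ε t x + ε * deriv (deriv (u ε t)) x)
    (hbc : ∀ ε > (0:ℝ), ∀ t > (0:ℝ), u ε t 0 = gε ε t)
    (hic : ∀ ε > (0:ℝ), ∀ x > (0:ℝ), u ε 0 x = u₀ε ε x)
    -- convergence of the approximate data
    (hu₀ε_conv : ∀ᵐ x ∂(volume.restrict (Ioi (0:ℝ))),
        Tendsto (fun ε => u₀ε ε x) (nhdsWithin 0 (Ioi 0)) (nhds (u₀ x)))
    (hgε_conv : ∀ᵐ t ∂(volume.restrict (Ioi (0:ℝ))),
        Tendsto (fun ε => gε ε t) (nhdsWithin 0 (Ioi 0)) (nhds (g t)))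
    (hu₀ε_mean : ∀ ε > (0:ℝ), ∫ x in Ioi (0:ℝ), u₀ε ε x = 0)
    (Cg : ℝ) (hCg : 0 < Cg)
    (hgε_bound : ∀ ε > (0:ℝ), ∀ t : ℝ, |gε ε t| ≤ Cg)
    -- the family `{u_ε}` is uniformly bounded in `L^∞((0,T)×(0,∞))`
    (M : ℝ)
    (hu_bound : ∀ ε > (0:ℝ), ∀ t ∈ Ioo (0:ℝ) T, ∀ x > (0:ℝ), |u ε t x| ≤ M) :
    ∃ εk : ℕ → ℝ, (∀ k, 0 < εk k) ∧ Tendsto εk atTop (nhds 0) ∧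
    ∃ (v : ℝ → ℝ → ℝ) (vτ : ℝ → ℝ),
      -- `v ∈ L^∞((0,T)×(0,∞))`
      Measurable (Function.uncurry v) ∧
      (∀ t ∈ Ioo (0:ℝ) T, ∀ x > (0:ℝ), |v t x| ≤ M) ∧
      -- `u_{ε_k} → v` a.e. on `(0,T)×(0,∞)`
      (∀ᵐ p ∂(volume.restrict ((Ioo (0:ℝ) T) ×ˢ (Ioi (0:ℝ)))),
          Tendsto (fun k => u (εk k) (Prod.fst p) (Prod.snd p)) atTop
            (nhds (v (Prod.fst p) (Prod.snd p)))) ∧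
      -- `u_{ε_k} → v` in `L^p_loc((0,T)×(0,∞))` for every `1 ≤ p < ∞`
      (∀ q : ℝ, 1 ≤ q → ∀ K : Set (ℝ × ℝ), IsCompact K →
          K ⊆ (Ioo (0:ℝ) T) ×ˢ (Ioi (0:ℝ)) →
          Tendsto (fun k => ∫ p in K,
              |u (εk k) (Prod.fst p) (Prod.snd p) - v (Prod.fst p) (Prod.snd p)| ^ q)
            atTop (nhds 0)) ∧
      -- `P_{ε_k} → P = ∫_0^· v dy` a.e. on `(0,T)×(0,∞)`
      (∀ᵐ p ∂(volume.restrict ((Ioo (0:ℝ) T) ×ˢ (Ioi (0:ℝ)))),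
          Tendsto (fun k => P (εk k) (Prod.fst p) (Prod.snd p)) atTop
            (nhds (spePrimitive v (Prod.fst p) (Prod.snd p)))) ∧
      -- `P_{ε_k} → P` in `L^p_loc(0,T; W^{1,p}_loc(0,∞))` for every `1 ≤ p < ∞`
      -- (recall `∂ₓP_{ε_k} = u_{ε_k}` and `∂ₓP = v`)
      (∀ q : ℝ, 1 ≤ q → ∀ K : Set (ℝ × ℝ), IsCompact K →
          K ⊆ (Ioo (0:ℝ) T) ×ˢ (Ioi (0:ℝ)) →
          Tendsto (fun k => ∫ p in K,
              (|P (εk k) (Prod.fst p) (Prod.snd p)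
                  - spePrimitive v (Prod.fst p) (Prod.snd p)| ^ q
                + |u (εk k) (Prod.fst p) (Prod.snd p) - v (Prod.fst p) (Prod.snd p)| ^ q))
            atTop (nhds 0)) ∧
      -- `vτ` is the strong trace of `v` on the boundary `x = 0`
      (Tendsto (fun x => ∫ t in Ioo (0:ℝ) T, |v t x - vτ t|)
          (nhdsWithin 0 (Ioi 0)) (nhds 0)) ∧
      -- `v` satisfies the entropy inequality
      (∀ φ : ℝ → ℝ → ℝ, ContDiff ℝ 2 (Function.uncurry φ) →
          HasCompactSupport (Function.uncurry φ) → (∀ t x, 0 ≤ φ t x) → ∀ c : ℝ,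
          0 ≤ (∫ x in Ioi (0:ℝ), ∫ t in Ioi (0:ℝ),
                  (|v t x - c| * deriv (fun s => φ s x) t
                    + Real.sign (v t x - c) * ((v t x) ^ 3 - c ^ 3)
                        * deriv (fun y => φ t y) x
                    + Real.sign (v t x - c) * spePrimitive v t x * φ t x))
              + (∫ t in Ioi (0:ℝ), Real.sign (g t - c) * ((vτ t) ^ 3 - c ^ 3) * φ t 0)
              + (∫ x in Ioi (0:ℝ), |u₀ x - c| * φ 0 x)) := by
  have hT2 : T / 2 ∈ Ioo 0 T := ⟨by linarith, by linarith⟩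
  have hM : 0 ≤ M := (abs_nonneg _).trans (hu_bound 1 one_pos _ hT2 1 one_pos)
  set e : ℕ → ℝ := fun n => 1 / ((n:ℝ) + 1) with he
  have e_pos : ∀ n, 0 < e n := fun n => by positivity
  have e_lim : Tendsto e atTop (nhds 0) := tendsto_one_div_add_atTop_nhds_zero_nat
  have e_lim' : Tendsto e atTop (nhdsWithin 0 (Ioi 0)) :=
    tendsto_nhdsWithin_iff.2 ⟨e_lim, Eventually.of_forall e_pos⟩
  have hu_two : ∀ n, ContDiff ℝ 2 (Function.uncurry (u (e n))) := fun n =>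
    contDiff_infty.1 (hu_smooth _ (e_pos n)) 2
  have sol : ∀ {M₁ : ℝ}, M ≤ M₁ → ∀ n, IsViscousSolution (e n) T M₁ (u (e n)) := fun hM₁ n =>
    IsViscousSolution.of_interior hT (hu_two n)
      (fun t ht x hx => by
        rw [hPDE _ (e_pos n) t ht x hx, hPdef _ (e_pos n)]
        rfl)
      (fun t ht x hx => (hu_bound _ (e_pos n) t ht x hx).trans hM₁)
  have hsol := sol le_rfl
  have hcu : ∀ n, Continuous fun p : ℝ × ℝ => u (e n) p.1 p.2 := fun n => (hu_two n).continuous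
  have lim_u₀ : ∀ᵐ x ∂(volume.restrict (Ioi (0:ℝ))),
      Tendsto (fun n => u (e n) 0 x) atTop (nhds (u₀ x)) := by
    filter_upwards [hu₀ε_conv, ae_restrict_mem measurableSet_Ioi] with x hx hx0
    exact (hx.comp e_lim').congr fun n => (hic _ (e_pos n) x hx0).symm
  have lim_g : ∀ᵐ t ∂(volume.restrict (Ioi (0:ℝ))),
      Tendsto (fun n => u (e n) t 0) atTop (nhds (g t)) := by
    filter_upwards [hgε_conv, ae_restrict_mem measurableSet_Ioi] with t ht ht0
    exact (ht.comp e_lim').congr fun n => (hbc _ (e_pos n) t ht0).symm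
  set u₀' : ℝ → ℝ := fun x => max (-M) (min M (u₀ x)) with hu₀'
  set g' : ℝ → ℝ := fun t => max (-M) (min M (g t)) with hg'
  have eq_u₀ : ∀ᵐ x ∂(volume.restrict (Ioi (0:ℝ))), u₀ x = u₀' x := by
    filter_upwards [lim_u₀, ae_restrict_mem measurableSet_Ioi] with x hx hx0
    exact (clip_eq_self (le_of_tendsto' hx.abs fun n =>
      (hsol n).bound _ ⟨le_rfl, hT.le⟩ _ (mem_Ici.2 (mem_Ioi.1 hx0).le))).symm
  have eq_g : ∀ᵐ t ∂(volume.restrict (Ioc (0:ℝ) T)), g t = g' t := by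
    filter_upwards [ae_restrict_of_ae_restrict_of_subset Ioc_subset_Ioi_self lim_g,
      ae_restrict_mem measurableSet_Ioc] with t ht ht0
    exact (clip_eq_self (le_of_tendsto' ht.abs fun n =>
      (hsol n).bound _ ⟨ht0.1.le, ht0.2⟩ _ (mem_Ici.2 le_rfl))).symm
  have eq_g' : ∀ᵐ t ∂(volume.restrict (Ioo (0:ℝ) T)), g t = g' t :=
    ae_restrict_of_ae_restrict_of_subset Ioo_subset_Ioc_self eq_g
  have hu₀'m : Measurable u₀' := by fun_prop
  have hg'm : Measurable g' := by fun_prop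
  have seq : IsViscousSequence T (M + 1) e (fun n => u (e n)) u₀' g' :=
    { T_pos := hT
      M_pos := by linarith
      e_pos := e_pos
      e_lim := e_lim
      sol := sol (by linarith)
      meas_u₀ := hu₀'m
      meas_g := hg'm
      bound_u₀ := fun x => (abs_clip_le hM _).trans (by linarith)
      bound_g := fun t => (abs_clip_le hM _).trans (by linarith)
      lim_u₀ := fun R hR => by
        refine tendsto_integral_abs_sub_of_ae hR
          (fun n => (hcu n).comp (by fun_prop : Continuous fun x : ℝ => ((0:ℝ), x))) hu₀'m
          (fun n x hx => (hsol n).bound _ ⟨le_rfl, hT.le⟩ _ (mem_Ici.2 hx.1.le))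
          (fun x => abs_clip_le hM _) ?_
        filter_upwards [ae_restrict_of_ae_restrict_of_subset Ioc_subset_Ioi_self lim_u₀,
          ae_restrict_of_ae_restrict_of_subset Ioc_subset_Ioi_self eq_u₀] with x hx hx'
        rwa [← hx']
      lim_g := by
        refine tendsto_integral_abs_sub_of_ae hT.le
          (fun n => (hcu n).comp (by fun_prop : Continuous fun t : ℝ => (t, (0:ℝ)))) hg'm
          (fun n t ht => (hsol n).bound _ ⟨ht.1.le, ht.2⟩ _ (mem_Ici.2 le_rfl))
          (fun t => abs_clip_le hM _) ?_
        filter_upwards [ae_restrict_of_ae_restrict_of_subset Ioc_subset_Ioi_self lim_g,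
          eq_g] with t ht ht'
        rwa [← ht'] }
  obtain ⟨k, hk, f, hf, hfM, hlim, htr⟩ :=
    seq.exists_limit hM (by linarith) hsol fun t => abs_clip_le hM _
  obtain ⟨H, hHm, hH⟩ := exists_measurable_not_integrableOn
  have hmem := ae_restrict_mem (μ := (volume : Measure (ℝ × ℝ)))
    ((measurableSet_Ioo (a := (0:ℝ)) (b := T)).prod (measurableSet_Ioi (a := (0:ℝ))))
  have hseq := seq.comp_strictMono hk
  have hvm : Measurable (Function.uncurry (extendAfter T f H)) := measurable_extendAfter hf hHm
  have hvM : ∀ t ∈ Ioo (0:ℝ) T, ∀ x > (0:ℝ), |extendAfter T f H t x| ≤ M := fun t ht x _ => by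
    rw [extendAfter_of_lt ht.2]
    exact hfM _
  have hv_lim : ∀ᵐ p ∂(volume.restrict ((Ioo (0:ℝ) T) ×ˢ (Ioi (0:ℝ)))),
      Tendsto (fun n => u (e (k n)) p.1 p.2) atTop (nhds (extendAfter T f H p.1 p.2)) := by
    filter_upwards [hlim, hmem] with p hp hpm
    rwa [extendAfter_of_lt hpm.1.2]
  have hP_eq : ∀ n, ∀ t x, P (e (k n)) t x = spePrimitive (u (e (k n))) t x := fun n t x =>
    hPdef _ (e_pos _) t x
  have hvP : ∀ p ∈ (Ioo (0:ℝ) T) ×ˢ (Ioi (0:ℝ)), spePrimitive (extendAfter T f H) p.1 p.2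
      = spePrimitive (fun t x => f (t, x)) p.1 p.2 := fun p hp =>
    spePrimitive_extendAfter_of_lt hp.1.2 f H _
  have hP_lim : ∀ᵐ p ∂(volume.restrict ((Ioo (0:ℝ) T) ×ˢ (Ioi (0:ℝ)))),
      Tendsto (fun n => P (e (k n)) p.1 p.2) atTop
        (nhds (spePrimitive (extendAfter T f H) p.1 p.2)) := by
    filter_upwards [hseq.ae_prod_tendsto_spePrimitive hlim, hmem] with p hp hpm
    rw [hvP p hpm]
    exact hp.congr fun n => (hP_eq n _ _).symm
  have hu_meas : ∀ n (K : Set (ℝ × ℝ)),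
      AEStronglyMeasurable (fun p : ℝ × ℝ => u (e (k n)) p.1 p.2) (volume.restrict K) :=
    fun n K => (hcu _).aestronglyMeasurable
  have hP_meas : ∀ n (K : Set (ℝ × ℝ)),
      AEStronglyMeasurable (fun p : ℝ × ℝ => P (e (k n)) p.1 p.2) (volume.restrict K) := by
    intro n K
    simp only [hP_eq]
    exact (continuous_spePrimitive (hu_two (k n)).continuous).aestronglyMeasurable
  have hvP_meas : AEStronglyMeasurable
      (fun p : ℝ × ℝ => spePrimitive (extendAfter T f H) p.1 p.2)
      (volume.restrict ((Ioo (0:ℝ) T) ×ˢ (Ioi (0:ℝ)))) := by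
    refine (hseq.aestronglyMeasurable_spePrimitive hlim).congr ?_
    filter_upwards [hmem] with p hpm using (hvP p hpm).symm
  have hu_M : ∀ n, ∀ p ∈ (Ioo (0:ℝ) T) ×ˢ (Ioi (0:ℝ)), |u (e (k n)) p.1 p.2| ≤ M :=
    fun n p hp => hu_bound _ (e_pos _) _ hp.1 _ hp.2
  have hv_M : ∀ p ∈ (Ioo (0:ℝ) T) ×ˢ (Ioi (0:ℝ)), |extendAfter T f H p.1 p.2| ≤ M :=
    fun p hp => hvM _ hp.1 _ hp.2
  have hu_Lq : ∀ q : ℝ, 1 ≤ q → ∀ K : Set (ℝ × ℝ), IsCompact K →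
      K ⊆ (Ioo (0:ℝ) T) ×ˢ (Ioi (0:ℝ)) →
      Tendsto (fun n => ∫ p in K, |u (e (k n)) p.1 p.2 - extendAfter T f H p.1 p.2| ^ q)
        atTop (nhds 0) := fun q hq K hK hKs =>
    tendsto_setIntegral_abs_sub_rpow hK.measurableSet hK.measure_lt_top.ne (by linarith)
      (fun n => hu_meas n K) hvm.aestronglyMeasurable (fun n p hp => hu_M n p (hKs hp))
      (fun p hp => hv_M p (hKs hp)) (ae_restrict_of_ae_restrict_of_subset hKs hv_lim)
  refine ⟨fun n => e (k n), fun n => e_pos _, e_lim.comp hk.tendsto_atTop, extendAfter T f H, g,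
    hvm, hvM, hv_lim, hu_Lq, hP_lim, fun q hq K hK hKs => ?_, ?_, fun φ hφ hs hφ0 c => ?_⟩
  · obtain ⟨R, hR0, hR⟩ := hK.exists_nonneg_bound continuous_snd
    have hP_R : ∀ n, ∀ p ∈ K, |P (e (k n)) p.1 p.2| ≤ M * R := fun n p hp => by
      have hp' := hKs hp
      rw [hP_eq]
      exact ((hsol (k n)).abs_primitive_le ⟨hp'.1.1.le, hp'.1.2.le⟩ (mem_Ioi.1 hp'.2).le).trans
        (mul_le_mul_of_nonneg_left ((le_abs_self _).trans (hR p hp)) hM)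
    have hvP_R : ∀ p ∈ K, |spePrimitive (extendAfter T f H) p.1 p.2| ≤ M * R := fun p hp => by
      have hp' := hKs hp
      exact (abs_spePrimitive_le (mem_Ioi.1 hp'.2).le fun y hy => hvM _ hp'.1 _ hy.1).trans
        (mul_le_mul_of_nonneg_left ((le_abs_self _).trans (hR p hp)) hM)
    have hq0 : 0 ≤ q := by linarith
    have hvP_K := hvP_meas.mono_set hKs
    have hP_Lq := tendsto_setIntegral_abs_sub_rpow hK.measurableSet hK.measure_lt_top.ne
      (by linarith : 0 < q) (fun n => hP_meas n K) hvP_K hP_R hvP_R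
      (ae_restrict_of_ae_restrict_of_subset hKs hP_lim)
    have hsum := hP_Lq.add (hu_Lq q hq K hK hKs)
    rw [add_zero] at hsum
    refine hsum.congr fun n => (integral_add ?_ ?_).symm
    · exact integrableOn_abs_sub_rpow hK.measurableSet hK.measure_lt_top.ne hq0 (hP_meas n K)
        hvP_K (hP_R n) hvP_R
    · exact integrableOn_abs_sub_rpow hK.measurableSet hK.measure_lt_top.ne hq0 (hu_meas n K)
        hvm.aestronglyMeasurable (fun p hp => hu_M n p (hKs hp)) (fun p hp => hv_M p (hKs hp))
  · refine htr.congr fun x => integral_congr_ae ?_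
    filter_upwards [eq_g', ae_restrict_mem measurableSet_Ioo] with t ht htm
    rw [ht, extendAfter_of_lt htm.2]
  · refine hseq.entropy_extendAfter hf (fun p => (hfM p).trans (by linarith)) hlim hHm hH eq_u₀
      hg_meas (C := Cg) ?_ eq_g' hφ hs hφ0 c
    filter_upwards [hgε_conv] with t ht
    exact le_of_tendsto ht.abs (eventually_mem_nhdsWithin.mono fun ε hε => hgε_bound ε hε t)
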